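/- Let α* be the unique real number in (−∞, −3·4^{−1/3}) such that the planar system dv/dτ = v·f(v,α*) + z², dz/dτ = z·f(v,α*) admits a solution (v,z) : ℝ → ℝ² with z > 0 everywhere tending to (v₁⁰(α*),0) as τ → −∞ and to (v₃⁰(α*),0) as τ → +∞. Then for every α ∈ (α*, 0), the system ẋ = y, ẏ = −x³ + αx²y + y³ has a nonconstant periodic solution, and any two nonconstant periodic solutions of this system have the same image in ℝ² (i.e., the system has exactly one limit cycle). -/

import Mathlib

open Filter Topology

/-- `f(v,α) = v³ - αv² - 1`. -/
noncomputable def fcubic (v α : ℝ) : ℝ := v ^ 3 - α * v ^ 2 - 1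

/-- The transformed system `dv/dτ = v f(v,α) + z²`, `dz/dτ = z f(v,α)` admits a heteroclinic
solution in the upper half plane, joining the saddle at the smallest root of `f(·,α)` (as
`τ → -∞`) with the saddle at the largest root (as `τ → +∞`). -/
def HasHeteroclinic (α : ℝ) : Prop :=
  ∃ v z : ℝ → ℝ, ∃ v₁ v₃ : ℝ,
    (fcubic v₁ α = 0 ∧ ∀ w : ℝ, fcubic w α = 0 → v₁ ≤ w) ∧
    (fcubic v₃ α = 0 ∧ ∀ w : ℝ, fcubic w α = 0 → w ≤ v₃) ∧
    (∀ τ : ℝ, HasDerivAt v (v τ * fcubic (v τ) α + (z τ) ^ 2) τ ∧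
      HasDerivAt z (z τ * fcubic (v τ) α) τ ∧ 0 < z τ) ∧
    Tendsto (fun τ => (v τ, z τ)) atBot (𝓝 (v₁, 0)) ∧
    Tendsto (fun τ => (v τ, z τ)) atTop (𝓝 (v₃, 0))

/-- `(x,y)` is a solution of `ẋ = y`, `ẏ = -x³ + αx²y + y³`. -/
def IsSolXY (α : ℝ) (x y : ℝ → ℝ) : Prop :=
  ∀ t : ℝ, HasDerivAt x (y t) t ∧
    HasDerivAt y (-(x t) ^ 3 + α * (x t) ^ 2 * y t + (y t) ^ 3) t

/-- `(x,y)` is periodic with some positive period. -/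
def IsPeriodicSol (x y : ℝ → ℝ) : Prop :=
  ∃ T : ℝ, 0 < T ∧ ∀ t : ℝ, x (t + T) = x t ∧ y (t + T) = y t

/-- `(x,y)` is nonconstant. -/
def NonconstSol (x y : ℝ → ℝ) : Prop := ∃ t s : ℝ, (x t, y t) ≠ (x s, y s)

section

open MeasureTheory Set

/-- Differentiation under the integral sign over `[0,1]` for an integrand that is `C¹` near the
slice. -/
theorem hasDerivAt_integral_of_contDiffAt {H : ℝ × ℝ → ℝ} {x₀ : ℝ}
    (hH : ∀ s ∈ Icc (0 : ℝ) 1, ContDiffAt ℝ 1 H (x₀, s)) :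
    HasDerivAt (fun x => ∫ s in (0 : ℝ)..1, H (x, s))
      (∫ s in (0 : ℝ)..1, fderiv ℝ H (x₀, s) (1, 0)) x₀ := by
  set U : Set (ℝ × ℝ) := {p | ContDiffAt ℝ 1 H p} with hU
  have hUo : IsOpen U := by
    rw [isOpen_iff_mem_nhds]
    intro p hp
    have : ∀ᶠ q in 𝓝 p, ContDiffAt ℝ 1 H q := ContDiffAt.eventually hp (by simp)
    exact this
  have hsub : ({x₀} : Set ℝ) ×ˢ Icc (0 : ℝ) 1 ⊆ U := by
    rintro ⟨a, b⟩ ⟨ha, hb⟩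
    simp only [mem_singleton_iff] at ha
    subst ha
    exact hH b hb
  obtain ⟨u, v, hu, hv, hxu, hIv, huv⟩ :=
    generalized_tube_lemma isCompact_singleton isCompact_Icc hUo hsub
  have hxu' : u ∈ 𝓝 x₀ := hu.mem_nhds (hxu rfl)
  obtain ⟨ε, hε, hball⟩ := Metric.nhds_basis_closedBall.mem_iff.mp hxu'
  have hK : Metric.closedBall x₀ ε ×ˢ Icc (0 : ℝ) 1 ⊆ U :=
    (prod_mono hball hIv).trans huv
  have hKc : IsCompact (Metric.closedBall x₀ ε ×ˢ Icc (0 : ℝ) 1) :=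
    (isCompact_closedBall x₀ ε).prod isCompact_Icc
  have hcont : ContinuousOn (fun p => fderiv ℝ H p (1, 0)) U := by
    intro p hp
    have hp' : ContDiffAt ℝ 1 H p := hp
    have h1 : ContinuousAt (fderiv ℝ H) p :=
      (ContDiffAt.fderiv_right (m := 0) hp' (by simp)).continuousAt
    exact (h1.clm_apply continuousAt_const).continuousWithinAt
  have hHc : ContinuousOn H U := fun p hp => by
    have hp' : ContDiffAt ℝ 1 H p := hp
    exact hp'.continuousAt.continuousWithinAt
  obtain ⟨C, hC⟩ := (hKc.image_of_continuousOn (hcont.mono hK)).isBounded.exists_norm_le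
  have hslice : ∀ x ∈ Metric.closedBall x₀ ε, ∀ g : ℝ × ℝ → ℝ, ContinuousOn g U →
      ContinuousOn (fun s => g (x, s)) (Icc (0 : ℝ) 1) := by
    intro x hx g hg
    refine hg.comp (by fun_prop) ?_
    intro s hs
    exact hK ⟨hx, hs⟩
  have h01 : uIoc (0 : ℝ) 1 = Ioc 0 1 := uIoc_of_le zero_le_one
  have hx0 : x₀ ∈ Metric.closedBall x₀ ε := Metric.mem_closedBall_self hε.le
  refine (intervalIntegral.hasDerivAt_integral_of_dominated_loc_of_deriv_le
    (F := fun x s => H (x, s)) (F' := fun x s => fderiv ℝ H (x, s) (1, 0))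
    (bound := fun _ => C) (s := Metric.closedBall x₀ ε) (Metric.closedBall_mem_nhds x₀ hε)
    ?_ ?_ ?_ ?_ ?_ ?_).2
  · filter_upwards [Metric.closedBall_mem_nhds x₀ hε] with x hx
    rw [h01]
    exact ((hslice x hx H hHc).mono Ioc_subset_Icc_self).aestronglyMeasurable measurableSet_Ioc
  · exact (ContinuousOn.intervalIntegrable_of_Icc zero_le_one (hslice x₀ hx0 H hHc))
  · rw [h01]
    exact ((hslice x₀ hx0 _ hcont).mono Ioc_subset_Icc_self).aestronglyMeasurable
      measurableSet_Ioc
  · refine Eventually.of_forall fun s hs x hx => ?_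
    rw [h01] at hs
    exact hC _ ⟨(x, s), ⟨hx, Ioc_subset_Icc_self hs⟩, rfl⟩
  · exact intervalIntegrable_const
  · refine Eventually.of_forall fun s hs x hx => ?_
    rw [h01] at hs
    have hd : ContDiffAt ℝ 1 H (x, s) := hK ⟨hx, Ioc_subset_Icc_self hs⟩
    have h1 := (hd.differentiableAt (by simp)).hasFDerivAt
    have h2 : HasDerivAt (fun x : ℝ => (x, s)) ((1 : ℝ), (0 : ℝ)) x :=
      (hasDerivAt_id x).prodMk (hasDerivAt_const x s)
    exact h1.comp_hasDerivAt x h2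

/-- Leibniz rule for an integral between two moving `C¹` endpoints. -/
theorem hasDerivAt_integral_moving {F : ℝ × ℝ → ℝ} {F' R₁ R₂ : ℝ → ℝ} {θ d₁ d₂ : ℝ}
    (h₁ : ContDiffAt ℝ 1 R₁ θ) (h₂ : ContDiffAt ℝ 1 R₂ θ)
    (hd₁ : HasDerivAt R₁ d₁ θ) (hd₂ : HasDerivAt R₂ d₂ θ) (hle : R₂ θ ≤ R₁ θ)
    (hF : ∀ r ∈ Icc (R₂ θ) (R₁ θ), ContDiffAt ℝ 1 F (θ, r))
    (hF' : ∀ r ∈ Icc (R₂ θ) (R₁ θ), HasDerivAt (fun t => F (t, r)) (F' r) θ) :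
    ContinuousOn F' (Icc (R₂ θ) (R₁ θ)) ∧
    HasDerivAt (fun t => ∫ r in R₂ t..R₁ t, F (t, r))
      (F (θ, R₁ θ) * d₁ - F (θ, R₂ θ) * d₂ + ∫ r in R₂ θ..R₁ θ, F' r) θ := by
  have hcF' : ContinuousOn F' (Icc (R₂ θ) (R₁ θ)) := by
    have h0 : ContinuousOn (fun r => fderiv ℝ F (θ, r) (1, 0)) (Icc (R₂ θ) (R₁ θ)) := by
      intro r hr
      have h1 : ContinuousAt (fderiv ℝ F) (θ, r) :=
        (ContDiffAt.fderiv_right (m := 0) (hF r hr) (by simp)).continuousAt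
      have h2 : ContinuousAt (fun r => fderiv ℝ F (θ, r)) r :=
        ContinuousAt.comp (f := fun r : ℝ => (θ, r)) h1 (by fun_prop)
      exact (h2.clm_apply continuousAt_const).continuousWithinAt
    refine h0.congr fun r hr => ?_
    have h1 := ((hF r hr).differentiableAt (by simp)).hasFDerivAt
    have h2 : HasDerivAt (fun x : ℝ => (x, r)) ((1 : ℝ), (0 : ℝ)) θ :=
      (hasDerivAt_id θ).prodMk (hasDerivAt_const θ r)
    exact (hF' r hr).unique (h1.comp_hasDerivAt θ h2)
  refine ⟨hcF', ?_⟩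
  set H : ℝ × ℝ → ℝ := fun p => F (p.1, R₂ p.1 + (R₁ p.1 - R₂ p.1) * p.2) * (R₁ p.1 - R₂ p.1)
    with hH
  have hmem : ∀ s ∈ Icc (0 : ℝ) 1, R₂ θ + (R₁ θ - R₂ θ) * s ∈ Icc (R₂ θ) (R₁ θ) := by
    intro s hs
    constructor
    · nlinarith [hs.1]
    · nlinarith [hs.2]
  have hHc : ∀ s ∈ Icc (0 : ℝ) 1, ContDiffAt ℝ 1 H (θ, s) := by
    intro s hs
    have g1 : ContDiffAt ℝ 1 (fun p : ℝ × ℝ => R₁ p.1) (θ, s) :=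
      ContDiffAt.comp (θ, s) (g := R₁) (f := Prod.fst) h₁ contDiffAt_fst
    have g2 : ContDiffAt ℝ 1 (fun p : ℝ × ℝ => R₂ p.1) (θ, s) :=
      ContDiffAt.comp (θ, s) (g := R₂) (f := Prod.fst) h₂ contDiffAt_fst
    refine ContDiffAt.mul ?_ (g1.sub g2)
    refine ContDiffAt.comp (θ, s) (g := F)
      (f := fun p : ℝ × ℝ => (p.1, R₂ p.1 + (R₁ p.1 - R₂ p.1) * p.2)) (hF _ (hmem s hs)) ?_
    exact contDiffAt_fst.prodMk (g2.add ((g1.sub g2).mul contDiffAt_snd))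
  have hmain := hasDerivAt_integral_of_contDiffAt hHc
  have hfun : (fun t => ∫ r in R₂ t..R₁ t, F (t, r)) = fun x => ∫ s in (0 : ℝ)..1, H (x, s) := by
    funext t
    have := intervalIntegral.smul_integral_comp_add_mul (a := 0) (b := 1) (fun r => F (t, r))
      (R₁ t - R₂ t) (R₂ t)
    simp only [hH]
    rw [intervalIntegral.integral_mul_const]
    rw [smul_eq_mul, mul_comm] at this
    rw [this]
    congr 1 <;> ring
  rw [hfun]
  convert hmain using 1
  -- identify the derivative
  set γ : ℝ → ℝ := fun s => R₂ θ + (R₁ θ - R₂ θ) * s with hγ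
  set E : ℝ → ℝ := fun s => F (θ, γ s) * (d₂ + (d₁ - d₂) * s) with hE
  have hγd : ∀ s, HasDerivAt γ (R₁ θ - R₂ θ) s := by
    intro s
    have := ((hasDerivAt_id' s).const_mul (R₁ θ - R₂ θ)).const_add (R₂ θ)
    rw [mul_one] at this
    exact this
  have hFd : ∀ s ∈ Icc (0 : ℝ) 1, HasFDerivAt F (fderiv ℝ F (θ, γ s)) (θ, γ s) := fun s hs =>
    ((hF _ (hmem s hs)).differentiableAt (by simp)).hasFDerivAt
  have hFθ : ∀ s ∈ Icc (0 : ℝ) 1, fderiv ℝ F (θ, γ s) (1, 0) = F' (γ s) := by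
    intro s hs
    have h2 : HasDerivAt (fun x : ℝ => (x, γ s)) ((1 : ℝ), (0 : ℝ)) θ :=
      (hasDerivAt_id θ).prodMk (hasDerivAt_const θ _)
    exact ((hFd s hs).comp_hasDerivAt θ h2).unique (hF' _ (hmem s hs))
  have hEd : ∀ s ∈ Icc (0 : ℝ) 1, HasDerivAt E
      (fderiv ℝ F (θ, γ s) (0, 1) * (R₁ θ - R₂ θ) * (d₂ + (d₁ - d₂) * s)
        + F (θ, γ s) * (d₁ - d₂)) s := by
    intro s hs
    have h2 : HasDerivAt (fun x : ℝ => (θ, γ x)) ((0 : ℝ), (R₁ θ - R₂ θ)) s :=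
      (hasDerivAt_const s θ).prodMk (hγd s)
    have h3 := (hFd s hs).comp_hasDerivAt s h2
    have h4 : HasDerivAt (fun s => d₂ + (d₁ - d₂) * s) (d₁ - d₂) s := by
      simpa using ((hasDerivAt_id s).const_mul (d₁ - d₂)).const_add d₂
    have h5 := h3.mul h4
    have h6 : fderiv ℝ F (θ, γ s) (0, R₁ θ - R₂ θ)
        = fderiv ℝ F (θ, γ s) (0, 1) * (R₁ θ - R₂ θ) := by
      have : ((0 : ℝ), R₁ θ - R₂ θ) = (R₁ θ - R₂ θ) • ((0 : ℝ), (1 : ℝ)) := by simp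
      rw [this, map_smul, smul_eq_mul, mul_comm]
    rw [h6] at h5
    exact h5
  have hHd : ∀ s ∈ Icc (0 : ℝ) 1, fderiv ℝ H (θ, s) (1, 0) =
      F' (γ s) * (R₁ θ - R₂ θ) + (fderiv ℝ F (θ, γ s) (0, 1) * (R₁ θ - R₂ θ) *
        (d₂ + (d₁ - d₂) * s) + F (θ, γ s) * (d₁ - d₂)) := by
    intro s hs
    have h1 := ((hHc s hs).differentiableAt (by simp)).hasFDerivAt
    have h2 : HasDerivAt (fun x : ℝ => (x, s)) ((1 : ℝ), (0 : ℝ)) θ :=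
      (hasDerivAt_id θ).prodMk (hasDerivAt_const θ s)
    have h3 := h1.comp_hasDerivAt θ h2
    have hδ : HasDerivAt (fun t => R₁ t - R₂ t) (d₁ - d₂) θ := hd₁.sub hd₂
    have h4 : HasDerivAt (fun t => (t, R₂ t + (R₁ t - R₂ t) * s))
        ((1 : ℝ), d₂ + (d₁ - d₂) * s) θ :=
      (hasDerivAt_id θ).prodMk (hd₂.add (hδ.mul_const s))
    have h5 := ((hFd s hs).comp_hasDerivAt θ h4).mul hδ
    have h6 : fderiv ℝ F (θ, γ s) (1, d₂ + (d₁ - d₂) * s)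
        = fderiv ℝ F (θ, γ s) (1, 0) + fderiv ℝ F (θ, γ s) (0, 1) * (d₂ + (d₁ - d₂) * s) := by
      have : ((1 : ℝ), d₂ + (d₁ - d₂) * s)
          = (1, 0) + (d₂ + (d₁ - d₂) * s) • ((0 : ℝ), (1 : ℝ)) := by simp
      rw [this, map_add, map_smul, smul_eq_mul, mul_comm]
    have h7 := h3.unique h5
    rw [h7, h6, hFθ s hs]
    simp only [Function.comp, hγ]
    ring
  have hγc : ContinuousOn γ (Icc (0 : ℝ) 1) := fun s _ => (hγd s).continuousAt.continuousWithinAt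
  have hE' : ContinuousOn (fun s => fderiv ℝ F (θ, γ s) (0, 1) * (R₁ θ - R₂ θ) *
        (d₂ + (d₁ - d₂) * s) + F (θ, γ s) * (d₁ - d₂)) (Icc (0 : ℝ) 1) := by
    have hcF : ContinuousOn (fun s => F (θ, γ s)) (Icc (0 : ℝ) 1) := fun s hs =>
      (ContinuousAt.comp (f := fun s => (θ, γ s)) (hF _ (hmem s hs)).continuousAt
        ((continuousAt_const).prodMk (hγd s).continuousAt)).continuousWithinAt
    have hcD : ContinuousOn (fun s => fderiv ℝ F (θ, γ s) (0, 1)) (Icc (0 : ℝ) 1) := by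
      intro s hs
      have h1 : ContinuousAt (fderiv ℝ F) (θ, γ s) :=
        (ContDiffAt.fderiv_right (m := 0) (hF _ (hmem s hs)) (by simp)).continuousAt
      have h2 : ContinuousAt (fun s => fderiv ℝ F (θ, γ s)) s :=
        ContinuousAt.comp (f := fun s : ℝ => (θ, γ s)) h1
          ((continuousAt_const).prodMk (hγd s).continuousAt)
      exact (h2.clm_apply continuousAt_const).continuousWithinAt
    exact ((hcD.mul continuousOn_const).mul (by fun_prop)).add (hcF.mul continuousOn_const)
  have hF'c : ContinuousOn (fun s => F' (γ s) * (R₁ θ - R₂ θ)) (Icc (0 : ℝ) 1) :=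
    (hcF'.comp hγc (fun s hs => hmem s hs)).mul continuousOn_const
  have hI1 : ∫ s in (0 : ℝ)..1, (fderiv ℝ F (θ, γ s) (0, 1) * (R₁ θ - R₂ θ) *
        (d₂ + (d₁ - d₂) * s) + F (θ, γ s) * (d₁ - d₂)) = E 1 - E 0 := by
    refine intervalIntegral.integral_eq_sub_of_hasDerivAt ?_ ?_
    · intro s hs
      rw [uIcc_of_le zero_le_one] at hs
      exact hEd s hs
    · exact ContinuousOn.intervalIntegrable_of_Icc zero_le_one hE'
  have hI2 : ∫ s in (0 : ℝ)..1, F' (γ s) * (R₁ θ - R₂ θ) = ∫ r in R₂ θ..R₁ θ, F' r := by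
    have := intervalIntegral.smul_integral_comp_add_mul (a := 0) (b := 1) F'
      (R₁ θ - R₂ θ) (R₂ θ)
    rw [intervalIntegral.integral_mul_const]
    rw [smul_eq_mul, mul_comm] at this
    rw [this]
    congr 1 <;> ring
  have hI : ∫ s in (0 : ℝ)..1, fderiv ℝ H (θ, s) (1, 0)
      = (∫ r in R₂ θ..R₁ θ, F' r) + (E 1 - E 0) := by
    rw [← hI1, ← hI2, ← intervalIntegral.integral_add
      (ContinuousOn.intervalIntegrable_of_Icc zero_le_one hF'c)
      (ContinuousOn.intervalIntegrable_of_Icc zero_le_one hE')]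
    refine intervalIntegral.integral_congr fun s hs => ?_
    rw [uIcc_of_le zero_le_one] at hs
    exact hHd s hs
  rw [hI]
  simp only [hE, hγ]
  have e1 : R₂ θ + (R₁ θ - R₂ θ) * 1 = R₁ θ := by ring
  have e2 : R₂ θ + (R₁ θ - R₂ θ) * 0 = R₂ θ := by ring
  rw [e1, e2]
  ring

/-- The angular speed `-θ̇` of the system in the polar coordinates `R = x² + y²`, `θ`. -/
noncomputable def nF (A θ r : ℝ) : ℝ :=
  Real.sin θ ^ 2 + r * (Real.cos θ ^ 4 + A * Real.cos θ ^ 3 * Real.sin θ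
    - Real.cos θ * Real.sin θ ^ 3)

/-- The radial speed `-Ṙ` of the system in the polar coordinates `R = x² + y²`, `θ`. -/
noncomputable def eF (A θ r : ℝ) : ℝ :=
  -2 * r * (Real.cos θ * Real.sin θ + r * (-(Real.cos θ ^ 3 * Real.sin θ)
    - A * Real.cos θ ^ 2 * Real.sin θ ^ 2 + Real.sin θ ^ 4))

/-- `R` is an orbit in polar coordinates, parametrised by the angle. -/
def IsPol (A : ℝ) (R : ℝ → ℝ) : Prop :=
  ∀ θ, 0 < R θ ∧ 0 < nF A θ (R θ) ∧ HasDerivAt R (eF A θ (R θ) / nF A θ (R θ)) θ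

/-- The weighted flux between two curves, with density `exp b`. -/
noncomputable def jF (A : ℝ) (b : ℝ × ℝ → ℝ) (θ r₁ r₂ : ℝ) : ℝ :=
  ∫ r in r₂..r₁, Real.exp (b (θ, r)) * nF A θ r

theorem contDiff_nF (A : ℝ) : ContDiff ℝ 1 (fun p : ℝ × ℝ => nF A p.1 p.2) := by
  unfold nF; fun_prop

theorem nF_add_pi (A θ r : ℝ) : nF A (θ + Real.pi) r = nF A θ r := by
  simp only [nF, Real.sin_add_pi, Real.cos_add_pi]; ring

theorem eF_add_pi (A θ r : ℝ) : eF A (θ + Real.pi) r = eF A θ r := by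
  simp only [eF, Real.sin_add_pi, Real.cos_add_pi]; ring

theorem hasDerivAt_nF_angle (A θ r : ℝ) : HasDerivAt (fun t => nF A t r)
    (2 * Real.sin θ * Real.cos θ + r * (-4 * Real.cos θ ^ 3 * Real.sin θ
      + A * (-3 * Real.cos θ ^ 2 * Real.sin θ ^ 2 + Real.cos θ ^ 4)
      + Real.sin θ ^ 4 - 3 * Real.cos θ ^ 2 * Real.sin θ ^ 2)) θ := by
  have hs := Real.hasDerivAt_sin θ
  have hc := Real.hasDerivAt_cos θ
  have := (hs.pow 2).add ((((hc.pow 4).add (((hc.pow 3).const_mul A).mul hs)).sub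
    (hc.mul (hs.pow 3))).const_mul r)
  refine this.congr_deriv ?_
  simp only [Pi.pow_apply]
  push_cast
  ring

theorem hasDerivAt_eF_radius (A θ r : ℝ) : HasDerivAt (fun t => eF A θ t)
    (-2 * (Real.cos θ * Real.sin θ + 2 * r * (-(Real.cos θ ^ 3 * Real.sin θ)
      - A * Real.cos θ ^ 2 * Real.sin θ ^ 2 + Real.sin θ ^ 4))) r := by
  have h := hasDerivAt_id' r
  have := (h.const_mul (-2)).mul ((h.mul_const (-(Real.cos θ ^ 3 * Real.sin θ)
      - A * Real.cos θ ^ 2 * Real.sin θ ^ 2 + Real.sin θ ^ 4)).const_add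
        (Real.cos θ * Real.sin θ))
  refine this.congr_deriv ?_
  ring

/-- The divergence of the polar field. -/
theorem polar_div (A θ r : ℝ) :
    (2 * Real.sin θ * Real.cos θ + r * (-4 * Real.cos θ ^ 3 * Real.sin θ
      + A * (-3 * Real.cos θ ^ 2 * Real.sin θ ^ 2 + Real.cos θ ^ 4)
      + Real.sin θ ^ 4 - 3 * Real.cos θ ^ 2 * Real.sin θ ^ 2))
    + (-2 * (Real.cos θ * Real.sin θ + 2 * r * (-(Real.cos θ ^ 3 * Real.sin θ)
      - A * Real.cos θ ^ 2 * Real.sin θ ^ 2 + Real.sin θ ^ 4)))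
    = -r * (3 * Real.sin θ ^ 2 - A * Real.cos θ ^ 2) := by
  linear_combination (r * (3 * Real.sin θ ^ 2 - A * Real.cos θ ^ 2) * -1)
    * (Real.sin_sq_add_cos_sq θ)

/-- The derivative of the weighted flux between a supersolution and a subsolution. -/
theorem jF_deriv {A θ d₁ d₂ : ℝ} {b : ℝ × ℝ → ℝ} {bθ bR R₁ R₂ : ℝ → ℝ}
    (h₁ : ContDiffAt ℝ 1 R₁ θ) (h₂ : ContDiffAt ℝ 1 R₂ θ)
    (hd₁ : HasDerivAt R₁ d₁ θ) (hd₂ : HasDerivAt R₂ d₂ θ) (hle : R₂ θ ≤ R₁ θ)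
    (hb : ∀ r ∈ Icc (R₂ θ) (R₁ θ), ContDiffAt ℝ 1 b (θ, r))
    (hbθ : ∀ r ∈ Icc (R₂ θ) (R₁ θ), HasDerivAt (fun t => b (t, r)) (bθ r) θ)
    (hbR : ∀ r ∈ Icc (R₂ θ) (R₁ θ), HasDerivAt (fun t => b (θ, t)) (bR r) r)
    (hs₁ : d₁ * nF A θ (R₁ θ) ≤ eF A θ (R₁ θ)) (hs₂ : eF A θ (R₂ θ) ≤ d₂ * nF A θ (R₂ θ)) :
    ∃ d D, HasDerivAt (fun t => jF A b t (R₁ t) (R₂ t)) d θ ∧ d ≤ D ∧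
      ContinuousOn (fun r => Real.exp (b (θ, r)) *
        (nF A θ r * bθ r + eF A θ r * bR r - r * (3 * Real.sin θ ^ 2 - A * Real.cos θ ^ 2)))
        (Icc (R₂ θ) (R₁ θ)) ∧
      D = ∫ r in R₂ θ..R₁ θ, Real.exp (b (θ, r)) *
        (nF A θ r * bθ r + eF A θ r * bR r - r * (3 * Real.sin θ ^ 2 - A * Real.cos θ ^ 2)) := by
  set F : ℝ × ℝ → ℝ := fun p => Real.exp (b p) * nF A p.1 p.2 with hFdef
  set nθ : ℝ → ℝ := fun r => (2 * Real.sin θ * Real.cos θ + r * (-4 * Real.cos θ ^ 3 * Real.sin θ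
      + A * (-3 * Real.cos θ ^ 2 * Real.sin θ ^ 2 + Real.cos θ ^ 4)
      + Real.sin θ ^ 4 - 3 * Real.cos θ ^ 2 * Real.sin θ ^ 2)) with hnθ
  set eR : ℝ → ℝ := fun r => (-2 * (Real.cos θ * Real.sin θ + 2 * r * (-(Real.cos θ ^ 3 * Real.sin θ)
      - A * Real.cos θ ^ 2 * Real.sin θ ^ 2 + Real.sin θ ^ 4))) with heR
  set F' : ℝ → ℝ := fun r => Real.exp (b (θ, r)) * bθ r * nF A θ r + Real.exp (b (θ, r)) * nθ r
    with hF'def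
  have hF : ∀ r ∈ Icc (R₂ θ) (R₁ θ), ContDiffAt ℝ 1 F (θ, r) := fun r hr =>
    (hb r hr).exp.mul (contDiff_nF A).contDiffAt
  have hF' : ∀ r ∈ Icc (R₂ θ) (R₁ θ), HasDerivAt (fun t => F (t, r)) (F' r) θ := fun r hr =>
    (hbθ r hr).exp.mul (hasDerivAt_nF_angle A θ r)
  obtain ⟨hc, hd⟩ := hasDerivAt_integral_moving h₁ h₂ hd₁ hd₂ hle hF hF'
  set G' : ℝ → ℝ := fun r => Real.exp (b (θ, r)) * bR r * eF A θ r + Real.exp (b (θ, r)) * eR r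
    with hG'def
  have hG' : ∀ r ∈ Icc (R₂ θ) (R₁ θ),
      HasDerivAt (fun t => Real.exp (b (θ, t)) * eF A θ t) (G' r) r := fun r hr =>
    (hbR r hr).exp.mul (hasDerivAt_eF_radius A θ r)
  have hcb : ContinuousOn (fun r => b (θ, r)) (Icc (R₂ θ) (R₁ θ)) := fun r hr =>
    (ContinuousAt.comp (f := fun r : ℝ => (θ, r)) (hb r hr).continuousAt
      (by fun_prop)).continuousWithinAt
  have hcbR : ContinuousOn bR (Icc (R₂ θ) (R₁ θ)) := by
    have h0 : ContinuousOn (fun r => fderiv ℝ b (θ, r) (0, 1)) (Icc (R₂ θ) (R₁ θ)) := by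
      intro r hr
      have h1 : ContinuousAt (fderiv ℝ b) (θ, r) :=
        (ContDiffAt.fderiv_right (m := 0) (hb r hr) (by simp)).continuousAt
      have h2 : ContinuousAt (fun r => fderiv ℝ b (θ, r)) r :=
        ContinuousAt.comp (f := fun r : ℝ => (θ, r)) h1 (by fun_prop)
      exact (h2.clm_apply continuousAt_const).continuousWithinAt
    refine h0.congr fun r hr => ?_
    have h1 := ((hb r hr).differentiableAt (by simp)).hasFDerivAt
    have h2 : HasDerivAt (fun x : ℝ => (θ, x)) ((0 : ℝ), (1 : ℝ)) r :=
      (hasDerivAt_const r θ).prodMk (hasDerivAt_id r)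
    exact (hbR r hr).unique (h1.comp_hasDerivAt r h2)
  have hce : Continuous (fun r => eF A θ r) := by unfold eF; fun_prop
  have hcG : ContinuousOn G' (Icc (R₂ θ) (R₁ θ)) := by
    refine ((hcb.rexp.mul hcbR).mul hce.continuousOn).add (hcb.rexp.mul ?_)
    simp only [heR]; fun_prop
  have h_int : ∫ r in R₂ θ..R₁ θ, G' r =
      Real.exp (b (θ, R₁ θ)) * eF A θ (R₁ θ) - Real.exp (b (θ, R₂ θ)) * eF A θ (R₂ θ) := by
    refine intervalIntegral.integral_eq_sub_of_hasDerivAt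
      (f := fun t => Real.exp (b (θ, t)) * eF A θ t) ?_ ?_
    · intro r hr
      rw [uIcc_of_le hle] at hr
      exact hG' r hr
    · exact ContinuousOn.intervalIntegrable_of_Icc hle hcG
  have key : ∀ r, Real.exp (b (θ, r)) *
        (nF A θ r * bθ r + eF A θ r * bR r - r * (3 * Real.sin θ ^ 2 - A * Real.cos θ ^ 2))
        = G' r + F' r := by
    intro r
    have := polar_div A θ r
    simp only [hG'def, hF'def]
    have h2 : nθ r + eR r = -r * (3 * Real.sin θ ^ 2 - A * Real.cos θ ^ 2) := this
    linear_combination (-Real.exp (b (θ, r))) * h2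
  refine ⟨_, _, hd, ?_, ?_, rfl⟩
  · simp only [key]
    rw [intervalIntegral.integral_add (ContinuousOn.intervalIntegrable_of_Icc hle hcG)
      (ContinuousOn.intervalIntegrable_of_Icc hle hc), h_int]
    simp only [hFdef]
    have e1 := Real.exp_pos (b (θ, R₁ θ))
    have e2 := Real.exp_pos (b (θ, R₂ θ))
    have := mul_le_mul_of_nonneg_left hs₁ e1.le
    have := mul_le_mul_of_nonneg_left hs₂ e2.le
    linarith
  · simp only [key]
    exact hcG.add hc

/-- If the weighted divergence is negative the weighted flux strictly decreases. -/
theorem jF_lt {A a c : ℝ} (hac : a < c) {b : ℝ × ℝ → ℝ} {bθ bR : ℝ → ℝ → ℝ} {R₁ R₂ d₁ d₂ : ℝ → ℝ}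
    (h₁ : ∀ θ ∈ Icc a c, ContDiffAt ℝ 1 R₁ θ) (h₂ : ∀ θ ∈ Icc a c, ContDiffAt ℝ 1 R₂ θ)
    (hd₁ : ∀ θ ∈ Icc a c, HasDerivAt R₁ (d₁ θ) θ) (hd₂ : ∀ θ ∈ Icc a c, HasDerivAt R₂ (d₂ θ) θ)
    (hlt : ∀ θ ∈ Icc a c, R₂ θ < R₁ θ)
    (hb : ∀ θ ∈ Icc a c, ∀ r ∈ Icc (R₂ θ) (R₁ θ), ContDiffAt ℝ 1 b (θ, r))
    (hbθ : ∀ θ ∈ Icc a c, ∀ r ∈ Icc (R₂ θ) (R₁ θ), HasDerivAt (fun t => b (t, r)) (bθ θ r) θ)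
    (hbR : ∀ θ ∈ Icc a c, ∀ r ∈ Icc (R₂ θ) (R₁ θ), HasDerivAt (fun t => b (θ, t)) (bR θ r) r)
    (hs₁ : ∀ θ ∈ Icc a c, d₁ θ * nF A θ (R₁ θ) ≤ eF A θ (R₁ θ))
    (hs₂ : ∀ θ ∈ Icc a c, eF A θ (R₂ θ) ≤ d₂ θ * nF A θ (R₂ θ))
    (hD : ∀ θ ∈ Icc a c, ∀ r ∈ Icc (R₂ θ) (R₁ θ), nF A θ r * bθ θ r + eF A θ r * bR θ r
      - r * (3 * Real.sin θ ^ 2 - A * Real.cos θ ^ 2) < 0) :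
    jF A b c (R₁ c) (R₂ c) < jF A b a (R₁ a) (R₂ a) := by
  have main : ∀ θ ∈ Icc a c, ∃ d, HasDerivAt (fun t => jF A b t (R₁ t) (R₂ t)) d θ ∧ d < 0 := by
    intro θ hθ
    obtain ⟨d, D, hd, hdD, hcont, hDe⟩ := jF_deriv (h₁ θ hθ) (h₂ θ hθ) (hd₁ θ hθ) (hd₂ θ hθ)
      (hlt θ hθ).le (hb θ hθ) (hbθ θ hθ) (hbR θ hθ) (hs₁ θ hθ) (hs₂ θ hθ)
    refine ⟨d, hd, hdD.trans_lt ?_⟩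
    rw [hDe]
    have := intervalIntegral.intervalIntegral_pos_of_pos_on
      (f := fun r => -(Real.exp (b (θ, r)) *
        (nF A θ r * bθ θ r + eF A θ r * bR θ r - r * (3 * Real.sin θ ^ 2 - A * Real.cos θ ^ 2))))
      (ContinuousOn.intervalIntegrable_of_Icc (hlt θ hθ).le hcont.neg)
      (fun r hr => by
        have := hD θ hθ r (Ioo_subset_Icc_self hr)
        have := mul_pos (Real.exp_pos (b (θ, r))) (neg_pos.mpr this)
        linarith) (hlt θ hθ)
    rw [intervalIntegral.integral_neg] at this
    linarith
  choose! d hd hdn using main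
  have : StrictAntiOn (fun t => jF A b t (R₁ t) (R₂ t)) (Icc a c) := by
    refine strictAntiOn_of_deriv_neg (convex_Icc a c)
      (fun θ hθ => (hd θ hθ).continuousAt.continuousWithinAt) fun θ hθ => ?_
    rw [interior_Icc] at hθ
    rw [(hd θ (Ioo_subset_Icc_self hθ)).deriv]
    exact hdn θ (Ioo_subset_Icc_self hθ)
  exact this (left_mem_Icc.mpr hac.le) (right_mem_Icc.mpr hac.le) hac

/-- A bound for the weighted divergence by a multiple `-μ` of the angular speed gives exponential
decay of the weighted flux. -/
theorem jF_le {A a c : ℝ} (hac : a ≤ c) {b : ℝ × ℝ → ℝ} {bθ bR : ℝ → ℝ → ℝ}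
    {R₁ R₂ d₁ d₂ Λ μ : ℝ → ℝ}
    (h₁ : ∀ θ ∈ Icc a c, ContDiffAt ℝ 1 R₁ θ) (h₂ : ∀ θ ∈ Icc a c, ContDiffAt ℝ 1 R₂ θ)
    (hd₁ : ∀ θ ∈ Icc a c, HasDerivAt R₁ (d₁ θ) θ) (hd₂ : ∀ θ ∈ Icc a c, HasDerivAt R₂ (d₂ θ) θ)
    (hlt : ∀ θ ∈ Icc a c, R₂ θ ≤ R₁ θ)
    (hb : ∀ θ ∈ Icc a c, ∀ r ∈ Icc (R₂ θ) (R₁ θ), ContDiffAt ℝ 1 b (θ, r))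
    (hbθ : ∀ θ ∈ Icc a c, ∀ r ∈ Icc (R₂ θ) (R₁ θ), HasDerivAt (fun t => b (t, r)) (bθ θ r) θ)
    (hbR : ∀ θ ∈ Icc a c, ∀ r ∈ Icc (R₂ θ) (R₁ θ), HasDerivAt (fun t => b (θ, t)) (bR θ r) r)
    (hs₁ : ∀ θ ∈ Icc a c, d₁ θ * nF A θ (R₁ θ) ≤ eF A θ (R₁ θ))
    (hs₂ : ∀ θ ∈ Icc a c, eF A θ (R₂ θ) ≤ d₂ θ * nF A θ (R₂ θ))
    (hΛ : ∀ θ ∈ Icc a c, HasDerivAt Λ (μ θ) θ)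
    (hD : ∀ θ ∈ Icc a c, ∀ r ∈ Icc (R₂ θ) (R₁ θ), nF A θ r * bθ θ r + eF A θ r * bR θ r
      - r * (3 * Real.sin θ ^ 2 - A * Real.cos θ ^ 2) ≤ -μ θ * nF A θ r) :
    jF A b c (R₁ c) (R₂ c) * Real.exp (Λ c) ≤ jF A b a (R₁ a) (R₂ a) * Real.exp (Λ a) := by
  have main : ∀ θ ∈ Icc a c, ∃ d, HasDerivAt (fun t => jF A b t (R₁ t) (R₂ t)) d θ ∧
      d ≤ -μ θ * jF A b θ (R₁ θ) (R₂ θ) := by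
    intro θ hθ
    obtain ⟨d, D, hd, hdD, hcont, hDe⟩ := jF_deriv (h₁ θ hθ) (h₂ θ hθ) (hd₁ θ hθ) (hd₂ θ hθ)
      (hlt θ hθ) (hb θ hθ) (hbθ θ hθ) (hbR θ hθ) (hs₁ θ hθ) (hs₂ θ hθ)
    refine ⟨d, hd, hdD.trans ?_⟩
    rw [hDe, jF, ← intervalIntegral.integral_const_mul]
    have hcb : ContinuousOn (fun r => b (θ, r)) (Icc (R₂ θ) (R₁ θ)) := fun r hr =>
      (ContinuousAt.comp (f := fun r : ℝ => (θ, r)) (hb θ hθ r hr).continuousAt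
        (by fun_prop)).continuousWithinAt
    have hcn : Continuous (fun r => nF A θ r) := by unfold nF; fun_prop
    refine intervalIntegral.integral_mono_on (hlt θ hθ)
      (ContinuousOn.intervalIntegrable_of_Icc (hlt θ hθ) hcont)
      (ContinuousOn.intervalIntegrable_of_Icc (hlt θ hθ)
        (continuousOn_const.mul (hcb.rexp.mul hcn.continuousOn))) fun r hr => ?_
    have := mul_le_mul_of_nonneg_left (hD θ hθ r hr) (Real.exp_pos (b (θ, r))).le
    linarith
  choose! d hd hdn using main
  have : AntitoneOn (fun t => jF A b t (R₁ t) (R₂ t) * Real.exp (Λ t)) (Icc a c) := by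
    have hder : ∀ θ ∈ Icc a c, HasDerivAt
        (fun t => jF A b t (R₁ t) (R₂ t) * Real.exp (Λ t)) _ θ := fun θ hθ =>
      (hd θ hθ).mul (hΛ θ hθ).exp
    refine antitoneOn_of_deriv_nonpos (convex_Icc a c)
      (fun θ hθ => (hder θ hθ).continuousAt.continuousWithinAt)
      (fun θ hθ => (hder θ (interior_subset hθ)).differentiableAt.differentiableWithinAt)
      fun θ hθ => ?_
    have hθ' := interior_subset hθ
    rw [(hder θ hθ').deriv]
    have := mul_le_mul_of_nonneg_right (hdn θ hθ') (Real.exp_pos (Λ θ)).le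
    linarith
  exact this (left_mem_Icc.mpr hac) (right_mem_Icc.mpr hac) hac

theorem continuous_nF_comp (A : ℝ) {R : ℝ → ℝ} (hR : Continuous R) :
    Continuous (fun θ => nF A θ (R θ)) := by
  unfold nF; fun_prop

theorem continuous_eF_comp (A : ℝ) {R : ℝ → ℝ} (hR : Continuous R) :
    Continuous (fun θ => eF A θ (R θ)) := by
  unfold eF; fun_prop

theorem IsPol.contDiff {A : ℝ} {R : ℝ → ℝ} (h : IsPol A R) : ContDiff ℝ 1 R := by
  rw [contDiff_one_iff_deriv]
  have hR : Differentiable ℝ R := fun θ => (h θ).2.2.differentiableAt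
  refine ⟨hR, ?_⟩
  have : deriv R = fun θ => eF A θ (R θ) / nF A θ (R θ) := funext fun θ => (h θ).2.2.deriv
  rw [this]
  exact (continuous_eF_comp A hR.continuous).div (continuous_nF_comp A hR.continuous)
    fun θ => (h θ).2.1.ne'

theorem IsPol.shift {A : ℝ} {R : ℝ → ℝ} (h : IsPol A R) :
    IsPol A (fun θ => R (θ + Real.pi)) := by
  intro θ
  obtain ⟨h1, h2, h3⟩ := h (θ + Real.pi)
  rw [nF_add_pi, eF_add_pi] at h3
  rw [nF_add_pi] at h2
  exact ⟨h1, h2, h3.comp_add_const θ Real.pi⟩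

/-- The divided difference of the slope `eF / nF` in the radius. -/
noncomputable def ddF (A θ r s : ℝ) : ℝ :=
  -2 * (Real.sin θ ^ 2 * (Real.cos θ * Real.sin θ)
    + (-(Real.cos θ ^ 3 * Real.sin θ) - A * Real.cos θ ^ 2 * Real.sin θ ^ 2 + Real.sin θ ^ 4)
      * (Real.sin θ ^ 2 * (r + s) + (Real.cos θ ^ 4 + A * Real.cos θ ^ 3 * Real.sin θ
    - Real.cos θ * Real.sin θ ^ 3) * (r * s)))

theorem ddF_spec (A θ r s : ℝ) :
    eF A θ r * nF A θ s - eF A θ s * nF A θ r = (r - s) * ddF A θ r s := by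
  simp only [eF, nF, ddF]; ring

/-- A differential inequality `D' ≥ c D` preserves nonnegativity. -/
theorem nonneg_of_deriv_ge {D D' c : ℝ → ℝ} {a b : ℝ} (hab : a ≤ b) (hc : ContinuousOn c (Icc a b))
    (hD : ∀ t ∈ Icc a b, HasDerivAt D (D' t) t) (hle : ∀ t ∈ Icc a b, c t * D t ≤ D' t)
    (ha : 0 ≤ D a) : 0 ≤ D b := by
  set k : ℝ → ℝ := fun t => c (projIcc a b hab t) with hk
  have hkc : Continuous k := by
    have := continuousOn_iff_continuous_domRestrict.mp hc
    exact this.comp continuous_projIcc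
  have hkd : ∀ t, HasDerivAt (fun t => ∫ s in a..t, k s) (k t) t := fun t =>
    intervalIntegral.integral_hasDerivAt_right (hkc.intervalIntegrable _ _)
      (hkc.stronglyMeasurableAtFilter _ _) hkc.continuousAt
  set E : ℝ → ℝ := fun t => D t * Real.exp (-∫ s in a..t, k s) with hE
  have hEd : ∀ t ∈ Icc a b, HasDerivAt E (D' t * Real.exp (-∫ s in a..t, k s)
      + D t * (Real.exp (-∫ s in a..t, k s) * (-k t))) t := fun t ht =>
    (hD t ht).mul (hkd t).neg.exp
  have hmono : MonotoneOn E (Icc a b) := by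
    refine monotoneOn_of_deriv_nonneg (convex_Icc a b)
      (fun t ht => (hEd t ht).continuousAt.continuousWithinAt)
      (fun t ht => (hEd t (interior_subset ht)).differentiableAt.differentiableWithinAt)
      fun t ht => ?_
    have ht' := interior_subset ht
    rw [(hEd t ht').deriv]
    have e : k t = c t := by simp only [hk, projIcc_of_mem hab ht']
    rw [e]
    have := mul_le_mul_of_nonneg_right (hle t ht') (Real.exp_pos (-∫ s in a..t, k s)).le
    linarith
  have := hmono (left_mem_Icc.mpr hab) (right_mem_Icc.mpr hab) hab
  have hEa : 0 ≤ E a := mul_nonneg ha (Real.exp_pos _).le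
  exact nonneg_of_mul_nonneg_left (hEa.trans this) (Real.exp_pos _)

/-- Two polar orbits are ordered. -/
theorem IsPol.sub_formula {A : ℝ} {R S : ℝ → ℝ} (hR : IsPol A R) (hS : IsPol A S) :
    ∃ E : ℝ → ℝ, ∀ θ, R θ - S θ = (R 0 - S 0) * Real.exp (E θ) := by
  have hcR := hR.contDiff.continuous
  have hcS := hS.contDiff.continuous
  set k : ℝ → ℝ := fun θ => ddF A θ (R θ) (S θ) / (nF A θ (R θ) * nF A θ (S θ)) with hk
  have hkc : Continuous k := by
    have h1 := continuous_nF_comp A hcR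
    have h2 := continuous_nF_comp A hcS
    refine Continuous.div ?_ (h1.mul h2) fun θ => (mul_pos (hR θ).2.1 (hS θ).2.1).ne'
    unfold ddF; fun_prop
  have hkd : ∀ t, HasDerivAt (fun t => ∫ s in (0 : ℝ)..t, k s) (k t) t := fun t =>
    intervalIntegral.integral_hasDerivAt_right (hkc.intervalIntegrable _ _)
      (hkc.stronglyMeasurableAtFilter _ _) hkc.continuousAt
  refine ⟨fun t => ∫ s in (0 : ℝ)..t, k s, fun θ => ?_⟩
  have hder : ∀ t, HasDerivAt (fun t => (R t - S t) * Real.exp (-∫ s in (0 : ℝ)..t, k s)) 0 t := by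
    intro t
    refine (((hR t).2.2.sub (hS t).2.2).mul (hkd t).neg.exp).congr_deriv ?_
    have h1 := (hR t).2.1.ne'
    have h2 := (hS t).2.1.ne'
    have h3 : eF A t (R t) / nF A t (R t) - eF A t (S t) / nF A t (S t)
        = (R t - S t) * k t := by
      simp only [hk]
      rw [div_sub_div _ _ h1 h2, ← mul_div_assoc, ← ddF_spec]
      congr 1; ring
    simp only [Pi.sub_apply]
    rw [h3]; ring
  have hconst := is_const_of_deriv_eq_zero (fun t => (hder t).differentiableAt)
    (fun t => (hder t).deriv) θ 0
  simp only [intervalIntegral.integral_same, neg_zero, Real.exp_zero, mul_one] at hconst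
  rw [← hconst, mul_assoc, ← Real.exp_add]
  simp

theorem IsPol.ext_of_eq {A : ℝ} {R S : ℝ → ℝ} (hR : IsPol A R) (hS : IsPol A S) {θ₀ : ℝ}
    (h : R θ₀ = S θ₀) : R = S := by
  obtain ⟨E, hE⟩ := hR.sub_formula hS
  have h0 : R 0 - S 0 = 0 := by
    have := hE θ₀
    rw [h, sub_self] at this
    rcases mul_eq_zero.mp this.symm with h | h
    · exact h
    · exact absurd h (Real.exp_pos _).ne'
  funext θ
  have := hE θ
  rw [h0, zero_mul] at this
  linarith

theorem IsPol.lt_of_lt {A : ℝ} {R S : ℝ → ℝ} (hR : IsPol A R) (hS : IsPol A S) {θ₀ : ℝ}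
    (h : R θ₀ < S θ₀) (θ : ℝ) : R θ < S θ := by
  obtain ⟨E, hE⟩ := hR.sub_formula hS
  have h0 : R 0 - S 0 < 0 := by
    by_contra hc
    have := hE θ₀
    have := mul_nonneg (not_lt.mp hc) (Real.exp_pos (E θ₀)).le
    linarith
  have := hE θ
  have := mul_neg_of_neg_of_pos h0 (Real.exp_pos (E θ))
  linarith

/-- A polar orbit that closes up after some turns is `π`-periodic. -/
theorem IsPol.periodic_pi {A : ℝ} {R : ℝ → ℝ} (hR : IsPol A R) {k : ℕ} (hk : 0 < k)
    (hper : ∀ θ, R (θ + k * Real.pi) = R θ) (θ : ℝ) : R (θ + Real.pi) = R θ := by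
  have hS := hR.shift
  have hcomp : ∀ j : ℕ, 0 < j → ∀ θ, (R 0 < R (0 + Real.pi) → R θ < R (θ + j * Real.pi)) ∧
      (R (0 + Real.pi) < R 0 → R (θ + j * Real.pi) < R θ) := by
    intro j hj
    induction j, hj using Nat.le_induction with
    | base =>
      intro θ
      simp only [zero_add, Nat.cast_one, one_mul]
      exact ⟨fun h => hR.lt_of_lt hS (θ₀ := 0) (by simpa using h) θ,
        fun h => hS.lt_of_lt hR (θ₀ := 0) (by simpa using h) θ⟩
    | succ j _ ih =>
      intro θ
      have e : θ + ((j + 1 : ℕ) : ℝ) * Real.pi = (θ + j * Real.pi) + Real.pi := by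
        push_cast; ring
      rw [e]
      exact ⟨fun h => ((ih θ).1 h).trans (hR.lt_of_lt hS (θ₀ := 0) h _),
        fun h => (hS.lt_of_lt hR (θ₀ := 0) h _).trans ((ih θ).2 h)⟩
  rcases lt_trichotomy (R 0) (R (0 + Real.pi)) with h | h | h
  · exact absurd (hper 0) ((hcomp k hk 0).1 h).ne'
  · exact (congrFun (hR.ext_of_eq hS h) θ).symm
  · exact absurd (hper 0) ((hcomp k hk 0).2 h).ne

/-- A function whose derivative is positive at each zero stays positive. -/
theorem pos_of_deriv_pos_at_zero {f f' : ℝ → ℝ} {a b : ℝ} (hab : a ≤ b)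
    (hd : ∀ t ∈ Icc a b, HasDerivAt f (f' t) t) (h0 : 0 < f a)
    (hz : ∀ t ∈ Ioc a b, (∀ s ∈ Ico a t, 0 < f s) → f t = 0 → 0 < f' t) : 0 < f b := by
  by_contra hb
  have hc : ContinuousOn f (Icc a b) := fun t ht => (hd t ht).continuousAt.continuousWithinAt
  set Z : Set ℝ := Icc a b ∩ f ⁻¹' Iic 0 with hZ
  have hZc : IsClosed Z := hc.preimage_isClosed_of_isClosed isClosed_Icc isClosed_Iic
  have hZn : Z.Nonempty := ⟨b, right_mem_Icc.mpr hab, not_lt.mp hb⟩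
  have hZb : BddBelow Z := ⟨a, fun t ht => ht.1.1⟩
  have hcm : sInf Z ∈ Z := hZc.csInf_mem hZn hZb
  set c := sInf Z with hcdef
  have hlt : ∀ s ∈ Ico a c, 0 < f s := by
    intro s hs
    by_contra hn
    have : s ∈ Z := ⟨⟨hs.1, hs.2.le.trans hcm.1.2⟩, not_lt.mp hn⟩
    exact absurd (csInf_le hZb this) (not_le.mpr hs.2)
  have hac : a < c := by
    rcases hcm.1.1.eq_or_lt with h | h
    · have : f c ≤ 0 := hcm.2
      rw [← h] at this
      linarith
    · exact h
  have hfc : f c = 0 := by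
    refine le_antisymm hcm.2 ?_
    have h1 : Tendsto f (𝓝[<] c) (𝓝 (f c)) :=
      (hd c hcm.1).continuousAt.continuousWithinAt
    refine ge_of_tendsto h1 ?_
    filter_upwards [Ioo_mem_nhdsLT hac] with s hs
    exact (hlt s ⟨hs.1.le, hs.2⟩).le
  have hpos := hz c ⟨hac, hcm.1.2⟩ hlt hfc
  have h2 : Tendsto (slope f c) (𝓝[<] c) (𝓝 (f' c)) :=
    ((hasDerivAt_iff_tendsto_slope.mp (hd c hcm.1))).mono_left
      (nhdsWithin_mono _ fun x hx => ne_of_lt hx)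
  have h3 : ∀ᶠ s in 𝓝[<] c, 0 < slope f c s := h2.eventually (lt_mem_nhds hpos)
  obtain ⟨s, hs1, hs2⟩ := (h3.and (Ioo_mem_nhdsLT hac)).exists
  rw [slope_def_field, hfc, sub_zero] at hs1
  have h4 := hlt s ⟨hs2.1.le, hs2.2⟩
  have h5 : f s / (s - c) < 0 := div_neg_of_pos_of_neg h4 (by linarith [hs2.2])
  linarith

/-- The sextic form whose positivity makes the Dulac function work. -/
noncomputable def sexticF (A a β γ x y : ℝ) : ℝ :=
  (a - A / 3) * x ^ 6 + (A * a / 3 + 3 * β) * x ^ 5 * y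
    + (1 + 4 * A * β / 3 + 2 * β * a) * x ^ 4 * y ^ 2 + (a + 2 * β ^ 2 - 4 * γ) * x ^ 3 * y ^ 3
    - 10 / 3 * A * γ * x ^ 2 * y ^ 4 - 2 * β * γ * x * y ^ 5 + 2 * γ * y ^ 6

/-- The function `y² + x⁴/2 + a x³y + β x²y² - γ y⁴` in polar coordinates. -/
noncomputable def psiF (a β γ θ r : ℝ) : ℝ :=
  r * Real.sin θ ^ 2 + r ^ 2 * (Real.cos θ ^ 4 / 2 + a * Real.cos θ ^ 3 * Real.sin θ
    + β * Real.cos θ ^ 2 * Real.sin θ ^ 2 - γ * Real.sin θ ^ 4)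

/-- The logarithm of the Dulac function. -/
noncomputable def dulF (a β γ : ℝ) (p : ℝ × ℝ) : ℝ :=
  -(3 / 2) * Real.log (psiF a β γ p.1 p.2) + 3 / 2 * β * (p.2 * Real.cos p.1 ^ 2)

/-- The angular derivative of `psiF`. -/
noncomputable def psiθ (a β γ θ r : ℝ) : ℝ :=
  2 * r * Real.sin θ * Real.cos θ + r ^ 2 * (-2 * Real.cos θ ^ 3 * Real.sin θ
    + a * (Real.cos θ ^ 4 - 3 * Real.cos θ ^ 2 * Real.sin θ ^ 2)
    + β * (2 * Real.cos θ ^ 3 * Real.sin θ - 2 * Real.cos θ * Real.sin θ ^ 3)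
    - 4 * γ * Real.sin θ ^ 3 * Real.cos θ)

/-- The radial derivative of `psiF`. -/
noncomputable def psiR (a β γ θ r : ℝ) : ℝ :=
  Real.sin θ ^ 2 + 2 * r * (Real.cos θ ^ 4 / 2 + a * Real.cos θ ^ 3 * Real.sin θ
    + β * Real.cos θ ^ 2 * Real.sin θ ^ 2 - γ * Real.sin θ ^ 4)

theorem hasDerivAt_psiF_angle (a β γ θ r : ℝ) :
    HasDerivAt (fun t => psiF a β γ t r) (psiθ a β γ θ r) θ := by
  have hs := Real.hasDerivAt_sin θ
  have hc := Real.hasDerivAt_cos θ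
  have := ((hs.pow 2).const_mul r).add ((((((hc.pow 4).div_const 2).add
    (((hc.pow 3).const_mul a).mul hs)).add (((hc.pow 2).const_mul β).mul (hs.pow 2))).sub
    ((hs.pow 4).const_mul γ)).const_mul (r ^ 2))
  refine this.congr_deriv ?_
  simp only [Pi.pow_apply, psiθ]
  push_cast
  ring

theorem hasDerivAt_psiF_radius (a β γ θ r : ℝ) :
    HasDerivAt (fun t => psiF a β γ θ t) (psiR a β γ θ r) r := by
  have h := hasDerivAt_id' r
  have := (h.mul_const (Real.sin θ ^ 2)).add ((h.pow 2).mul_const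
    (Real.cos θ ^ 4 / 2 + a * Real.cos θ ^ 3 * Real.sin θ
    + β * Real.cos θ ^ 2 * Real.sin θ ^ 2 - γ * Real.sin θ ^ 4))
  refine this.congr_deriv ?_
  simp only [psiR]
  push_cast
  ring

theorem psi_identity (A a β γ θ r : ℝ) :
    3 / 2 * -(nF A θ r * psiθ a β γ θ r + eF A θ r * psiR a β γ θ r)
      + (-3 * β * (r * (Real.cos θ * Real.sin θ))
        - r * (3 * Real.sin θ ^ 2 - A * Real.cos θ ^ 2)) * psiF a β γ θ r
    = r ^ 2 * (9 / 2 * a - 2 * A) * Real.cos θ ^ 2 * Real.sin θ ^ 2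
      - 3 / 2 * r ^ 3 * sexticF A a β γ (Real.cos θ) (Real.sin θ) := by
  have h := Real.sin_sq_add_cos_sq θ
  simp only [nF, eF, psiθ, psiR, psiF, sexticF]
  generalize Real.sin θ = s at *
  generalize Real.cos θ = c at *
  linear_combination (3 / 2 * (r ^ 2 * (2 * s * (-c ^ 3 - A * c ^ 2 * s + s ^ 3)
    + s * (2 * c ^ 3 + 3 * a * c ^ 2 * s + 2 * β * c * s ^ 2))
    + r ^ 3 * (-c ^ 3 - A * c ^ 2 * s + s ^ 3) * (a * c ^ 3 + 2 * β * c ^ 2 * s - 4 * γ * s ^ 3)))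
    * h

theorem psi_neg {A a β γ θ r : ℝ} (ha : a ≤ 4 * A / 9)
    (hS : ∀ x y : ℝ, x ≠ 0 ∨ y ≠ 0 → 0 < sexticF A a β γ x y) (hr : 0 < r) :
    3 / 2 * -(nF A θ r * psiθ a β γ θ r + eF A θ r * psiR a β γ θ r)
      + (-3 * β * (r * (Real.cos θ * Real.sin θ))
        - r * (3 * Real.sin θ ^ 2 - A * Real.cos θ ^ 2)) * psiF a β γ θ r < 0 := by
  rw [psi_identity]
  have h1 : 0 < sexticF A a β γ (Real.cos θ) (Real.sin θ) := by
    refine hS _ _ ?_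
    by_contra hn
    push Not at hn
    have := Real.sin_sq_add_cos_sq θ
    rw [hn.1, hn.2] at this
    norm_num at this
  have h2 : r ^ 2 * (9 / 2 * a - 2 * A) * Real.cos θ ^ 2 * Real.sin θ ^ 2 ≤ 0 := by
    have h3 : 9 / 2 * a - 2 * A ≤ 0 := by linarith
    have h4 : 0 ≤ r ^ 2 * Real.cos θ ^ 2 * Real.sin θ ^ 2 := by positivity
    nlinarith
  have : 0 < r ^ 3 * sexticF A a β γ (Real.cos θ) (Real.sin θ) := by positivity
  linarith

theorem psiF_pos_of_isPol {A a β γ : ℝ} (ha : a ≤ 4 * A / 9)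
    (hS : ∀ x y : ℝ, x ≠ 0 ∨ y ≠ 0 → 0 < sexticF A a β γ x y) {R : ℝ → ℝ} (hR : IsPol A R)
    {θ : ℝ} (hθ : 0 ≤ θ) : 0 < psiF a β γ θ (R θ) := by
  have hd : ∀ t ∈ Icc 0 θ, HasDerivAt (fun t => psiF a β γ t (R t))
      (psiθ a β γ t (R t) + psiR a β γ t (R t) * (eF A t (R t) / nF A t (R t))) t := by
    intro t _
    have hs := Real.hasDerivAt_sin t
    have hc := Real.hasDerivAt_cos t
    have hr := (hR t).2.2
    have := ((hr.mul (hs.pow 2))).add ((hr.pow 2).mul (((((hc.pow 4).div_const 2).add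
      (((hc.pow 3).const_mul a).mul hs)).add (((hc.pow 2).const_mul β).mul (hs.pow 2))).sub
      ((hs.pow 4).const_mul γ)))
    refine this.congr_deriv ?_
    simp only [Pi.pow_apply, Pi.add_apply, Pi.sub_apply, Pi.mul_apply, psiθ, psiR]
    push_cast
    ring
  refine pos_of_deriv_pos_at_zero (f := fun t => psiF a β γ t (R t)) hθ hd ?_ ?_
  · have := (hR 0).1
    simp only [psiF, Real.sin_zero, Real.cos_zero]
    have : 0 < R 0 ^ 2 := by positivity
    nlinarith
  · intro t _ _ h0
    have h1 := psi_neg (θ := t) ha hS (hR t).1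
    rw [h0] at h1
    have hn := (hR t).2.1
    have : nF A t (R t) * (psiθ a β γ t (R t) + psiR a β γ t (R t)
        * (eF A t (R t) / nF A t (R t))) = nF A t (R t) * psiθ a β γ t (R t)
        + eF A t (R t) * psiR a β γ t (R t) := by
      field_simp
    have h2 : 0 < nF A t (R t) * (psiθ a β γ t (R t) + psiR a β γ t (R t)
        * (eF A t (R t) / nF A t (R t))) := by rw [this]; linarith
    exact pos_of_mul_pos_right h2 hn.le

theorem psiF_pos_of_le {a β γ θ r s : ℝ} (hr : 0 < r) (hrs : r ≤ s) (hs : 0 < psiF a β γ θ s) :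
    0 < psiF a β γ θ r := by
  have h0 : 0 < s := hr.trans_le hrs
  set k := Real.cos θ ^ 4 / 2 + a * Real.cos θ ^ 3 * Real.sin θ
    + β * Real.cos θ ^ 2 * Real.sin θ ^ 2 - γ * Real.sin θ ^ 4 with hk
  have e : ∀ r, psiF a β γ θ r = r * (Real.sin θ ^ 2 + r * k) := fun r => by
    simp only [psiF, hk]; ring
  rw [e] at hs ⊢
  have h1 := pos_of_mul_pos_right hs h0.le
  refine mul_pos hr ?_
  rcases le_or_gt 0 k with h | h
  · rcases (sq_nonneg (Real.sin θ)).eq_or_lt with h2 | h2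
    · rw [← h2, zero_add] at h1 ⊢
      exact mul_pos hr (pos_of_mul_pos_right h1 h0.le)
    · have := mul_nonneg hr.le h
      linarith
  · nlinarith

theorem dulF_contDiffAt {a β γ θ r : ℝ} (h : 0 < psiF a β γ θ r) :
    ContDiffAt ℝ 1 (dulF a β γ) (θ, r) := by
  unfold dulF
  refine ContDiffAt.add (contDiffAt_const.mul (ContDiffAt.log ?_ h.ne')) (by fun_prop)
  unfold psiF
  fun_prop

theorem dulF_angle {a β γ θ r : ℝ} (h : 0 < psiF a β γ θ r) :
    HasDerivAt (fun t => dulF a β γ (t, r)) (-(3 / 2) * (psiθ a β γ θ r / psiF a β γ θ r)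
      + 3 / 2 * β * (r * (-2 * Real.cos θ * Real.sin θ))) θ := by
  have := (((hasDerivAt_psiF_angle a β γ θ r).log h.ne').const_mul (-(3 / 2))).add
    ((((Real.hasDerivAt_cos θ).pow 2).const_mul r).const_mul (3 / 2 * β))
  refine this.congr_deriv ?_
  push_cast
  ring

theorem dulF_radius {a β γ θ r : ℝ} (h : 0 < psiF a β γ θ r) :
    HasDerivAt (fun t => dulF a β γ (θ, t)) (-(3 / 2) * (psiR a β γ θ r / psiF a β γ θ r)
      + 3 / 2 * β * Real.cos θ ^ 2) r := by
  have := (((hasDerivAt_psiF_radius a β γ θ r).log h.ne').const_mul (-(3 / 2))).add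
    (((hasDerivAt_id' r).mul_const (Real.cos θ ^ 2)).const_mul (3 / 2 * β))
  refine this.congr_deriv ?_
  ring

theorem dulF_div_neg {A a β γ θ r : ℝ} (ha : a ≤ 4 * A / 9)
    (hS : ∀ x y : ℝ, x ≠ 0 ∨ y ≠ 0 → 0 < sexticF A a β γ x y) (hr : 0 < r)
    (h : 0 < psiF a β γ θ r) :
    nF A θ r * (-(3 / 2) * (psiθ a β γ θ r / psiF a β γ θ r)
      + 3 / 2 * β * (r * (-2 * Real.cos θ * Real.sin θ)))
    + eF A θ r * (-(3 / 2) * (psiR a β γ θ r / psiF a β γ θ r) + 3 / 2 * β * Real.cos θ ^ 2)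
    - r * (3 * Real.sin θ ^ 2 - A * Real.cos θ ^ 2) < 0 := by
  have h1 := psi_neg (θ := θ) ha hS hr
  have key : nF A θ r * (r * (-2 * Real.cos θ * Real.sin θ)) + eF A θ r * Real.cos θ ^ 2
      = -2 * (r * (Real.cos θ * Real.sin θ)) := by
    have h := Real.sin_sq_add_cos_sq θ
    simp only [nF, eF]
    generalize Real.sin θ = s at *
    generalize Real.cos θ = c at *
    linear_combination (-2 * r * c * s) * h
  have e : nF A θ r * (-(3 / 2) * (psiθ a β γ θ r / psiF a β γ θ r)
      + 3 / 2 * β * (r * (-2 * Real.cos θ * Real.sin θ)))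
    + eF A θ r * (-(3 / 2) * (psiR a β γ θ r / psiF a β γ θ r) + 3 / 2 * β * Real.cos θ ^ 2)
    - r * (3 * Real.sin θ ^ 2 - A * Real.cos θ ^ 2)
    = (3 / 2 * -(nF A θ r * psiθ a β γ θ r + eF A θ r * psiR a β γ θ r)
      + (-3 * β * (r * (Real.cos θ * Real.sin θ))
        - r * (3 * Real.sin θ ^ 2 - A * Real.cos θ ^ 2)) * psiF a β γ θ r) / psiF a β γ θ r := by
    rw [eq_div_iff h.ne']
    have h2 : psiθ a β γ θ r / psiF a β γ θ r * psiF a β γ θ r = psiθ a β γ θ r :=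
      div_mul_cancel₀ _ h.ne'
    have h3 : psiR a β γ θ r / psiF a β γ θ r * psiF a β γ θ r = psiR a β γ θ r :=
      div_mul_cancel₀ _ h.ne'
    linear_combination (-(3 / 2) * nF A θ r) * h2 + (-(3 / 2) * eF A θ r) * h3
      + 3 / 2 * β * psiF a β γ θ r * key
  rw [e]
  exact div_neg_of_neg_of_pos h1 h

theorem psiF_add_pi (a β γ θ r : ℝ) : psiF a β γ (θ + Real.pi) r = psiF a β γ θ r := by
  simp only [psiF, Real.sin_add_pi, Real.cos_add_pi]; ring

theorem jF_dulF_add_pi (A a β γ θ r₁ r₂ : ℝ) :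
    jF A (dulF a β γ) (θ + Real.pi) r₁ r₂ = jF A (dulF a β γ) θ r₁ r₂ := by
  simp only [jF, dulF, psiF_add_pi, nF_add_pi, Real.cos_add_pi, neg_sq]

/-- Uniqueness of the `π`-periodic orbit from a Dulac function. -/
theorem unique_of_sextic {A a β γ : ℝ} (ha : a ≤ 4 * A / 9)
    (hS : ∀ x y : ℝ, x ≠ 0 ∨ y ≠ 0 → 0 < sexticF A a β γ x y) {R₁ R₂ : ℝ → ℝ}
    (h₁ : IsPol A R₁) (h₂ : IsPol A R₂) (p₁ : ∀ θ, R₁ (θ + Real.pi) = R₁ θ)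
    (p₂ : ∀ θ, R₂ (θ + Real.pi) = R₂ θ) (hlt : R₂ 0 < R₁ 0) : False := by
  have hord : ∀ θ, R₂ θ < R₁ θ := h₂.lt_of_lt h₁ hlt
  have hpos : ∀ θ ∈ Icc 0 Real.pi, ∀ r ∈ Icc (R₂ θ) (R₁ θ), 0 < psiF a β γ θ r := fun θ hθ r hr =>
    psiF_pos_of_le ((h₂ θ).1.trans_le hr.1) hr.2 (psiF_pos_of_isPol ha hS h₁ hθ.1)
  have := jF_lt (A := A) Real.pi_pos (fun θ _ => h₁.contDiff.contDiffAt)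
    (fun θ _ => h₂.contDiff.contDiffAt) (fun θ _ => (h₁ θ).2.2) (fun θ _ => (h₂ θ).2.2)
    (fun θ _ => hord θ) (b := dulF a β γ)
    (fun θ hθ r hr => dulF_contDiffAt (hpos θ hθ r hr))
    (fun θ hθ r hr => dulF_angle (hpos θ hθ r hr))
    (fun θ hθ r hr => dulF_radius (hpos θ hθ r hr))
    (fun θ _ => (div_mul_cancel₀ _ (h₁ θ).2.1.ne').le)
    (fun θ _ => (div_mul_cancel₀ _ (h₂ θ).2.1.ne').ge)
    (fun θ hθ r hr => dulF_div_neg ha hS ((h₂ θ).1.trans_le hr.1) (hpos θ hθ r hr))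
  have e1 := p₁ 0
  have e2 := p₂ 0
  have e3 := jF_dulF_add_pi A a β γ 0 (R₁ 0) (R₂ 0)
  rw [zero_add] at e1 e2 e3
  rw [e1, e2, e3] at this
  exact lt_irrefl _ this

theorem sexticF_low_left (x y : ℝ) :
    (1 / 1000) * (x ^ 6 + y ^ 6) ≤ sexticF (169 / 100) (3733 / 5000) (21 / 200) (57 / 200) x y := by
  have h : 0 ≤ (569 / 1000) * ((1) * (y ^ 3) + (-1197 / 22760) * (x * y ^ 2) + (-840 / 569) * (x ^ 2 * y) + (-220 / 569) * (x ^ 3)) ^ 2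
      + (66391991 / 910400000) * ((1) * (x * y ^ 2) + (-8969720 / 66391991) * (x ^ 2 * y) + (-19637600 / 66391991) * (x ^ 3)) ^ 2
      + (5709200135263 / 33195995500000) * ((1) * (x ^ 2 * y) + (7986521713607 / 34255200811578) * (x ^ 3)) ^ 2
      + (8372963159139079561 / 102765602434734000000) * ((1) * (x ^ 3)) ^ 2 := by positivity
  unfold sexticF
  linarith

theorem sexticF_low_right (x y : ℝ) :
    (1 / 1000) * (x ^ 6 + y ^ 6) ≤ sexticF (179 / 100) (3733 / 5000) (21 / 200) (57 / 200) x y := by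
  have h : 0 ≤ (569 / 1000) * ((1) * (y ^ 3) + (-1197 / 22760) * (x * y ^ 2) + (-870 / 569) * (x ^ 2 * y) + (-240 / 569) * (x ^ 3)) ^ 2
      + (34527991 / 910400000) * ((1) * (x * y ^ 2) + (7801880 / 34527991) * (x ^ 2 * y) + (-20595200 / 34527991) * (x ^ 3)) ^ 2
      + (1643897150263 / 17263995500000) * ((1) * (x ^ 2 * y) + (1904675749637 / 9863382901578) * (x ^ 3)) ^ 2
      + (907195670880837041 / 29590148704734000000) * ((1) * (x ^ 3)) ^ 2 := by positivity
  unfold sexticF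
  linarith

theorem sexticF_low {A : ℝ} (h₁ : (169 / 100) ≤ A) (h₂ : A ≤ (179 / 100)) (x y : ℝ)
    (h : x ≠ 0 ∨ y ≠ 0) : 0 < sexticF A (3733 / 5000) (21 / 200) (57 / 200) x y := by
  have hp : 0 < x ^ 6 + y ^ 6 := by
    rcases h with h | h
    · have := pow_pos (sq_pos_of_ne_zero h) 3
      nlinarith [pow_nonneg (sq_nonneg y) 3]
    · have := pow_pos (sq_pos_of_ne_zero h) 3
      nlinarith [pow_nonneg (sq_nonneg x) 3]
  have e1 := sexticF_low_left x y
  have e2 := sexticF_low_right x y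
  have e3 := mul_le_mul_of_nonneg_left e1 (sub_nonneg.mpr h₂)
  have e4 := mul_le_mul_of_nonneg_left e2 (sub_nonneg.mpr h₁)
  have e5 : ((179 / 100) - A) * sexticF (169 / 100) (3733 / 5000) (21 / 200) (57 / 200) x y
      + (A - (169 / 100)) * sexticF (179 / 100) (3733 / 5000) (21 / 200) (57 / 200) x y
      = (1 / 10) * sexticF A (3733 / 5000) (21 / 200) (57 / 200) x y := by
    unfold sexticF; ring
  nlinarith

theorem sexticF_high_left (x y : ℝ) :
    (1 / 1000) * (x ^ 6 + y ^ 6) ≤ sexticF (179 / 100) (1591 / 2000) (17 / 100)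
    (323 / 1000) x y := by
  have h : 0 ≤ (129 / 200) * ((1) * (y ^ 3) + (-5491 / 64500) * (x * y ^ 2) + (-200 / 129) * (x ^ 2 * y) + (-58 / 129) * (x ^ 3)) ^ 2
      + (146397973 / 2150000000) * ((1) * (x * y ^ 2) + (-93407500 / 439193919) * (x ^ 2 * y) + (-159239000 / 439193919) * (x ^ 3)) ^ 2
      + (16171439764759 / 131758175700000) * ((1) * (x ^ 2 * y) + (19743218632091 / 64685759059036) * (x ^ 3)) ^ 2
      + (1217663565557118867 / 25874303623614400000) * ((1) * (x ^ 3)) ^ 2 := by positivity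
  unfold sexticF
  linarith

theorem sexticF_high_right (x y : ℝ) :
    (1 / 1000) * (x ^ 6 + y ^ 6) ≤ sexticF (47 / 25) (1591 / 2000) (17 / 100) (323 / 1000) x y := by
  have h : 0 ≤ (129 / 200) * ((1) * (y ^ 3) + (-5491 / 64500) * (x * y ^ 2) + (-206 / 129) * (x ^ 2 * y) + (-64 / 129) * (x ^ 3)) ^ 2
      + (67062973 / 2150000000) * ((1) * (x * y ^ 2) + (83619500 / 201188919) * (x ^ 2 * y) + (-46712000 / 201188919) * (x ^ 3)) ^ 2
      + (386816086039 / 60356675700000) * ((1) * (x ^ 2 * y) + (-225797060437 / 386816086039) * (x ^ 3)) ^ 2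
      + (201468851037233 / 38681608603900000) * ((1) * (x ^ 3)) ^ 2 := by positivity
  unfold sexticF
  linarith

theorem sexticF_high {A : ℝ} (h₁ : (179 / 100) ≤ A) (h₂ : A ≤ (47 / 25)) (x y : ℝ)
    (h : x ≠ 0 ∨ y ≠ 0) : 0 < sexticF A (1591 / 2000) (17 / 100) (323 / 1000) x y := by
  have hp : 0 < x ^ 6 + y ^ 6 := by
    rcases h with h | h
    · have := pow_pos (sq_pos_of_ne_zero h) 3
      nlinarith [pow_nonneg (sq_nonneg y) 3]
    · have := pow_pos (sq_pos_of_ne_zero h) 3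
      nlinarith [pow_nonneg (sq_nonneg x) 3]
  have e1 := sexticF_high_left x y
  have e2 := sexticF_high_right x y
  have e3 := mul_le_mul_of_nonneg_left e1 (sub_nonneg.mpr h₂)
  have e4 := mul_le_mul_of_nonneg_left e2 (sub_nonneg.mpr h₁)
  have e5 : ((47 / 25) - A) * sexticF (179 / 100) (1591 / 2000) (17 / 100) (323 / 1000) x y
      + (A - (179 / 100)) * sexticF (47 / 25) (1591 / 2000) (17 / 100) (323 / 1000) x y
      = (9 / 100) * sexticF A (1591 / 2000) (17 / 100) (323 / 1000) x y := by
    unfold sexticF; ring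
  nlinarith

theorem sexticF_small {A : ℝ} (h₁ : 0 < A) (h₂ : A ≤ 169 / 100) (x y : ℝ)
    (h : x ≠ 0 ∨ y ≠ 0) : 0 < sexticF A (2 * A / 5) 0 (A / 10) x y := by
  have e : sexticF A (2 * A / 5) 0 (A / 10) x y = 1 / 15 * (A * x ^ 4 * (x + A * y) ^ 2
      + y ^ 2 * ((15 - A ^ 3) * x ^ 4 - 5 * A ^ 2 * x ^ 2 * y ^ 2 + 3 * A * y ^ 4)) := by
    unfold sexticF; ring
  have hA : A ^ 3 ≤ 483 / 100 := by
    have : A ^ 3 ≤ (169 / 100) ^ 3 := pow_le_pow_left₀ h₁.le h₂ 3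
    norm_num at this ⊢
    linarith
  rw [e]
  have hq : 0 ≤ A * x ^ 4 * (x + A * y) ^ 2 := by positivity
  rcases eq_or_ne y 0 with hy | hy
  · have hx : x ≠ 0 := by simpa [hy] using h
    subst hy
    have := pow_pos (sq_pos_of_ne_zero hx) 3
    have := mul_pos h₁ this
    nlinarith
  · have hy2 := sq_pos_of_ne_zero hy
    have key : 0 < (15 - A ^ 3) * x ^ 4 - 5 * A ^ 2 * x ^ 2 * y ^ 2 + 3 * A * y ^ 4 := by
      have h12 : 0 < 12 * A := by linarith
      have e2 : 12 * A * ((15 - A ^ 3) * x ^ 4 - 5 * A ^ 2 * x ^ 2 * y ^ 2 + 3 * A * y ^ 4)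
          = (6 * A * y ^ 2 - 5 * A ^ 2 * x ^ 2) ^ 2 + A * (180 - 37 * A ^ 3) * x ^ 4 := by ring
      have h3 : 0 ≤ A * (180 - 37 * A ^ 3) * x ^ 4 :=
        mul_nonneg (mul_nonneg h₁.le (by linarith)) (by positivity)
      rcases eq_or_ne x 0 with hx | hx
      · subst hx
        have : 0 < A * (y ^ 2) ^ 2 := by positivity
        nlinarith
      · have : 0 < A * (180 - 37 * A ^ 3) * x ^ 4 :=
          mul_pos (mul_pos h₁ (by linarith)) (by positivity)
        refine pos_of_mul_pos_right (a := 12 * A) ?_ h12.le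
        rw [e2]
        positivity
    have := mul_pos hy2 key
    linarith

/-- Uniqueness of the periodic orbit for small parameters. -/
theorem IsPol.unique_small {A : ℝ} (h0 : 0 < A) (hA : A ≤ 188 / 100) {R₁ R₂ : ℝ → ℝ}
    (h₁ : IsPol A R₁) (h₂ : IsPol A R₂) (p₁ : ∀ θ, R₁ (θ + Real.pi) = R₁ θ)
    (p₂ : ∀ θ, R₂ (θ + Real.pi) = R₂ θ) (hlt : R₂ 0 < R₁ 0) : False := by
  rcases le_total A (169 / 100) with h | h
  · exact unique_of_sextic (by linarith) (sexticF_small h0 h) h₁ h₂ p₁ p₂ hlt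
  rcases le_total A (179 / 100) with h' | h'
  · exact unique_of_sextic (by linarith) (sexticF_low h h') h₁ h₂ p₁ p₂ hlt
  · exact unique_of_sextic (by linarith) (sexticF_high h' (by linarith)) h₁ h₂ p₁ p₂ hlt

theorem nonneg_of_deriv_pos_at_zero {f f' : ℝ → ℝ} {a b : ℝ} (hab : a ≤ b)
    (hd : ∀ t ∈ Icc a b, HasDerivAt f (f' t) t) (h0 : 0 ≤ f a)
    (hz : ∀ t ∈ Icc a b, f t = 0 → 0 < f' t) : 0 ≤ f b := by
  rcases h0.lt_or_eq with h | h
  · exact (pos_of_deriv_pos_at_zero hab hd h fun t ht _ h => hz t (Ioc_subset_Icc_self ht) h).le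
  rcases hab.eq_or_lt with h' | h'
  · rw [← h', ← h]
  have hpos := hz a (left_mem_Icc.mpr hab) h.symm
  have h2 : Tendsto (slope f a) (𝓝[>] a) (𝓝 (f' a)) :=
    ((hasDerivAt_iff_tendsto_slope.mp (hd a (left_mem_Icc.mpr hab)))).mono_left
      (nhdsWithin_mono _ fun x hx => ne_of_gt hx)
  obtain ⟨s, hs1, hs2⟩ := ((h2.eventually (lt_mem_nhds hpos)).and (Ioo_mem_nhdsGT h')).exists
  have hfs : 0 < f s := by
    rw [slope_def_field, ← h, sub_zero] at hs1
    have : 0 < s - a := by linarith [hs2.1]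
    rcases div_pos_iff.mp hs1 with h | h
    · exact h.1
    · linarith [h.2]
  refine (pos_of_deriv_pos_at_zero hs2.2.le (fun t ht => hd t ⟨hs2.1.le.trans ht.1, ht.2⟩) hfs
    fun t ht _ h => hz t ⟨hs2.1.le.trans ht.1.le, ht.2⟩ h).le

theorem slope_mono {A₁ A θ r : ℝ} (hA : A₁ ≤ A) (h₁ : 0 < nF A₁ θ r)
    (h₂ : 0 < nF A θ r) : eF A₁ θ r / nF A₁ θ r ≤ eF A θ r / nF A θ r := by
  rw [div_le_div_iff₀ h₁ h₂]
  have : eF A θ r * nF A₁ θ r - eF A₁ θ r * nF A θ r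
      = 2 * (A - A₁) * (r * Real.cos θ * Real.sin θ) ^ 2 := by
    have h := Real.sin_sq_add_cos_sq θ
    simp only [eF, nF]
    generalize Real.sin θ = s at *
    generalize Real.cos θ = c at *
    linear_combination (2 * (A - A₁) * (r * c * s) ^ 2) * h
  have h3 : 0 ≤ 2 * (A - A₁) * (r * Real.cos θ * Real.sin θ) ^ 2 :=
    mul_nonneg (by linarith) (sq_nonneg _)
  linarith

theorem nF_pos_of_le {A θ r s : ℝ} (hr : 0 < r) (hrs : r ≤ s) (hs : 0 < nF A θ s) :
    0 < nF A θ r := by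
  simp only [nF] at hs ⊢
  set k := Real.cos θ ^ 4 + A * Real.cos θ ^ 3 * Real.sin θ
    - Real.cos θ * Real.sin θ ^ 3 with hk
  rcases le_or_gt 0 k with h | h
  · rcases (sq_nonneg (Real.sin θ)).eq_or_lt with h2 | h2
    · rw [← h2, zero_add] at hs ⊢
      exact mul_pos hr (pos_of_mul_pos_right hs (hr.trans_le hrs).le)
    · have := mul_nonneg hr.le h
      linarith
  · nlinarith

theorem nF_pos_of_mem {A θ r s t : ℝ} (hr : 0 < nF A θ r) (hs : 0 < nF A θ s)
    (ht : t ∈ Icc r s) : 0 < nF A θ t := by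
  simp only [nF] at *
  set k := Real.cos θ ^ 4 + A * Real.cos θ ^ 3 * Real.sin θ
    - Real.cos θ * Real.sin θ ^ 3 with hk
  rcases le_or_gt 0 k with h | h
  · nlinarith [ht.1]
  · nlinarith [ht.2]

/-- The exponent of the second Dulac function. -/
noncomputable def expF (p : ℝ × ℝ) : ℝ := -(17 / 10) * (p.2 * Real.cos p.1 ^ 2)

/-- The exponent of the first Dulac function at the parameter of the barrier. -/
noncomputable def dulB : ℝ × ℝ → ℝ := dulF (1591 / 2000) (17 / 100) (323 / 1000)

/-- `R = ra` at `θ = a` and `R = rb` at `θ = b` are joined by a barrier, which pushes orbits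
outwards, decreases the flux below it and contracts the flux above it by `exp (-k)`. -/
def Step (a b ra rb k : ℝ) : Prop :=
  ∀ A, 188 / 100 ≤ A → A ≤ 225 / 100 → ∀ R, IsPol A R →
    (ra ≤ R a → rb ≤ R b) ∧
    (R b < rb → jF (188 / 100) dulB b rb (R b) < jF (188 / 100) dulB a ra (R a)) ∧
    ∀ R₁, IsPol A R₁ → (∀ θ, R θ ≤ R₁ θ) → ra ≤ R a →
      jF A expF b (R₁ b) (R b) ≤ Real.exp (-k) * jF A expF a (R₁ a) (R a)

theorem Step.trans {a b c ra rb rc k l : ℝ} (h₁ : Step a b ra rb k) (h₂ : Step b c rb rc l) :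
    Step a c ra rc (k + l) := by
  intro A hA hA' R hR
  obtain ⟨p1, p2, p3⟩ := h₁ A hA hA' R hR
  obtain ⟨q1, q2, q3⟩ := h₂ A hA hA' R hR
  refine ⟨fun h => q1 (p1 h), fun h => (q2 h).trans (p2 ?_), fun R₁ hR₁ hle h => ?_⟩
  · by_contra hn
    exact absurd (q1 (not_lt.mp hn)) (not_le.mpr h)
  · refine (q3 R₁ hR₁ hle (p1 h)).trans ?_
    have := mul_le_mul_of_nonneg_left (p3 R₁ hR₁ hle h) (Real.exp_pos (-l)).le
    refine this.trans (le_of_eq ?_)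
    rw [← mul_assoc, ← Real.exp_add]
    congr 2; ring

theorem Step.of_curve {a b : ℝ} (hab : a < b) {ρ ρ' Λ μ : ℝ → ℝ}
    (hC : ∀ θ ∈ Icc a b, ContDiffAt ℝ 1 ρ θ) (hd : ∀ θ ∈ Icc a b, HasDerivAt ρ (ρ' θ) θ)
    (hn : ∀ θ ∈ Icc a b, 0 < nF (188 / 100) θ (ρ θ))
    (hs : ∀ θ ∈ Icc a b, ρ' θ * nF (188 / 100) θ (ρ θ) < eF (188 / 100) θ (ρ θ))
    (hψ : ∀ θ ∈ Icc a b, 0 < psiF (1591 / 2000) (17 / 100) (323 / 1000) θ (ρ θ))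
    (hΛ : ∀ θ ∈ Icc a b, HasDerivAt Λ (μ θ) θ)
    (hD : ∀ A, 188 / 100 ≤ A → A ≤ 225 / 100 → ∀ θ ∈ Icc a b, ∀ r, ρ θ ≤ r → 0 < nF A θ r →
      μ θ * nF A θ r ≤ r * (3 * Real.sin θ ^ 2 - A * Real.cos θ ^ 2
        - 34 / 10 * (Real.cos θ * Real.sin θ))) :
    Step a b (ρ a) (ρ b) (Λ b - Λ a) := by
  intro A hA hA' R hR
  have hmain : ρ a ≤ R a → ∀ θ ∈ Icc a b, ρ θ ≤ R θ := by
    intro h θ hθ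
    have := nonneg_of_deriv_pos_at_zero (f := fun t => R t - ρ t) hθ.1
      (fun t ht => (hR t).2.2.sub (hd t ⟨ht.1, ht.2.trans hθ.2⟩)) (by linarith) ?_
    · linarith
    · intro t ht h0
      have ht' : t ∈ Icc a b := ⟨ht.1, ht.2.trans hθ.2⟩
      have e : R t = ρ t := by linarith
      have h1 := slope_mono hA (hn t ht') (e ▸ (hR t).2.1)
      have h2 := (lt_div_iff₀ (hn t ht')).mpr (hs t ht')
      rw [e]
      linarith
  have hab' := right_mem_Icc.mpr hab.le
  refine ⟨fun h => hmain h b hab', fun h => ?_, fun R₁ hR₁ hle h => ?_⟩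
  · have hlt : ∀ θ ∈ Icc a b, R θ < ρ θ := by
      intro θ hθ
      by_contra hc
      have := nonneg_of_deriv_pos_at_zero (f := fun t => R t - ρ t) hθ.2
        (fun t ht => (hR t).2.2.sub (hd t ⟨hθ.1.trans ht.1, ht.2⟩)) (by linarith) ?_
      · linarith
      · intro t ht h0
        have ht' : t ∈ Icc a b := ⟨hθ.1.trans ht.1, ht.2⟩
        have e : R t = ρ t := by linarith
        have h1 := slope_mono hA (hn t ht') (e ▸ (hR t).2.1)
        have h2 := (lt_div_iff₀ (hn t ht')).mpr (hs t ht')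
        rw [e]
        linarith
    have hψ' : ∀ θ ∈ Icc a b, ∀ r ∈ Icc (R θ) (ρ θ),
        0 < psiF (1591 / 2000) (17 / 100) (323 / 1000) θ r := fun θ hθ r hr =>
      psiF_pos_of_le ((hR θ).1.trans_le hr.1) hr.2 (hψ θ hθ)
    refine jF_lt hab hC (fun θ _ => hR.contDiff.contDiffAt) hd (fun θ _ => (hR θ).2.2) hlt
      (fun θ hθ r hr => dulF_contDiffAt (hψ' θ hθ r hr))
      (fun θ hθ r hr => dulF_angle (hψ' θ hθ r hr))
      (fun θ hθ r hr => dulF_radius (hψ' θ hθ r hr)) (fun θ hθ => (hs θ hθ).le) ?_ ?_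
    · intro θ hθ
      have h1 := nF_pos_of_le (hR θ).1 (hlt θ hθ).le (hn θ hθ)
      exact (div_le_iff₀ h1).mp (slope_mono hA h1 (hR θ).2.1)
    · intro θ hθ r hr
      exact dulF_div_neg (by norm_num) (sexticF_high (by norm_num) (by norm_num))
        ((hR θ).1.trans_le hr.1) (hψ' θ hθ r hr)
  · have := jF_le (A := A) (b := expF) (bθ := fun θ r => -(17 / 10) * (r * (-2 * Real.cos θ * Real.sin θ)))
      (bR := fun θ _ => -(17 / 10) * Real.cos θ ^ 2) hab.le
      (fun θ _ => hR₁.contDiff.contDiffAt) (fun θ _ => hR.contDiff.contDiffAt)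
      (fun θ _ => (hR₁ θ).2.2) (fun θ _ => (hR θ).2.2) (fun θ _ => hle θ) ?_ ?_ ?_
      (fun θ _ => (div_mul_cancel₀ _ (hR₁ θ).2.1.ne').le)
      (fun θ _ => (div_mul_cancel₀ _ (hR θ).2.1.ne').ge) hΛ ?_
    · have e1 := Real.exp_pos (Λ b)
      have e2 : Real.exp (-(Λ b - Λ a)) * Real.exp (Λ b) = Real.exp (Λ a) := by
        rw [← Real.exp_add]; congr 1; ring
      refine le_of_mul_le_mul_right ?_ e1
      refine this.trans (le_of_eq ?_)
      rw [← e2]; ring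
    · intro θ _ r _
      unfold expF; fun_prop
    · intro θ _ r _
      refine ((((Real.hasDerivAt_cos θ).pow 2).const_mul r).const_mul (-(17 / 10))).congr_deriv ?_
      push_cast
      ring
    · intro θ _ r _
      refine (((hasDerivAt_id' r).mul_const (Real.cos θ ^ 2)).const_mul
        (-(17 / 10))).congr_deriv ?_
      ring
    · intro θ hθ r hr
      have h1 := hD A hA hA' θ hθ r ((hmain h θ hθ).trans hr.1)
        (nF_pos_of_mem (hR θ).2.1 (hR₁ θ).2.1 hr)
      have key : nF A θ r * (r * (-2 * Real.cos θ * Real.sin θ)) + eF A θ r * Real.cos θ ^ 2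
          = -2 * (r * (Real.cos θ * Real.sin θ)) := by
        have h := Real.sin_sq_add_cos_sq θ
        simp only [nF, eF]
        generalize Real.sin θ = s at *
        generalize Real.cos θ = c at *
        linear_combination (-2 * r * c * s) * h
      linear_combination h1 + (-(17 / 10)) * key

/-- The angle with cotangent `v`. -/
noncomputable def acot (v : ℝ) : ℝ := Real.pi / 2 - Real.arctan v

theorem sin_acot_sq (v : ℝ) : Real.sin (acot v) ^ 2 = 1 / (1 + v ^ 2) := by
  rw [acot, Real.sin_pi_div_two_sub, Real.cos_sq_arctan]

theorem cot_acot (v : ℝ) : Real.cos (acot v) / Real.sin (acot v) = v := by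
  rw [acot, Real.sin_pi_div_two_sub, Real.cos_pi_div_two_sub, ← Real.tan_eq_sin_div_cos,
    Real.tan_arctan]

theorem acot_pos (v : ℝ) : 0 < acot v := by
  have := Real.arctan_lt_pi_div_two v
  unfold acot; linarith

theorem acot_lt_pi (v : ℝ) : acot v < Real.pi := by
  have := Real.neg_pi_div_two_lt_arctan v
  unfold acot; linarith

theorem acot_lt {v w : ℝ} (h : w < v) : acot v < acot w := by
  have := Real.arctan_strictMono h
  unfold acot; linarith

theorem sin_pos_and_cot_mem {v w θ : ℝ} (h : θ ∈ Icc (acot v) (acot w)) :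
    0 < Real.sin θ ∧ Real.cos θ / Real.sin θ ∈ Icc w v := by
  have hs : 0 < Real.sin θ := Real.sin_pos_of_pos_of_lt_pi ((acot_pos v).trans_le h.1)
    (h.2.trans_lt (acot_lt_pi w))
  refine ⟨hs, ?_⟩
  have hm : Real.pi / 2 - θ ∈ Ioo (-(Real.pi / 2)) (Real.pi / 2) := by
    have h1 := acot_pos v
    have h2 := acot_lt_pi w
    constructor <;> linarith [h.1, h.2]
  have e : Real.cos θ / Real.sin θ = Real.tan (Real.pi / 2 - θ) := by
    rw [Real.tan_eq_sin_div_cos, Real.sin_pi_div_two_sub, Real.cos_pi_div_two_sub]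
  have hh1 := h.1
  have hh2 := h.2
  unfold acot at hh1 hh2
  rw [e]
  constructor
  · rw [← Real.tan_arctan w]
    exact Real.strictMonoOn_tan.monotoneOn (Real.arctan_mem_Ioo w) hm (by linarith)
  · rw [← Real.tan_arctan v]
    exact Real.strictMonoOn_tan.monotoneOn hm (Real.arctan_mem_Ioo v) (by linarith)

/-- A barrier given in the coordinate `v = x / y`, with a decay rate `m`. -/
theorem Step.of_cot {va vb : ℝ} (hv : vb < va) {W W' m M : ℝ → ℝ} (hW : ContDiff ℝ 1 W)
    (hW' : ∀ v, HasDerivAt W (W' v) v) (hM : ∀ v, HasDerivAt M (m v) v)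
    (h1 : ∀ v ∈ Icc vb va, 0 < W v)
    (h2 : ∀ v ∈ Icc vb va, 0 < v * (v ^ 3 + 188 / 100 * v ^ 2 - 1) + W v)
    (h3 : ∀ v ∈ Icc vb va, 0 < 2 * W v * (v ^ 3 + 188 / 100 * v ^ 2 - 1)
      - W' v * (v * (v ^ 3 + 188 / 100 * v ^ 2 - 1) + W v))
    (h4 : ∀ v ∈ Icc vb va, 0 < W v + (v ^ 4 / 2 + 1591 / 2000 * v ^ 3 + 17 / 100 * v ^ 2
      - 323 / 1000))
    (h5 : (∀ v ∈ Icc vb va, 0 ≤ m v ∧ ∀ A, A = 188 / 100 ∨ A = 225 / 100 →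
        0 ≤ 3 - A * v ^ 2 - 34 / 10 * v - m v * (v * (v ^ 3 + A * v ^ 2 - 1) + W v)) ∨
      (∀ v ∈ Icc vb va, m v ≤ 0 ∧ ∀ A, A = 188 / 100 ∨ A = 225 / 100 →
        0 ≤ 3 - A * v ^ 2 - 34 / 10 * v - m v * (v * (v ^ 3 + A * v ^ 2 - 1)))) :
    Step (acot va) (acot vb) ((1 + va ^ 2) / W va) ((1 + vb ^ 2) / W vb) (M va - M vb) := by
  set ct : ℝ → ℝ := fun θ => Real.cos θ / Real.sin θ with hct
  have hctd : ∀ θ ∈ Icc (acot va) (acot vb), HasDerivAt ct (-(1 / Real.sin θ ^ 2)) θ := by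
    intro θ hθ
    have hs := (sin_pos_and_cot_mem hθ).1
    refine ((Real.hasDerivAt_cos θ).div (Real.hasDerivAt_sin θ) hs.ne').congr_deriv ?_
    field_simp
    linear_combination -(Real.sin_sq_add_cos_sq θ)
  set ρ : ℝ → ℝ := fun θ => 1 / (Real.sin θ ^ 2 * W (ct θ)) with hρ
  have hval : ∀ v, (1 + v ^ 2) / W v = ρ (acot v) := by
    intro v
    simp only [hρ, hct, cot_acot, sin_acot_sq]
    have : 1 + v ^ 2 ≠ 0 := by positivity
    rw [one_div_mul_eq_div, one_div_div]
  have hk : M va - M vb = (-M (ct (acot vb))) - (-M (ct (acot va))) := by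
    simp only [hct, cot_acot]; ring
  rw [hval, hval, hk]
  have hsc : ∀ θ ∈ Icc (acot va) (acot vb), Real.cos θ = ct θ * Real.sin θ := fun θ hθ =>
    (div_mul_cancel₀ _ (sin_pos_and_cot_mem hθ).1.ne').symm
  have hnn : ∀ A r, ∀ θ ∈ Icc (acot va) (acot vb), nF A θ r = Real.sin θ ^ 2
      + r * Real.sin θ ^ 4 * (ct θ * (ct θ ^ 3 + A * ct θ ^ 2 - 1)) := by
    intro A r θ hθ
    simp only [nF, hsc θ hθ]; ring
  have hee : ∀ A r, ∀ θ ∈ Icc (acot va) (acot vb), eF A θ r = -2 * r * (Real.sin θ ^ 2 * ct θ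
      - r * Real.sin θ ^ 4 * (ct θ ^ 3 + A * ct θ ^ 2 - 1)) := by
    intro A r θ hθ
    simp only [eF, hsc θ hθ]; ring
  refine Step.of_curve (ρ := ρ) (Λ := fun θ => -M (ct θ)) (μ := fun θ => m (ct θ) / Real.sin θ ^ 2)
    (ρ' := fun θ => -(2 * ct θ * W (ct θ) - (1 + ct θ ^ 2) * W' (ct θ))
      / (Real.sin θ ^ 2 * W (ct θ) ^ 2))
    (acot_lt hv) ?_ ?_ ?_ ?_ ?_ ?_ ?_
  · intro θ hθ
    obtain ⟨hs, hv⟩ := sin_pos_and_cot_mem hθ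
    have hw := h1 _ hv
    refine ContDiffAt.div contDiffAt_const ?_ (by positivity)
    refine ContDiffAt.mul (by fun_prop) ?_
    exact hW.contDiffAt.comp θ (ContDiffAt.div (by fun_prop) (by fun_prop) hs.ne')
  · intro θ hθ
    obtain ⟨hs, hv⟩ := sin_pos_and_cot_mem hθ
    have hw : 0 < W (ct θ) := h1 _ hv
    have := (hasDerivAt_const θ (1 : ℝ)).div (((Real.hasDerivAt_sin θ).pow 2).mul
      ((hW' (ct θ)).comp θ (hctd θ hθ)))
      (by simp only [Pi.mul_apply, Pi.pow_apply, Function.comp]; positivity)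
    refine this.congr_deriv ?_
    have hh := Real.sin_sq_add_cos_sq θ
    rw [hsc θ hθ] at hh
    simp only [Pi.mul_apply, Pi.pow_apply, Function.comp]
    rw [hsc θ hθ]
    have h7 : Real.sin θ ^ 2 * (1 + ct θ ^ 2) = 1 := by linarith
    field_simp
    push_cast
    linear_combination (-(W' (ct θ))) * h7
  · intro θ hθ
    obtain ⟨hs, hv⟩ := sin_pos_and_cot_mem hθ
    have hw : 0 < W (ct θ) := h1 _ hv
    have := h2 _ hv
    rw [hnn _ _ θ hθ]
    have e : Real.sin θ ^ 2 + ρ θ * Real.sin θ ^ 4 * (ct θ * (ct θ ^ 3 + 188 / 100 * ct θ ^ 2 - 1))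
        = Real.sin θ ^ 2 / W (ct θ) * (ct θ * (ct θ ^ 3 + 188 / 100 * ct θ ^ 2 - 1) + W (ct θ)) := by
      simp only [hρ]; field_simp; ring
    rw [e]
    positivity
  · intro θ hθ
    obtain ⟨hs, hv⟩ := sin_pos_and_cot_mem hθ
    have hw : 0 < W (ct θ) := h1 _ hv
    have h3' := h3 _ hv
    rw [hnn _ _ θ hθ, hee _ _ θ hθ, ← sub_pos]
    have e : -2 * ρ θ * (Real.sin θ ^ 2 * ct θ
          - ρ θ * Real.sin θ ^ 4 * (ct θ ^ 3 + 188 / 100 * ct θ ^ 2 - 1))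
        - -(2 * ct θ * W (ct θ) - (1 + ct θ ^ 2) * W' (ct θ)) / (Real.sin θ ^ 2 * W (ct θ) ^ 2)
        * (Real.sin θ ^ 2 + ρ θ * Real.sin θ ^ 4 * (ct θ * (ct θ ^ 3 + 188 / 100 * ct θ ^ 2 - 1)))
        = (1 + ct θ ^ 2) / W (ct θ) ^ 3 * (2 * W (ct θ) * (ct θ ^ 3 + 188 / 100 * ct θ ^ 2 - 1)
      - W' (ct θ) * (ct θ * (ct θ ^ 3 + 188 / 100 * ct θ ^ 2 - 1) + W (ct θ))) := by
      simp only [hρ]; field_simp; ring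
    rw [e]
    exact mul_pos (by positivity) h3'
  · intro θ hθ
    obtain ⟨hs, hv⟩ := sin_pos_and_cot_mem hθ
    have hw : 0 < W (ct θ) := h1 _ hv
    have h4' := h4 _ hv
    have e : psiF (1591 / 2000) (17 / 100) (323 / 1000) θ (ρ θ) = 1 / W (ct θ) ^ 2
        * (W (ct θ) + (ct θ ^ 4 / 2 + 1591 / 2000 * ct θ ^ 3 + 17 / 100 * ct θ ^ 2
      - 323 / 1000)) := by
      simp only [psiF, hsc θ hθ, hρ]; field_simp
    rw [e]
    exact mul_pos (by positivity) h4'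
  · intro θ hθ
    refine ((hM (ct θ)).comp θ (hctd θ hθ)).neg.congr_deriv ?_
    ring
  · intro A hA hA' θ hθ r hr hn
    obtain ⟨hs, hv⟩ := sin_pos_and_cot_mem hθ
    have hw : 0 < W (ct θ) := h1 _ hv
    have hρpos : 0 < ρ θ := by simp only [hρ]; positivity
    have hr0 : 0 < r := hρpos.trans_le hr
    have hW1 : 1 ≤ r * Real.sin θ ^ 2 * W (ct θ) := by
      have : ρ θ * (Real.sin θ ^ 2 * W (ct θ)) = 1 := by
        simp only [hρ]; field_simp
      have h8 := mul_le_mul_of_nonneg_right hr (by positivity : 0 ≤ Real.sin θ ^ 2 * W (ct θ))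
      linarith
    have e1 : m (ct θ) / Real.sin θ ^ 2 * nF A θ r = m (ct θ) * (1
      + r * Real.sin θ ^ 2 * (ct θ * (ct θ ^ 3 + A * ct θ ^ 2 - 1))) := by
      rw [hnn _ _ θ hθ]; field_simp
    have e2 : r * (3 * Real.sin θ ^ 2 - A * Real.cos θ ^ 2
        - 34 / 10 * (Real.cos θ * Real.sin θ)) = r * Real.sin θ ^ 2
        * (3 - A * ct θ ^ 2 - 34 / 10 * ct θ) := by
      rw [hsc θ hθ]; ring
    rw [e1, e2]
    have hrs : 0 < r * Real.sin θ ^ 2 := by positivity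
    rcases h5 with h5 | h5
    · obtain ⟨hm, h5⟩ := h5 _ hv
      have a1 := h5 _ (Or.inl rfl)
      have a2 := h5 _ (Or.inr rfl)
      have a3 : 0 ≤ 3 - A * ct θ ^ 2 - 34 / 10 * ct θ
          - m (ct θ) * (ct θ * (ct θ ^ 3 + A * ct θ ^ 2 - 1) + W (ct θ)) := by
        have b1 := mul_nonneg a1 (sub_nonneg.mpr hA')
        have b2 := mul_nonneg a2 (sub_nonneg.mpr hA)
        linear_combination (100 / 37) * b1 + (100 / 37) * b2
      have a4 := mul_nonneg hrs.le a3
      have a5 := mul_nonneg hm (sub_nonneg.mpr hW1)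
      linear_combination a4 + a5
    · obtain ⟨hm, h5⟩ := h5 _ hv
      have a1 := h5 _ (Or.inl rfl)
      have a2 := h5 _ (Or.inr rfl)
      have a3 : 0 ≤ 3 - A * ct θ ^ 2 - 34 / 10 * ct θ
          - m (ct θ) * (ct θ * (ct θ ^ 3 + A * ct θ ^ 2 - 1)) := by
        have b1 := mul_nonneg a1 (sub_nonneg.mpr hA')
        have b2 := mul_nonneg a2 (sub_nonneg.mpr hA)
        linear_combination (100 / 37) * b1 + (100 / 37) * b2
      have a4 := mul_nonneg hrs.le a3
      have hm' : m (ct θ) ≤ 0 := hm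
      linear_combination a4 + hm'

/-- A barrier given in the coordinate `s = y / x`, with a decay rate `κ`. -/
theorem Step.of_tan {a b s₀ s₁ : ℝ} (hab : a < b)
    (hσ : ∀ θ ∈ Icc a b, Real.cos θ ≠ 0 ∧ Real.tan θ ∈ Icc s₀ s₁)
    {h h' κ K : ℝ → ℝ} (hh : ContDiff ℝ 1 h)
    (hh' : ∀ s, HasDerivAt h (h' s) s) (hK : ∀ s, HasDerivAt K (κ s) s)
    (h1 : ∀ s ∈ Icc s₀ s₁, 0 < h s)
    (h2 : ∀ s ∈ Icc s₀ s₁, 0 < s ^ 2 * h s + (1 + 188 / 100 * s - s ^ 3))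
    (h3 : ∀ s ∈ Icc s₀ s₁, 0 < h' s * (s ^ 2 * h s + (1 + 188 / 100 * s - s ^ 3))
      - 2 * s * h s ^ 2)
    (h4 : ∀ s ∈ Icc s₀ s₁, 0 < h s * s ^ 2 + (1 / 2 + 1591 / 2000 * s + 17 / 100 * s ^ 2
      - 323 / 1000 * s ^ 4))
    (h5 : ∀ s ∈ Icc s₀ s₁, 0 ≤ κ s ∧ ∀ A, A = 188 / 100 ∨ A = 225 / 100 →
        0 ≤ κ s * (1 + A * s - s ^ 3) - (A + 34 / 10 * s - 3 * s ^ 2)) :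
    Step a b ((1 + Real.tan a ^ 2) / h (Real.tan a)) ((1 + Real.tan b ^ 2) / h (Real.tan b))
      (K (Real.tan a) - K (Real.tan b)) := by
  set ρ : ℝ → ℝ := fun θ => 1 / (Real.cos θ ^ 2 * h (Real.tan θ)) with hρ
  have hval : ∀ θ ∈ Icc a b, (1 + Real.tan θ ^ 2) / h (Real.tan θ) = ρ θ := by
    intro θ hθ
    have hc := (hσ θ hθ).1
    have := Real.inv_one_add_tan_sq hc
    simp only [hρ]
    rw [← this, one_div, mul_inv, inv_inv]
    rfl
  have hk : K (Real.tan a) - K (Real.tan b) = -K (Real.tan b) - -K (Real.tan a) := by ring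
  rw [hval a (left_mem_Icc.mpr hab.le), hval b (right_mem_Icc.mpr hab.le), hk]
  have hsc : ∀ θ ∈ Icc a b, Real.sin θ = Real.tan θ * Real.cos θ := fun θ hθ =>
    (Real.tan_mul_cos (hσ θ hθ).1).symm
  have hnn : ∀ A r, ∀ θ ∈ Icc a b, nF A θ r = Real.cos θ ^ 2 * Real.tan θ ^ 2
      + r * Real.cos θ ^ 4 * (1 + A * Real.tan θ - Real.tan θ ^ 3) := by
    intro A r θ hθ
    simp only [nF, hsc θ hθ]; ring
  have hee : ∀ A r, ∀ θ ∈ Icc a b, eF A θ r = -2 * r * (Real.cos θ ^ 2 * Real.tan θ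
      - r * Real.cos θ ^ 4 * Real.tan θ * (1 + A * Real.tan θ - Real.tan θ ^ 3)) := by
    intro A r θ hθ
    simp only [eF, hsc θ hθ]; ring
  refine Step.of_curve (ρ := ρ) (Λ := fun θ => -K (Real.tan θ))
    (μ := fun θ => -κ (Real.tan θ) / Real.cos θ ^ 2)
    (ρ' := fun θ => (2 * Real.cos θ ^ 2 * Real.tan θ * h (Real.tan θ) - h' (Real.tan θ))
      / (Real.cos θ ^ 4 * h (Real.tan θ) ^ 2)) hab ?_ ?_ ?_ ?_ ?_ ?_ ?_
  · intro θ hθ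
    obtain ⟨hc, hv⟩ := hσ θ hθ
    have hw := h1 _ hv
    refine ContDiffAt.div contDiffAt_const ?_ (by positivity)
    exact ContDiffAt.mul (by fun_prop) (hh.contDiffAt.comp θ (Real.contDiffAt_tan.mpr hc))
  · intro θ hθ
    obtain ⟨hc, hv⟩ := hσ θ hθ
    have hw := h1 _ hv
    have := (hasDerivAt_const θ (1 : ℝ)).div (((Real.hasDerivAt_cos θ).pow 2).mul
      ((hh' (Real.tan θ)).comp θ (Real.hasDerivAt_tan hc)))
      (by simp only [Pi.mul_apply, Pi.pow_apply, Function.comp]; positivity)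
    refine this.congr_deriv ?_
    simp only [Pi.mul_apply, Pi.pow_apply, Function.comp]
    rw [hsc θ hθ]
    field_simp
    push_cast
    ring
  · intro θ hθ
    obtain ⟨hc, hv⟩ := hσ θ hθ
    have hw := h1 _ hv
    have := h2 _ hv
    rw [hnn _ _ θ hθ]
    have e : Real.cos θ ^ 2 * Real.tan θ ^ 2
        + ρ θ * Real.cos θ ^ 4 * (1 + 188 / 100 * Real.tan θ - Real.tan θ ^ 3)
        = Real.cos θ ^ 2 / h (Real.tan θ) * (Real.tan θ ^ 2 * h (Real.tan θ)
          + (1 + 188 / 100 * Real.tan θ - Real.tan θ ^ 3)) := by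
      simp only [hρ]; field_simp
    rw [e]
    positivity
  · intro θ hθ
    obtain ⟨hc, hv⟩ := hσ θ hθ
    have hw := h1 _ hv
    have h3' := h3 _ hv
    rw [hnn _ _ θ hθ, hee _ _ θ hθ, ← sub_pos]
    have hid := Real.inv_one_add_tan_sq hc
    have hid' : Real.cos θ ^ 2 * (1 + Real.tan θ ^ 2) = 1 := by
      rw [← hid]; exact inv_mul_cancel₀ (by positivity)
    have e : -2 * ρ θ * (Real.cos θ ^ 2 * Real.tan θ
          - ρ θ * Real.cos θ ^ 4 * Real.tan θ * (1 + 188 / 100 * Real.tan θ - Real.tan θ ^ 3))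
        - (2 * Real.cos θ ^ 2 * Real.tan θ * h (Real.tan θ) - h' (Real.tan θ))
          / (Real.cos θ ^ 4 * h (Real.tan θ) ^ 2) * (Real.cos θ ^ 2 * Real.tan θ ^ 2
          + ρ θ * Real.cos θ ^ 4 * (1 + 188 / 100 * Real.tan θ - Real.tan θ ^ 3))
        = 1 / (Real.cos θ ^ 2 * h (Real.tan θ) ^ 3) * (h' (Real.tan θ) * (Real.tan θ ^ 2
          * h (Real.tan θ) + (1 + 188 / 100 * Real.tan θ - Real.tan θ ^ 3))
          - 2 * Real.tan θ * h (Real.tan θ) ^ 2) := by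
      simp only [hρ]; field_simp
      linear_combination (-200 * Real.tan θ * h (Real.tan θ) ^ 2) * hid'
    rw [e]
    exact mul_pos (by positivity) h3'
  · intro θ hθ
    obtain ⟨hc, hv⟩ := hσ θ hθ
    have hw := h1 _ hv
    have h4' := h4 _ hv
    have e : psiF (1591 / 2000) (17 / 100) (323 / 1000) θ (ρ θ) = 1 / h (Real.tan θ) ^ 2
        * (h (Real.tan θ) * Real.tan θ ^ 2 + (1 / 2 + 1591 / 2000 * Real.tan θ
          + 17 / 100 * Real.tan θ ^ 2 - 323 / 1000 * Real.tan θ ^ 4)) := by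
      simp only [psiF, hsc θ hθ, hρ]; field_simp
    rw [e]
    exact mul_pos (by positivity) h4'
  · intro θ hθ
    refine ((hK (Real.tan θ)).comp θ (Real.hasDerivAt_tan (hσ θ hθ).1)).neg.congr_deriv ?_
    ring
  · intro A hA hA' θ hθ r hr hn
    obtain ⟨hc, hv⟩ := hσ θ hθ
    have hw := h1 _ hv
    have hρpos : 0 < ρ θ := by simp only [hρ]; positivity
    have hr0 : 0 < r := hρpos.trans_le hr
    have e1 : -κ (Real.tan θ) / Real.cos θ ^ 2 * nF A θ r = -κ (Real.tan θ) * (Real.tan θ ^ 2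
      + r * Real.cos θ ^ 2 * (1 + A * Real.tan θ - Real.tan θ ^ 3)) := by
      rw [hnn _ _ θ hθ]; field_simp
    have e2 : r * (3 * Real.sin θ ^ 2 - A * Real.cos θ ^ 2
        - 34 / 10 * (Real.cos θ * Real.sin θ)) = r * Real.cos θ ^ 2
        * (3 * Real.tan θ ^ 2 - A - 34 / 10 * Real.tan θ) := by
      rw [hsc θ hθ]; ring
    rw [e1, e2]
    have hrs : 0 < r * Real.cos θ ^ 2 := by positivity
    obtain ⟨hm, h5⟩ := h5 _ hv
    have a1 := h5 _ (Or.inl rfl)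
    have a2 := h5 _ (Or.inr rfl)
    have a3 : 0 ≤ κ (Real.tan θ) * (1 + A * Real.tan θ - Real.tan θ ^ 3)
        - (A + 34 / 10 * Real.tan θ - 3 * Real.tan θ ^ 2) := by
      have b1 := mul_nonneg a1 (sub_nonneg.mpr hA')
      have b2 := mul_nonneg a2 (sub_nonneg.mpr hA)
      linear_combination (100 / 37) * b1 + (100 / 37) * b2
    have a4 := mul_nonneg hrs.le a3
    have a5 := mul_nonneg hm (sq_nonneg (Real.tan θ))
    linear_combination a4 + a5

/-- The form `∑ cᵢ pⁿ⁻ⁱ qⁱ` with coefficients `cᵢ`. -/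
noncomputable def bern : List ℝ → ℝ → ℝ → ℝ
  | [], _, _ => 0
  | c :: l, p, q => c * p ^ l.length + q * bern l p q

theorem bern_nonneg {p q : ℝ} (hp : 0 ≤ p) (hq : 0 ≤ q) :
    ∀ l : List ℝ, (∀ c ∈ l, 0 < c) → 0 ≤ bern l p q
  | [], _ => le_rfl
  | c :: l, h => by
    have h1 := h c (by simp)
    have h2 := bern_nonneg hp hq l fun x hx => h x (by simp [hx])
    simp only [bern]
    positivity

theorem bern_pos {p q : ℝ} (hp : 0 ≤ p) (hq : 0 ≤ q) (hpq : p + q = 1) :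
    ∀ l : List ℝ, l ≠ [] → (∀ c ∈ l, 0 < c) → 0 < bern l p q
  | [], h0, _ => absurd rfl h0
  | c :: l, _, h => by
    have h1 := h c (by simp)
    have h2 := bern_nonneg hp hq l fun x hx => h x (by simp [hx])
    simp only [bern]
    rcases hp.eq_or_lt with h3 | h3
    · rcases l with _ | ⟨d, l⟩
      · simpa [bern] using h1
      · have h4 := bern_pos hp hq hpq (d :: l) (by simp) fun x hx => h x (by simp [hx])
        have : 0 < q := by linarith
        positivity
    · positivity

/-- The antiderivative in `v` of the function with values `m₀`, `m₁` at `a`, `b`, affine. -/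
noncomputable def affInt (a b m₀ m₁ v : ℝ) : ℝ :=
  (m₁ * (v - a) ^ 2 - m₀ * (b - v) ^ 2) / (2 * (b - a))

theorem hasDerivAt_affInt {a b : ℝ} (hab : a < b) (m₀ m₁ v : ℝ) :
    HasDerivAt (affInt a b m₀ m₁) (m₀ * ((b - v) / (b - a)) + m₁ * ((v - a) / (b - a))) v := by
  have hL : b - a ≠ 0 := (sub_pos.mpr hab).ne'
  refine ((((((hasDerivAt_id' v).sub_const a).pow 2).const_mul m₁).sub
    ((((hasDerivAt_id' v).const_sub b).pow 2).const_mul m₀)).div_const _).congr_deriv ?_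
  field_simp
  push_cast
  ring

theorem affInt_sub {a b : ℝ} (hab : a < b) (m₀ m₁ : ℝ) :
    affInt a b m₀ m₁ b - affInt a b m₀ m₁ a = (b - a) * (m₀ + m₁) / 2 := by
  have hL : b - a ≠ 0 := (sub_pos.mpr hab).ne'
  unfold affInt
  field_simp
  ring

/-- The cubic with Bernstein coefficients `c₀, c₁, c₂, c₃` on `[a, b]`, up to binomials. -/
noncomputable def cub (a b c₀ c₁ c₂ c₃ v : ℝ) : ℝ :=
  c₀ * ((b - v) / (b - a)) ^ 3 + c₁ * ((b - v) / (b - a)) ^ 2 * ((v - a) / (b - a))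
    + c₂ * ((b - v) / (b - a)) * ((v - a) / (b - a)) ^ 2 + c₃ * ((v - a) / (b - a)) ^ 3

theorem cub_left {a b : ℝ} (hab : a < b) (c₀ c₁ c₂ c₃ : ℝ) : cub a b c₀ c₁ c₂ c₃ a = c₀ := by
  have hL : b - a ≠ 0 := (sub_pos.mpr hab).ne'
  simp [cub, div_self hL]

theorem cub_right {a b : ℝ} (hab : a < b) (c₀ c₁ c₂ c₃ : ℝ) : cub a b c₀ c₁ c₂ c₃ b = c₃ := by
  have hL : b - a ≠ 0 := (sub_pos.mpr hab).ne'
  simp [cub, div_self hL]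

theorem hasDerivAt_cub {a b : ℝ} (hab : a < b) (c₀ c₁ c₂ c₃ v : ℝ) :
    HasDerivAt (cub a b c₀ c₁ c₂ c₃) (((c₁ - 3 * c₀) * ((b - v) / (b - a)) ^ 2
      + 2 * (c₂ - c₁) * ((b - v) / (b - a)) * ((v - a) / (b - a))
      + (3 * c₃ - c₂) * ((v - a) / (b - a)) ^ 2) / (b - a)) v := by
  have hL : b - a ≠ 0 := (sub_pos.mpr hab).ne'
  have h1 : HasDerivAt (fun v => (b - v) / (b - a)) (-1 / (b - a)) v :=
    ((hasDerivAt_id' v).const_sub b).div_const _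
  have h2 : HasDerivAt (fun v => (v - a) / (b - a)) (1 / (b - a)) v :=
    ((hasDerivAt_id' v).sub_const a).div_const _
  refine (((((h1.pow 3).const_mul c₀).add (((h1.pow 2).const_mul c₁).mul h2)).add
    ((h1.const_mul c₂).mul (h2.pow 2))).add ((h2.pow 3).const_mul c₃)).congr_deriv ?_
  simp only [Pi.pow_apply]
  push_cast
  ring

/-- The coefficients of the cubic form of `v³ + A v² - 1` on `[a, b]`. -/
noncomputable def fB (A a b : ℝ) : Fin 4 → ℝ :=
  ![a ^ 3 + A * a ^ 2 - 1, 3 * a ^ 2 * b + A * (a ^ 2 + 2 * a * b) - 3,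
    3 * a * b ^ 2 + A * (2 * a * b + b ^ 2) - 3, b ^ 3 + A * b ^ 2 - 1]

/-- The coefficients of the quartic form of `v (v³ + A v² - 1) + e W`. -/
noncomputable def qB (A a b e c₀ c₁ c₂ c₃ : ℝ) : Fin 5 → ℝ :=
  ![a * fB A a b 0 + e * c₀, a * fB A a b 1 + b * fB A a b 0 + e * (c₀ + c₁),
    a * fB A a b 2 + b * fB A a b 1 + e * (c₁ + c₂),
    a * fB A a b 3 + b * fB A a b 2 + e * (c₂ + c₃), b * fB A a b 3 + e * c₃]

theorem fB_eq {A a b p q v : ℝ} (hv : v = a * p + b * q) (hpq : p + q = 1) :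
    v ^ 3 + A * v ^ 2 - 1 = fB A a b 0 * p ^ 3 + fB A a b 1 * p ^ 2 * q
      + fB A a b 2 * p * q ^ 2 + fB A a b 3 * q ^ 3 := by
  have : p = 1 - q := by linarith
  subst hv this
  simp [fB]
  ring

theorem qB_eq {A a b e c₀ c₁ c₂ c₃ p q v : ℝ} (hv : v = a * p + b * q) (hpq : p + q = 1) :
    v * (v ^ 3 + A * v ^ 2 - 1) + e * (c₀ * p ^ 3 + c₁ * p ^ 2 * q + c₂ * p * q ^ 2 + c₃ * q ^ 3)
      = qB A a b e c₀ c₁ c₂ c₃ 0 * p ^ 4 + qB A a b e c₀ c₁ c₂ c₃ 1 * p ^ 3 * q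
      + qB A a b e c₀ c₁ c₂ c₃ 2 * p ^ 2 * q ^ 2 + qB A a b e c₀ c₁ c₂ c₃ 3 * p * q ^ 3
      + qB A a b e c₀ c₁ c₂ c₃ 4 * q ^ 4 := by
  rw [fB_eq hv hpq]
  have : p = 1 - q := by linarith
  subst hv this
  simp [qB]
  ring

/-- The coefficients of the quintic form of the decay inequality. -/
noncomputable def decayB (A a b e c₀ c₁ c₂ c₃ m₀ m₁ : ℝ) : List ℝ :=
  let Q := qB A a b e c₀ c₁ c₂ c₃
  let d₀ := 3 - A * a ^ 2 - 34 / 10 * a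
  let d₁ := 6 - 2 * A * a * b - 34 / 10 * (a + b)
  let d₂ := 3 - A * b ^ 2 - 34 / 10 * b
  [d₀ - m₀ * Q 0, 3 * d₀ + d₁ - m₀ * Q 1 - m₁ * Q 0, 3 * d₀ + 3 * d₁ + d₂ - m₀ * Q 2 - m₁ * Q 1,
    d₀ + 3 * d₁ + 3 * d₂ - m₀ * Q 3 - m₁ * Q 2, d₁ + 3 * d₂ - m₀ * Q 4 - m₁ * Q 3, d₂ - m₁ * Q 4]

theorem decayB_eq {A a b e c₀ c₁ c₂ c₃ m₀ m₁ p q v : ℝ} (hv : v = a * p + b * q)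
    (hpq : p + q = 1) :
    3 - A * v ^ 2 - 34 / 10 * v - (m₀ * p + m₁ * q) * (v * (v ^ 3 + A * v ^ 2 - 1)
      + e * (c₀ * p ^ 3 + c₁ * p ^ 2 * q + c₂ * p * q ^ 2 + c₃ * q ^ 3))
      = bern (decayB A a b e c₀ c₁ c₂ c₃ m₀ m₁) p q := by
  rw [qB_eq hv hpq]
  simp only [decayB, bern, List.length]
  generalize qB A a b e c₀ c₁ c₂ c₃ = Q
  have : p = 1 - q := by linarith
  subst hv this
  ring

theorem pos_of_bern {l : List ℝ} (hl : l ≠ [] ∧ ∀ c ∈ l, 0 < c) {p q x : ℝ} (hp : 0 ≤ p)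
    (hq : 0 ≤ q) (hpq : p + q = 1) (hx : x = bern l p q) : 0 < x :=
  hx ▸ bern_pos hp hq hpq l hl.1 hl.2

/-- The coefficients of the form `2 W f - W' (v f + W)` for a cubic `W`. -/
noncomputable def slopeB (a b c₀ c₁ c₂ c₃ : ℝ) : List ℝ :=
  let F := fB (188 / 100) a b
  let Q := qB (188 / 100) a b 1 c₀ c₁ c₂ c₃
  let D₀ := (c₁ - 3 * c₀) / (b - a)
  let D₁ := 2 * (c₂ - c₁) / (b - a)
  let D₂ := (3 * c₃ - c₂) / (b - a)
  [2 * (c₀ * F 0) - D₀ * Q 0, 2 * (c₀ * F 1 + c₁ * F 0) - D₀ * Q 1 - D₁ * Q 0,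
    2 * (c₀ * F 2 + c₁ * F 1 + c₂ * F 0) - D₀ * Q 2 - D₁ * Q 1 - D₂ * Q 0,
    2 * (c₀ * F 3 + c₁ * F 2 + c₂ * F 1 + c₃ * F 0) - D₀ * Q 3 - D₁ * Q 2 - D₂ * Q 1,
    2 * (c₁ * F 3 + c₂ * F 2 + c₃ * F 1) - D₀ * Q 4 - D₁ * Q 3 - D₂ * Q 2,
    2 * (c₂ * F 3 + c₃ * F 2) - D₁ * Q 4 - D₂ * Q 3, 2 * (c₃ * F 3) - D₂ * Q 4]

/-- The coefficients of the form `W + v⁴/2 + a v³ + β v² - γ` for a cubic `W`. -/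
noncomputable def psiB (a b c₀ c₁ c₂ c₃ : ℝ) : List ℝ :=
  let g₀ := a ^ 2 / 2 + 1591 / 2000 * a + 17 / 100
  let g₁ := a * b + 1591 / 2000 * (a + b) + 34 / 100
  let g₂ := b ^ 2 / 2 + 1591 / 2000 * b + 17 / 100
  let k : ℝ := 323 / 1000
  [c₀ + a ^ 2 * g₀ - k, c₀ + c₁ + a ^ 2 * g₁ + 2 * a * b * g₀ - 4 * k,
    c₁ + c₂ + a ^ 2 * g₂ + 2 * a * b * g₁ + b ^ 2 * g₀ - 6 * k,
    c₂ + c₃ + 2 * a * b * g₂ + b ^ 2 * g₁ - 4 * k, c₃ + b ^ 2 * g₂ - k]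

/-- The quantities whose positivity makes a cubic `W` a barrier with decay rate `m₀ p + m₁ q`. -/
noncomputable def cubicB (a b c₀ c₁ c₂ c₃ m₀ m₁ e : ℝ) : List ℝ :=
  [c₀, c₁, c₂, c₃] ++ (let Q := qB (188 / 100) a b 1 c₀ c₁ c₂ c₃
    [Q 0, Q 1, Q 2, Q 3, Q 4]) ++ slopeB a b c₀ c₁ c₂ c₃ ++ psiB a b c₀ c₁ c₂ c₃
    ++ decayB (188 / 100) a b e c₀ c₁ c₂ c₃ m₀ m₁ ++ decayB (225 / 100) a b e c₀ c₁ c₂ c₃ m₀ m₁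

/-- A barrier given by a cubic in the coordinate `v = x / y`; all conditions are stated in terms
of Bernstein coefficients. -/
theorem Step.of_cubic {a b c₀ c₁ c₂ c₃ m₀ m₁ e : ℝ} (hab : a < b)
    (hm : 0 ≤ m₀ ∧ 0 ≤ m₁ ∧ e = 1 ∨ m₀ ≤ 0 ∧ m₁ ≤ 0 ∧ e = 0)
    (h : ∀ c ∈ cubicB a b c₀ c₁ c₂ c₃ m₀ m₁ e, 0 < c) :
    Step (acot b) (acot a) ((1 + b ^ 2) / c₃) ((1 + a ^ 2) / c₀) ((b - a) * (m₀ + m₁) / 2) := by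
  simp only [cubicB, List.mem_append, or_imp, forall_and] at h
  obtain ⟨⟨⟨⟨⟨h1, h2⟩, h3⟩, h4⟩, h5⟩, h5'⟩ := h
  have hL : 0 < b - a := sub_pos.mpr hab
  have hpq : ∀ v, (b - v) / (b - a) + (v - a) / (b - a) = 1 := by
    intro v; field_simp; ring
  have hv : ∀ v, v = a * ((b - v) / (b - a)) + b * ((v - a) / (b - a)) := by
    intro v; field_simp; ring
  have hp : ∀ v ∈ Icc a b, 0 ≤ (b - v) / (b - a) := fun v hv =>
    div_nonneg (by linarith [hv.2]) hL.le
  have hq : ∀ v ∈ Icc a b, 0 ≤ (v - a) / (b - a) := fun v hv =>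
    div_nonneg (by linarith [hv.1]) hL.le
  have key := Step.of_cot hab (W := cub a b c₀ c₁ c₂ c₃) (hM := hasDerivAt_affInt hab m₀ m₁)
    (by unfold cub; fun_prop) (hasDerivAt_cub hab c₀ c₁ c₂ c₃) ?_ ?_ ?_ ?_ ?_
  · rwa [affInt_sub hab, cub_left hab, cub_right hab] at key
  · intro v hv'
    refine pos_of_bern ⟨by simp, h1⟩ (hp v hv') (hq v hv') (hpq v) ?_
    simp only [cub, bern, List.length]
    ring
  · intro v hv'
    refine pos_of_bern ⟨by simp, h2⟩ (hp v hv') (hq v hv') (hpq v) ?_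
    have := qB_eq (A := 188 / 100) (e := 1) (c₀ := c₀) (c₁ := c₁) (c₂ := c₂) (c₃ := c₃) (hv v) (hpq v)
    rw [one_mul] at this
    unfold cub
    rw [this]
    simp only [bern, List.length]
    ring
  · intro v hv'
    refine pos_of_bern ⟨by simp [slopeB], h3⟩ (hp v hv') (hq v hv') (hpq v) ?_
    have := qB_eq (A := 188 / 100) (e := 1) (c₀ := c₀) (c₁ := c₁) (c₂ := c₂) (c₃ := c₃) (hv v) (hpq v)
    rw [one_mul] at this
    unfold cub
    rw [this, fB_eq (hv v) (hpq v)]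
    simp only [slopeB, bern, List.length]
    ring
  · intro v hv'
    refine pos_of_bern ⟨by simp [psiB], h4⟩ (hp v hv') (hq v hv') (hpq v) ?_
    simp only [cub, psiB, bern, List.length]
    have e1 := hv v
    have e2 := hpq v
    generalize (b - v) / (b - a) = p at *
    generalize (v - a) / (b - a) = q at *
    have : p = 1 - q := by linarith
    subst e1 this
    ring
  · have h6 : ∀ v ∈ Icc a b, ∀ A, A = 188 / 100 ∨ A = 225 / 100 → 0 ≤ 3 - A * v ^ 2 - 34 / 10 * v
        - (m₀ * ((b - v) / (b - a)) + m₁ * ((v - a) / (b - a)))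
        * (v * (v ^ 3 + A * v ^ 2 - 1) + e * cub a b c₀ c₁ c₂ c₃ v) := by
      intro v hv' A hA
      rw [cub, decayB_eq (hv v) (hpq v)]
      rcases hA with rfl | rfl
      · exact bern_nonneg (hp v hv') (hq v hv') _ h5
      · exact bern_nonneg (hp v hv') (hq v hv') _ h5'
    rcases hm with ⟨hm0, hm1, rfl⟩ | ⟨hm0, hm1, rfl⟩
    · refine Or.inl fun v hv' => ⟨?_, fun A hA => ?_⟩
      · have := hp v hv'
        have := hq v hv'
        positivity
      · have := h6 v hv' A hA
        rwa [one_mul] at this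
    · refine Or.inr fun v hv' => ⟨?_, fun A hA => ?_⟩
      · have := mul_nonneg (neg_nonneg.mpr hm0) (hp v hv')
        have := mul_nonneg (neg_nonneg.mpr hm1) (hq v hv')
        linarith
      · have := h6 v hv' A hA
        rwa [zero_mul, add_zero] at this

/-- The coefficients of the form of `1 + A s - s³`. -/
noncomputable def gB (A a b : ℝ) : Fin 4 → ℝ :=
  ![1 + A * a - a ^ 3, 3 + A * (2 * a + b) - 3 * a ^ 2 * b, 3 + A * (a + 2 * b) - 3 * a * b ^ 2,
    1 + A * b - b ^ 3]

/-- The coefficients of the form of `s² h + 1 + 188/100 s - s³`. -/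
noncomputable def uB (a b c₀ c₁ c₂ c₃ : ℝ) : Fin 6 → ℝ :=
  let G := gB (188 / 100) a b
  ![a ^ 2 * c₀ + G 0, a ^ 2 * c₁ + 2 * a * b * c₀ + 2 * G 0 + G 1,
    a ^ 2 * c₂ + 2 * a * b * c₁ + b ^ 2 * c₀ + G 0 + 2 * G 1 + G 2,
    a ^ 2 * c₃ + 2 * a * b * c₂ + b ^ 2 * c₁ + G 1 + 2 * G 2 + G 3,
    2 * a * b * c₃ + b ^ 2 * c₂ + G 2 + 2 * G 3, b ^ 2 * c₃ + G 3]

theorem gB_eq {A a b p q v : ℝ} (hv : v = a * p + b * q) (hpq : p + q = 1) :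
    1 + A * v - v ^ 3 = gB A a b 0 * p ^ 3 + gB A a b 1 * p ^ 2 * q
      + gB A a b 2 * p * q ^ 2 + gB A a b 3 * q ^ 3 := by
  have : p = 1 - q := by linarith
  subst hv this
  simp [gB]
  ring

theorem uB_eq {a b c₀ c₁ c₂ c₃ p q v : ℝ} (hv : v = a * p + b * q) (hpq : p + q = 1) :
    v ^ 2 * (c₀ * p ^ 3 + c₁ * p ^ 2 * q + c₂ * p * q ^ 2 + c₃ * q ^ 3) + (1 + 188 / 100 * v - v ^ 3)
      = uB a b c₀ c₁ c₂ c₃ 0 * p ^ 5 + uB a b c₀ c₁ c₂ c₃ 1 * p ^ 4 * q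
      + uB a b c₀ c₁ c₂ c₃ 2 * p ^ 3 * q ^ 2 + uB a b c₀ c₁ c₂ c₃ 3 * p ^ 2 * q ^ 3
      + uB a b c₀ c₁ c₂ c₃ 4 * p * q ^ 4 + uB a b c₀ c₁ c₂ c₃ 5 * q ^ 5 := by
  rw [gB_eq hv hpq]
  have : p = 1 - q := by linarith
  subst hv this
  simp [uB]
  ring

/-- The coefficients of the quartic form of the decay inequality near the vertical axis. -/
noncomputable def decayT (A a b m₀ m₁ : ℝ) : List ℝ :=
  let G := gB A a b
  let d₀ := A + 34 / 10 * a - 3 * a ^ 2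
  let d₁ := 2 * A + 34 / 10 * (a + b) - 6 * a * b
  let d₂ := A + 34 / 10 * b - 3 * b ^ 2
  [m₀ * G 0 - d₀, m₀ * G 1 + m₁ * G 0 - (2 * d₀ + d₁),
    m₀ * G 2 + m₁ * G 1 - (d₀ + 2 * d₁ + d₂), m₀ * G 3 + m₁ * G 2 - (d₁ + 2 * d₂), m₁ * G 3 - d₂]

theorem decayT_eq {A a b m₀ m₁ p q v : ℝ} (hv : v = a * p + b * q) (hpq : p + q = 1) :
    (m₀ * p + m₁ * q) * (1 + A * v - v ^ 3) - (A + 34 / 10 * v - 3 * v ^ 2)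
      = bern (decayT A a b m₀ m₁) p q := by
  rw [gB_eq hv hpq]
  simp only [decayT, bern, List.length]
  generalize gB A a b = G
  have : p = 1 - q := by linarith
  subst hv this
  ring

/-- A barrier given by a cubic in the coordinate `s = y / x`; all conditions are stated in terms
of Bernstein coefficients. -/
theorem Step.of_cubic_tan {a b c₀ c₁ c₂ c₃ m₀ m₁ α β : ℝ} (hαβ : α < β) (hab : a < b)
    (hα : Real.tan α = a) (hβ : Real.tan β = b)
    (hσ : ∀ θ ∈ Icc α β, Real.cos θ ≠ 0 ∧ Real.tan θ ∈ Icc a b)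
    (h1 : ∀ c ∈ [c₀, c₁, c₂, c₃], 0 < c)
    (h2 : ∀ c ∈ (let U := uB a b c₀ c₁ c₂ c₃
      [U 0, U 1, U 2, U 3, U 4, U 5]), 0 < c)
    (h3 : ∀ c ∈ (let U := uB a b c₀ c₁ c₂ c₃
      let D₀ := (c₁ - 3 * c₀) / (b - a)
      let D₁ := 2 * (c₂ - c₁) / (b - a)
      let D₂ := (3 * c₃ - c₂) / (b - a)
      let s₀ := c₀ ^ 2
      let s₁ := 2 * c₀ * c₁
      let s₂ := 2 * c₀ * c₂ + c₁ ^ 2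
      let s₃ := 2 * c₀ * c₃ + 2 * c₁ * c₂
      let s₄ := 2 * c₁ * c₃ + c₂ ^ 2
      let s₅ := 2 * c₂ * c₃
      let s₆ := c₃ ^ 2
      [D₀ * U 0 - 2 * a * s₀, D₀ * U 1 + D₁ * U 0 - 2 * (a * s₁ + b * s₀),
        D₀ * U 2 + D₁ * U 1 + D₂ * U 0 - 2 * (a * s₂ + b * s₁),
        D₀ * U 3 + D₁ * U 2 + D₂ * U 1 - 2 * (a * s₃ + b * s₂),
        D₀ * U 4 + D₁ * U 3 + D₂ * U 2 - 2 * (a * s₄ + b * s₃),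
        D₀ * U 5 + D₁ * U 4 + D₂ * U 3 - 2 * (a * s₅ + b * s₄),
        D₁ * U 5 + D₂ * U 4 - 2 * (a * s₆ + b * s₅), D₂ * U 5 - 2 * b * s₆]), 0 < c)
    (h4 : ∀ c ∈ (let k : ℝ := 323 / 1000
      let l : ℝ := 1591 / 2000
      let n : ℝ := 17 / 100
      let z₀ := 1 / 2 + l * a + n * a ^ 2 - k * a ^ 4
      let z₁ := 2 + l * (3 * a + b) + n * (2 * a ^ 2 + 2 * a * b) - 4 * k * a ^ 3 * b
      let z₂ := 3 + l * (3 * a + 3 * b) + n * (a ^ 2 + 4 * a * b + b ^ 2) - 6 * k * a ^ 2 * b ^ 2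
      let z₃ := 2 + l * (a + 3 * b) + n * (2 * a * b + 2 * b ^ 2) - 4 * k * a * b ^ 3
      let z₄ := 1 / 2 + l * b + n * b ^ 2 - k * b ^ 4
      [c₀ * a ^ 2 + z₀, c₁ * a ^ 2 + 2 * a * b * c₀ + z₀ + z₁,
        c₂ * a ^ 2 + 2 * a * b * c₁ + b ^ 2 * c₀ + z₁ + z₂,
        c₃ * a ^ 2 + 2 * a * b * c₂ + b ^ 2 * c₁ + z₂ + z₃,
        2 * a * b * c₃ + b ^ 2 * c₂ + z₃ + z₄, b ^ 2 * c₃ + z₄]), 0 < c)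
    (hm : 0 ≤ m₀ ∧ 0 ≤ m₁)
    (h5 : ∀ c ∈ decayT (188 / 100) a b m₀ m₁ ++ decayT (225 / 100) a b m₀ m₁, 0 < c) :
    Step α β ((1 + a ^ 2) / c₀) ((1 + b ^ 2) / c₃) (-((b - a) * (m₀ + m₁) / 2)) := by
  have hL : 0 < b - a := sub_pos.mpr hab
  have hpq : ∀ v, (b - v) / (b - a) + (v - a) / (b - a) = 1 := by
    intro v; field_simp; ring
  have hv : ∀ v, v = a * ((b - v) / (b - a)) + b * ((v - a) / (b - a)) := by
    intro v; field_simp; ring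
  have hp : ∀ v ∈ Icc a b, 0 ≤ (b - v) / (b - a) := fun v hv =>
    div_nonneg (by linarith [hv.2]) hL.le
  have hq : ∀ v ∈ Icc a b, 0 ≤ (v - a) / (b - a) := fun v hv =>
    div_nonneg (by linarith [hv.1]) hL.le
  have key := Step.of_tan hαβ hσ (h := cub a b c₀ c₁ c₂ c₃) (hK := hasDerivAt_affInt hab m₀ m₁)
    (by unfold cub; fun_prop) (hasDerivAt_cub hab c₀ c₁ c₂ c₃) ?_ ?_ ?_ ?_ ?_
  · rw [hα, hβ, cub_left hab, cub_right hab] at key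
    rwa [← affInt_sub hab, neg_sub]
  · intro v hv'
    refine pos_of_bern ⟨by simp, h1⟩ (hp v hv') (hq v hv') (hpq v) ?_
    simp only [cub, bern, List.length]
    ring
  · intro v hv'
    refine pos_of_bern ⟨by simp, h2⟩ (hp v hv') (hq v hv') (hpq v) ?_
    unfold cub
    rw [uB_eq (hv v) (hpq v)]
    simp only [bern, List.length]
    ring
  · intro v hv'
    refine pos_of_bern ⟨by simp, h3⟩ (hp v hv') (hq v hv') (hpq v) ?_
    unfold cub
    rw [uB_eq (hv v) (hpq v)]
    simp only [bern, List.length]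
    have e1 := hv v
    have e2 := hpq v
    generalize (b - v) / (b - a) = p at *
    generalize (v - a) / (b - a) = q at *
    generalize uB a b c₀ c₁ c₂ c₃ = U
    subst e1
    ring
  · intro v hv'
    refine pos_of_bern ⟨by simp, h4⟩ (hp v hv') (hq v hv') (hpq v) ?_
    simp only [cub, bern, List.length]
    have e1 := hv v
    have e2 := hpq v
    generalize (b - v) / (b - a) = p at *
    generalize (v - a) / (b - a) = q at *
    have : p = 1 - q := by linarith
    subst e1 this
    ring
  · intro v hv'
    have h7 := hp v hv'
    have h8 := hq v hv'
    have h9 := hm.1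
    have h10 := hm.2
    refine ⟨by positivity, fun A hA => ?_⟩
    rw [decayT_eq (hv v) (hpq v)]
    refine bern_nonneg (hp v hv') (hq v hv') _ fun c hc => h5 c ?_
    rcases hA with rfl | rfl <;> simp [hc]

theorem tan_acot (v : ℝ) : Real.tan (acot v) = 1 / v := by
  rw [Real.tan_eq_sin_div_cos, ← inv_div, cot_acot, one_div]

theorem cos_ne_zero_and_tan_mem {a b θ : ℝ} (ha : -(Real.pi / 2) < a) (hb : b < Real.pi / 2)
    (hθ : θ ∈ Icc a b) : Real.cos θ ≠ 0 ∧ Real.tan θ ∈ Icc (Real.tan a) (Real.tan b) := by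
  have h1 : θ ∈ Ioo (-(Real.pi / 2)) (Real.pi / 2) := ⟨ha.trans_le hθ.1, hθ.2.trans_lt hb⟩
  refine ⟨(Real.cos_pos_of_mem_Ioo h1).ne', ?_, ?_⟩
  · exact Real.strictMonoOn_tan.monotoneOn ⟨ha, hθ.1.trans_lt h1.2⟩ h1 hθ.1
  · exact Real.strictMonoOn_tan.monotoneOn h1 ⟨h1.1.trans_le hθ.2, hb⟩ hθ.2

theorem step_right : Step 0 (acot 2) ((1 + 0 ^ 2) / (61 / 100)) ((1 + 2 ^ 2) / (2747 / 1000))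
    (-((967 / 1000))) := by
  have h2 := tan_acot 2
  have h3 : acot 2 < Real.pi / 2 := by
    have := Real.arctan_pos.mpr (two_pos (α := ℝ))
    unfold acot; linarith
  have := Step.of_cubic_tan (a := 0) (b := 1 / 2) (c₀ := (61 / 100)) (c₁ := (921 / 500))
    (c₂ := (7721 / 4000)) (c₃ := (2747 / 4000))
    (m₀ := (2259 / 1000)) (m₁ := (1609 / 1000)) (acot_pos 2) (by norm_num) Real.tan_zero h2
    (fun θ hθ => by
      have := cos_ne_zero_and_tan_mem (by linarith [Real.pi_pos]) h3 hθ
      rwa [Real.tan_zero, h2] at this)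
    (by norm_num) (by simp only [gB, uB, Matrix.cons_val]; norm_num)
    (by simp only [gB, uB, Matrix.cons_val]; norm_num) (by norm_num) (by norm_num)
    (by simp only [gB, decayT, Matrix.cons_val]; norm_num)
  convert this using 1 <;> norm_num

theorem step_left :
    Step (acot (-4)) Real.pi ((1 + (-4) ^ 2) / (1277 / 125)) ((1 + 0 ^ 2) / (61 / 100))
    (-((991 / 1600))) := by
  have h2 := tan_acot (-4)
  have h3 : Real.pi / 2 < acot (-4) := by
    have := Real.arctan_lt_zero.mpr (show (-4 : ℝ) < 0 by norm_num)
    unfold acot; linarith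
  have := Step.of_cubic_tan (a := 1 / (-4)) (b := 0) (c₀ := (1277 / 2000)) (c₁ := (3669 / 2000))
    (c₂ := (228 / 125)) (c₃ := (61 / 100))
    (m₀ := (337 / 125)) (m₁ := (2259 / 1000)) (acot_lt_pi (-4)) (by norm_num) h2 Real.tan_pi
    (fun θ hθ => by
      have := cos_ne_zero_and_tan_mem (a := acot (-4) - Real.pi) (b := 0) (θ := θ - Real.pi)
        (by linarith) (by linarith [Real.pi_pos]) ⟨by linarith [hθ.1], by linarith [hθ.2]⟩
      rwa [Real.tan_zero, Real.tan_sub_pi, Real.tan_sub_pi, Real.cos_sub_pi, neg_ne_zero, h2]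
        at this)
    (by norm_num) (by simp only [gB, uB, Matrix.cons_val]; norm_num)
    (by simp only [gB, uB, Matrix.cons_val]; norm_num) (by norm_num) (by norm_num)
    (by simp only [gB, decayT, Matrix.cons_val]; norm_num)
  convert this using 1 <;> norm_num

set_option maxHeartbeats 1000000 in
theorem step_right_arc : Step (acot 2) (acot (63 / 100)) ((1 + 2 ^ 2) / (2747 / 1000))
    ((1 + (63 / 100) ^ 2) / (383 / 625)) (-2019 / 1600) := by
  have h0 := Step.of_cubic (a := (3 / 2)) (b := 2)
      (c₀ := (207 / 125)) (c₁ := (738 / 125)) (c₂ := (2799 / 400)) (c₃ := (2747 / 1000))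
    (m₀ := (-643 / 1000)) (m₁ := (-401 / 1000)) (e := 0)
    (by norm_num) (by norm_num)
    (by simp only [cubicB, qB, fB, slopeB, psiB, decayB, Matrix.cons_val]; norm_num)
  have h1 := Step.of_cubic (a := (11 / 10)) (b := (3 / 2))
      (c₀ := (632 / 625)) (c₁ := (357 / 100)) (c₂ := (2637 / 625)) (c₃ := (207 / 125))
    (m₀ := (-1053 / 1000)) (m₁ := (-643 / 1000)) (e := 0)
    (by norm_num) (by norm_num)
    (by simp only [cubicB, qB, fB, slopeB, psiB, decayB, Matrix.cons_val]; norm_num)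
  have h2 := Step.of_cubic (a := (9 / 10)) (b := (11 / 10))
      (c₀ := (31 / 40)) (c₁ := (3157 / 1250)) (c₂ := (13827 / 5000)) (c₃ := (632 / 625))
    (m₀ := (-1407 / 1000)) (m₁ := (-1053 / 1000)) (e := 0)
    (by norm_num) (by norm_num)
    (by simp only [cubicB, qB, fB, slopeB, psiB, decayB, Matrix.cons_val]; norm_num)
  have h3 := Step.of_cubic (a := (3 / 4)) (b := (9 / 10))
      (c₀ := (6517 / 10000)) (c₁ := (8181 / 4000)) (c₂ := (43491 / 20000)) (c₃ := (31 / 40))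
    (m₀ := (-863 / 500)) (m₁ := (-1407 / 1000)) (e := 0)
    (by norm_num) (by norm_num)
    (by simp only [cubicB, qB, fB, slopeB, psiB, decayB, Matrix.cons_val]; norm_num)
  have h4 := Step.of_cubic (a := (17 / 25)) (b := (3 / 4))
      (c₀ := (3099 / 5000)) (c₁ := (187963 / 100000)) (c₂ := (191303 / 100000)) (c₃ := (6517 / 10000))
    (m₀ := (-204 / 125)) (m₁ := (-1763 / 1000)) (e := 0)
    (by norm_num) (by norm_num)
    (by simp only [cubicB, qB, fB, slopeB, psiB, decayB, Matrix.cons_val]; norm_num)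
  have h5 := Step.of_cubic (a := (63 / 100)) (b := (17 / 25))
      (c₀ := (383 / 625)) (c₁ := (36743 / 20000)) (c₂ := (36899 / 20000)) (c₃ := (3099 / 5000))
    (m₀ := (-821 / 1000)) (m₁ := (-827 / 500)) (e := 0)
    (by norm_num) (by norm_num)
    (by simp only [cubicB, qB, fB, slopeB, psiB, decayB, Matrix.cons_val]; norm_num)
  convert (((((h0.trans h1).trans h2).trans h3).trans h4).trans h5) using 1
  norm_num

set_option maxHeartbeats 1000000 in
theorem step_middle_arc :
    Step (acot (63 / 100)) (acot (-13 / 10)) ((1 + (63 / 100) ^ 2) / (383 / 625))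
    ((1 + (-13 / 10) ^ 2) / (2951 / 1000)) (598059 / 200000) := by
  have h0 := Step.of_cubic (a := (123 / 200)) (b := (63 / 100))
      (c₀ := (6141 / 10000)) (c₁ := (368049 / 200000)) (c₂ := (73551 / 40000)) (c₃ := (383 / 625))
    (m₀ := 0) (m₁ := (-411 / 1000)) (e := 0)
    (by norm_num) (by norm_num)
    (by simp only [cubicB, qB, fB, slopeB, psiB, decayB, Matrix.cons_val]; norm_num)
  have h1 := Step.of_cubic (a := (3 / 5)) (b := (123 / 200))
      (c₀ := (617 / 1000)) (c₁ := (369429 / 200000)) (c₂ := (368871 / 200000)) (c₃ := (6141 / 10000))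
    (m₀ := (233 / 1000)) (m₁ := (21 / 250)) (e := 1)
    (by norm_num) (by norm_num)
    (by simp only [cubicB, qB, fB, slopeB, psiB, decayB, Matrix.cons_val]; norm_num)
  have h2 := Step.of_cubic (a := (1 / 2)) (b := (3 / 5))
      (c₀ := (3439 / 5000)) (c₁ := (2433 / 1250)) (c₂ := (18767 / 10000)) (c₃ := (617 / 1000))
    (m₀ := (1383 / 1000)) (m₁ := (207 / 1000)) (e := 1)
    (by norm_num) (by norm_num)
    (by simp only [cubicB, qB, fB, slopeB, psiB, decayB, Matrix.cons_val]; norm_num)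
  have h3 := Step.of_cubic (a := (2 / 5)) (b := (1 / 2))
      (c₀ := (337 / 400)) (c₁ := (23427 / 10000)) (c₂ := (5451 / 2500)) (c₃ := (3439 / 5000))
    (m₀ := (2087 / 1000)) (m₁ := (1383 / 1000)) (e := 1)
    (by norm_num) (by norm_num)
    (by simp only [cubicB, qB, fB, slopeB, psiB, decayB, Matrix.cons_val]; norm_num)
  have h4 := Step.of_cubic (a := (1 / 5)) (b := (2 / 5))
      (c₀ := (3153 / 2500)) (c₁ := (4181 / 1250)) (c₂ := (28971 / 10000)) (c₃ := (337 / 400))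
    (m₀ := (2061 / 1000)) (m₁ := (2087 / 1000)) (e := 1)
    (by norm_num) (by norm_num)
    (by simp only [cubicB, qB, fB, slopeB, psiB, decayB, Matrix.cons_val]; norm_num)
  have h5 := Step.of_cubic (a := (-1 / 10)) (b := (1 / 5))
      (c₀ := (9459 / 5000)) (c₁ := (3183 / 625)) (c₂ := (22209 / 5000)) (c₃ := (3153 / 2500))
    (m₀ := (323 / 200)) (m₁ := (409 / 200)) (e := 1)
    (by norm_num) (by norm_num)
    (by simp only [cubicB, qB, fB, slopeB, psiB, decayB, Matrix.cons_val]; norm_num)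
  have h6 := Step.of_cubic (a := (-1 / 2)) (b := (-1 / 10))
      (c₀ := (12683 / 5000)) (c₁ := (35567 / 5000)) (c₂ := (32261 / 5000)) (c₃ := (9459 / 5000))
    (m₀ := (178 / 125)) (m₁ := (1617 / 1000)) (e := 1)
    (by norm_num) (by norm_num)
    (by simp only [cubicB, qB, fB, slopeB, psiB, decayB, Matrix.cons_val]; norm_num)
  have h7 := Step.of_cubic (a := (-9 / 10)) (b := (-1 / 2))
      (c₀ := (28721 / 10000)) (c₁ := (84359 / 10000)) (c₂ := (40531 / 5000)) (c₃ := (12683 / 5000))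
    (m₀ := (1483 / 1000)) (m₁ := (36 / 25)) (e := 1)
    (by norm_num) (by norm_num)
    (by simp only [cubicB, qB, fB, slopeB, psiB, decayB, Matrix.cons_val]; norm_num)
  have h8 := Step.of_cubic (a := (-13 / 10)) (b := (-9 / 10))
      (c₀ := (2951 / 1000)) (c₁ := (44099 / 5000)) (c₂ := (87967 / 10000)) (c₃ := (28721 / 10000))
    (m₀ := (178 / 125)) (m₁ := (1483 / 1000)) (e := 1)
    (by norm_num) (by norm_num)
    (by simp only [cubicB, qB, fB, slopeB, psiB, decayB, Matrix.cons_val]; norm_num)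
  convert ((((((((h0.trans h1).trans h2).trans h3).trans h4).trans h5).trans h6).trans h7).trans h8) using 1
  norm_num

set_option maxHeartbeats 1000000 in
theorem step_left_arc : Step (acot (-13 / 10)) (acot (-4)) ((1 + (-13 / 10) ^ 2) / (2951 / 1000))
    ((1 + (-4) ^ 2) / (1277 / 125)) (18619 / 200000) := by
  have h0 := Step.of_cubic (a := (-17 / 10)) (b := (-13 / 10))
      (c₀ := (773 / 250)) (c₁ := (22399 / 2500)) (c₂ := (44431 / 5000)) (c₃ := (2951 / 1000))
    (m₀ := (171 / 200)) (m₁ := (178 / 125)) (e := 1)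
    (by norm_num) (by norm_num)
    (by simp only [cubicB, qB, fB, slopeB, psiB, decayB, Matrix.cons_val]; norm_num)
  have h1 := Step.of_cubic (a := (-19 / 10)) (b := (-17 / 10))
      (c₀ := (1653 / 500)) (c₁ := (24117 / 2500)) (c₂ := (47171 / 5000)) (c₃ := (773 / 250))
    (m₀ := (119 / 250)) (m₁ := (171 / 200)) (e := 1)
    (by norm_num) (by norm_num)
    (by simp only [cubicB, qB, fB, slopeB, psiB, decayB, Matrix.cons_val]; norm_num)
  have h2 := Step.of_cubic (a := (-53 / 25)) (b := (-19 / 10))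
      (c₀ := (917 / 250)) (c₁ := (105827 / 10000)) (c₂ := (31926 / 3125)) (c₃ := (1653 / 500))
    (m₀ := 0) (m₁ := (197 / 500)) (e := 1)
    (by norm_num) (by norm_num)
    (by simp only [cubicB, qB, fB, slopeB, psiB, decayB, Matrix.cons_val]; norm_num)
  have h3 := Step.of_cubic (a := (-11 / 5)) (b := (-53 / 25))
      (c₀ := (3829 / 1000)) (c₁ := (56597 / 5000)) (c₂ := (27893 / 2500)) (c₃ := (917 / 250))
    (m₀ := (-273 / 1000)) (m₁ := 0) (e := 0)
    (by norm_num) (by norm_num)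
    (by simp only [cubicB, qB, fB, slopeB, psiB, decayB, Matrix.cons_val]; norm_num)
  have h4 := Step.of_cubic (a := (-49 / 20)) (b := (-11 / 5))
      (c₀ := (552 / 125)) (c₁ := (25203 / 2000)) (c₂ := (48043 / 4000)) (c₃ := (3829 / 1000))
    (m₀ := (-56 / 125)) (m₁ := (-343 / 1000)) (e := 0)
    (by norm_num) (by norm_num)
    (by simp only [cubicB, qB, fB, slopeB, psiB, decayB, Matrix.cons_val]; norm_num)
  have h5 := Step.of_cubic (a := (-14 / 5)) (b := (-49 / 20))
      (c₀ := (678 / 125)) (c₁ := (303327 / 20000)) (c₂ := (141531 / 10000)) (c₃ := (552 / 125))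
    (m₀ := (-347 / 1000)) (m₁ := (-417 / 1000)) (e := 0)
    (by norm_num) (by norm_num)
    (by simp only [cubicB, qB, fB, slopeB, psiB, decayB, Matrix.cons_val]; norm_num)
  have h6 := Step.of_cubic (a := (-33 / 10)) (b := (-14 / 5))
      (c₀ := (898 / 125)) (c₁ := (19617 / 1000)) (c₂ := (35703 / 2000)) (c₃ := (678 / 125))
    (m₀ := (-251 / 1000)) (m₁ := (-69 / 200)) (e := 0)
    (by norm_num) (by norm_num)
    (by simp only [cubicB, qB, fB, slopeB, psiB, decayB, Matrix.cons_val]; norm_num)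
  have h7 := Step.of_cubic (a := (-4)) (b := (-33 / 10))
      (c₀ := (1277 / 125)) (c₁ := (17062 / 625)) (c₂ := (24261 / 1000)) (c₃ := (898 / 125))
    (m₀ := (-21 / 125)) (m₁ := (-251 / 1000)) (e := 0)
    (by norm_num) (by norm_num)
    (by simp only [cubicB, qB, fB, slopeB, psiB, decayB, Matrix.cons_val]; norm_num)
  convert (((((((h0.trans h1).trans h2).trans h3).trans h4).trans h5).trans h6).trans h7) using 1
  norm_num

theorem step_half_turn : ∃ k, 0 < k ∧ Step 0 Real.pi (1 / (61 / 100)) (1 / (61 / 100)) k := by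
  have := (((step_right.trans step_right_arc).trans step_middle_arc).trans step_left_arc).trans
    step_left
  refine ⟨_, ?_, by simpa only [ne_eq, OfNat.ofNat_ne_zero, not_false_eq_true, zero_pow, add_zero] using this⟩
  norm_num

theorem jF_expF_add_pi (A θ r₁ r₂ : ℝ) :
    jF A expF (θ + Real.pi) r₁ r₂ = jF A expF θ r₁ r₂ := by
  simp only [jF, expF, nF_add_pi, Real.cos_add_pi, neg_sq]

theorem jF_pos {A θ : ℝ} {R₁ R₂ : ℝ} (b : ℝ × ℝ → ℝ) (hb : Continuous b)
    (h₁ : 0 < nF A θ R₁) (h₂ : 0 < nF A θ R₂) (hlt : R₂ < R₁) : 0 < jF A b θ R₁ R₂ := by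
  unfold jF
  have hc : Continuous fun r => Real.exp (b (θ, r)) * nF A θ r := by unfold nF; fun_prop
  refine intervalIntegral.intervalIntegral_pos_of_pos_on (hc.intervalIntegrable _ _)
    (fun r hr => mul_pos (Real.exp_pos _) ?_) hlt
  exact nF_pos_of_mem h₂ h₁ ⟨hr.1.le, hr.2.le⟩

theorem continuous_expF : Continuous expF := by
  unfold expF; fun_prop

/-- Uniqueness of the periodic orbit for parameters near the heteroclinic one. -/
theorem IsPol.unique_large {A : ℝ} (h0 : 188 / 100 ≤ A) (hA : A ≤ 225 / 100) {R₁ R₂ : ℝ → ℝ}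
    (h₁ : IsPol A R₁) (h₂ : IsPol A R₂) (p₁ : ∀ θ, R₁ (θ + Real.pi) = R₁ θ)
    (p₂ : ∀ θ, R₂ (θ + Real.pi) = R₂ θ) (hlt : R₂ 0 < R₁ 0) : False := by
  obtain ⟨k, hk, hS⟩ := step_half_turn
  obtain ⟨-, hd, he⟩ := hS A h0 hA R₂ h₂
  have q₁ := p₁ 0
  have q₂ := p₂ 0
  rw [zero_add] at q₁ q₂
  rcases le_or_gt (1 / (61 / 100)) (R₂ 0) with h | h
  · have := he R₁ h₁ (fun θ => (h₂.lt_of_lt h₁ hlt θ).le) h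
    have e := jF_expF_add_pi A 0 (R₁ 0) (R₂ 0)
    rw [zero_add] at e
    rw [q₁, q₂, e] at this
    have hJ := jF_pos expF continuous_expF (h₁ 0).2.1 (h₂ 0).2.1 hlt
    have : Real.exp (-k) < 1 := Real.exp_lt_one_iff.mpr (by linarith)
    nlinarith
  · have := hd (by rwa [q₂])
    have e := jF_dulF_add_pi (188 / 100) (1591 / 2000) (17 / 100) (323 / 1000) 0
      (1 / (61 / 100)) (R₂ 0)
    rw [zero_add] at e
    unfold dulB at this
    rw [q₂, e] at this
    exact lt_irrefl _ this

/-- Two periodic orbits coincide. -/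
theorem IsPol.unique {A : ℝ} (h0 : 0 < A) (hA : A ≤ 225 / 100) {R₁ R₂ : ℝ → ℝ}
    (h₁ : IsPol A R₁) (h₂ : IsPol A R₂) (p₁ : ∀ θ, R₁ (θ + Real.pi) = R₁ θ)
    (p₂ : ∀ θ, R₂ (θ + Real.pi) = R₂ θ) : R₁ = R₂ := by
  have key : ∀ {S₁ S₂ : ℝ → ℝ}, IsPol A S₁ → IsPol A S₂ → (∀ θ, S₁ (θ + Real.pi) = S₁ θ) →
      (∀ θ, S₂ (θ + Real.pi) = S₂ θ) → ¬ S₂ 0 < S₁ 0 := fun g₁ g₂ k₁ k₂ hlt => by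
    rcases le_total A (188 / 100) with h | h
    · exact g₁.unique_small h0 h g₂ k₁ k₂ hlt
    · exact g₁.unique_large h hA g₂ k₁ k₂ hlt
  exact h₁.ext_of_eq h₂ (le_antisymm (not_lt.mp (key h₁ h₂ p₁ p₂)) (not_lt.mp (key h₂ h₁ p₂ p₁)))

theorem nonpos_of_deriv_neg_at_zero {N N' p : ℝ → ℝ} (hN : ∀ t, HasDerivAt N (N' t) t)
    (hp : Continuous p) (h0 : ∀ t, N t ≤ 0 → p t ≠ 0) (hz : ∀ t, N t = 0 → 0 < p t → N' t < 0)
    {a : ℝ} (ha : N a ≤ 0) (hpa : 0 < p a) {t : ℝ} (ht : a ≤ t) : N t ≤ 0 := by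
  have hNc : Continuous N := continuous_iff_continuousAt.mpr fun t => (hN t).continuousAt
  have hset : {t | N t ≤ 0 ∧ 0 < p t} = {t | N t ≤ 0} ∩ {t | 0 ≤ p t} := by
    ext s
    exact ⟨fun h => ⟨h.1, h.2.le⟩, fun h => ⟨h.1, lt_of_le_of_ne h.2 (h0 s h.1).symm⟩⟩
  have hcl : IsClosed {t | N t ≤ 0 ∧ 0 < p t} :=
    hset ▸ (isClosed_le hNc continuous_const).inter (isClosed_le continuous_const hp)
  have := (hcl.inter isClosed_Icc).Icc_subset_of_forall_mem_nhdsWithin (a := a) (b := t) ⟨ha, hpa⟩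
    fun s hs => ?_
  · exact (this ⟨ht, le_rfl⟩).1
  have h2 : ∀ᶠ r in 𝓝[>] s, 0 < p r :=
    (hp.continuousAt.eventually (lt_mem_nhds hs.1.2)).filter_mono nhdsWithin_le_nhds
  have h3 : ∀ᶠ r in 𝓝[>] s, N r ≤ 0 := by
    rcases hs.1.1.lt_or_eq with h | h
    · exact ((hNc.continuousAt.eventually (gt_mem_nhds h)).filter_mono nhdsWithin_le_nhds).mono
        fun _ => le_of_lt
    · have h4 : Tendsto (slope N s) (𝓝[>] s) (𝓝 (N' s)) :=
        ((hasDerivAt_iff_tendsto_slope.mp (hN s))).mono_left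
          (nhdsWithin_mono _ fun x hx => ne_of_gt hx)
      filter_upwards [h4.eventually (gt_mem_nhds (hz s h hs.1.2)), self_mem_nhdsWithin] with r h5 h6
      rw [slope_def_field, h, sub_zero] at h5
      have h7 : 0 < r - s := sub_pos.mpr h6
      rcases div_neg_iff.mp h5 with h | h
      · linarith [h.2]
      · exact h.1.le
  filter_upwards [h2, h3] with r h4 h5 using ⟨h5, h4⟩

/-- The polar angle along a plane curve avoiding the origin. -/
theorem exists_polar_lift {x y x' y' : ℝ → ℝ} (hx : ∀ t, HasDerivAt x (x' t) t)
    (hy : ∀ t, HasDerivAt y (y' t) t) (hx' : Continuous x') (hy' : Continuous y')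
    (h0 : ∀ t, 0 < x t ^ 2 + y t ^ 2) :
    ∃ φ : ℝ → ℝ, (∀ t, HasDerivAt φ ((y t * x' t - x t * y' t) / (x t ^ 2 + y t ^ 2)) t) ∧
      ∀ t, x t = √(x t ^ 2 + y t ^ 2) * Real.cos (-φ t) ∧
        y t = √(x t ^ 2 + y t ^ 2) * Real.sin (-φ t) := by
  have hxc : Continuous x := continuous_iff_continuousAt.mpr fun t => (hx t).continuousAt
  have hyc : Continuous y := continuous_iff_continuousAt.mpr fun t => (hy t).continuousAt
  set k : ℝ → ℝ := fun t => (y t * x' t - x t * y' t) / (x t ^ 2 + y t ^ 2) with hk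
  have hkc : Continuous k := Continuous.div (by fun_prop) (by fun_prop) fun t => (h0 t).ne'
  set z : ℂ := ⟨x 0, y 0⟩ with hz
  have hz0 : ‖z‖ = √(x 0 ^ 2 + y 0 ^ 2) := by
    rw [Complex.norm_def, Complex.normSq_apply]; congr 1; simp only [hz]; ring
  set φ : ℝ → ℝ := fun t => (∫ s in (0 : ℝ)..t, k s) - Complex.arg z with hφ
  have hd : ∀ t, HasDerivAt φ (k t) t := fun t =>
    (intervalIntegral.integral_hasDerivAt_right (hkc.intervalIntegrable _ _)
      (hkc.stronglyMeasurableAtFilter _ _) hkc.continuousAt).sub_const _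
  have hφ0 : -φ 0 = Complex.arg z := by simp [hφ]
  have hφc : Continuous φ := continuous_iff_continuousAt.mpr fun t => (hd t).continuousAt
  have hx0 : x 0 = √(x 0 ^ 2 + y 0 ^ 2) * Real.cos (-φ 0) := by
    rw [hφ0, ← hz0, Complex.norm_mul_cos_arg]
  have hy0 : y 0 = √(x 0 ^ 2 + y 0 ^ 2) * Real.sin (-φ 0) := by
    rw [hφ0, ← hz0, Complex.norm_mul_sin_arg]
  set u : ℝ → ℝ := fun t => x t * Real.cos (φ t) - y t * Real.sin (φ t) with hu
  set w : ℝ → ℝ := fun t => x t * Real.sin (φ t) + y t * Real.cos (φ t) with hw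
  have huw : ∀ t, u t ^ 2 + w t ^ 2 = x t ^ 2 + y t ^ 2 := fun t => by
    simp only [hu, hw]
    linear_combination (x t ^ 2 + y t ^ 2) * Real.sin_sq_add_cos_sq (φ t)
  have hwd : ∀ t, HasDerivAt (fun t => w t ^ 2 / (x t ^ 2 + y t ^ 2)) 0 t := by
    intro t
    have h1 := (hd t).sin
    have h2 := (hd t).cos
    have h3 := ((hx t).mul h1).add ((hy t).mul h2)
    have h4 := (h3.pow 2).div (((hx t).pow 2).add ((hy t).pow 2)) (h0 t).ne'
    refine h4.congr_deriv ?_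
    have hR := (h0 t).ne'
    simp only [hk, Pi.mul_apply, Pi.add_apply, Pi.pow_apply]
    push_cast
    field_simp
    ring_nf
  have hw0 : ∀ t, w t = 0 := by
    intro t
    have h1 := is_const_of_deriv_eq_zero (fun t => (hwd t).differentiableAt)
      (fun t => (hwd t).deriv) t 0
    have h2 : w 0 = 0 := by
      have e1 := hx0
      have e2 := hy0
      rw [Real.cos_neg] at e1
      rw [Real.sin_neg] at e2
      simp only [hw]
      generalize √(x 0 ^ 2 + y 0 ^ 2) = q at *
      rw [e1, e2]; ring
    rw [h2] at h1
    have h3 : w t ^ 2 / (x t ^ 2 + y t ^ 2) = 0 := by rw [h1]; simp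
    rcases div_eq_zero_iff.mp h3 with h | h
    · exact pow_eq_zero_iff two_ne_zero |>.mp h
    · exact absurd h (h0 t).ne'
  have hu2 : ∀ t, u t ^ 2 = x t ^ 2 + y t ^ 2 := fun t => by rw [← huw, hw0 t]; ring
  have hupos : ∀ t, 0 < u t := by
    have hu0 : 0 < u 0 := by
      have e1 := hx0
      have e2 := hy0
      rw [Real.cos_neg] at e1
      rw [Real.sin_neg] at e2
      have e3 : u 0 = √(x 0 ^ 2 + y 0 ^ 2) := by
        simp only [hu]
        linear_combination Real.cos (φ 0) * e1 - Real.sin (φ 0) * e2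
          + √(x 0 ^ 2 + y 0 ^ 2) * Real.sin_sq_add_cos_sq (φ 0)
      rw [e3]; exact Real.sqrt_pos.mpr (h0 0)
    intro t
    by_contra hc
    have hcu : Continuous u := by simp only [hu]; fun_prop
    obtain ⟨s, hs⟩ := mem_range_of_exists_le_of_exists_ge hcu ⟨t, not_lt.mp hc⟩ ⟨0, hu0.le⟩
    have := hu2 s
    rw [hs] at this
    linarith [h0 s]
  refine ⟨φ, hd, fun t => ?_⟩
  have e : √(x t ^ 2 + y t ^ 2) = u t := by rw [← hu2, Real.sqrt_sq (hupos t).le]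
  rw [e, Real.cos_neg, Real.sin_neg]
  have e1 := hw0 t
  have e2 := Real.sin_sq_add_cos_sq (φ t)
  simp only [hu, hw] at e1 ⊢
  constructor
  · linear_combination Real.sin (φ t) * e1 - x t * e2
  · linear_combination Real.cos (φ t) * e1 - y t * e2

section PeriodicSolutions

variable {α : ℝ} {x y : ℝ → ℝ}

theorem IsSolXY.continuous (h : IsSolXY α x y) : Continuous x ∧ Continuous y :=
  ⟨continuous_iff_continuousAt.mpr fun t => (h t).1.continuousAt,
    continuous_iff_continuousAt.mpr fun t => (h t).2.continuousAt⟩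

theorem bounded_of_periodic {f : ℝ → ℝ} (hf : Continuous f) {T : ℝ} (hT : 0 < T)
    (hp : ∀ t, f (t + T) = f t) : ∃ M, ∀ t, |f t| ≤ M := by
  obtain ⟨M, hM⟩ := isCompact_Icc.exists_bound_of_continuousOn (s := Icc 0 T) hf.continuousOn
  refine ⟨M, fun t => ?_⟩
  obtain ⟨s, hs, hst⟩ := (Function.Periodic.exists_mem_Ico₀ (f := f) hp hT t)
  rw [hst]
  exact hM s ⟨hs.1, hs.2.le⟩

theorem IsSolXY.radius_pos (h : IsSolXY α x y) (hp : IsPeriodicSol x y) (hn : NonconstSol x y)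
    (t : ℝ) : 0 < x t ^ 2 + y t ^ 2 := by
  obtain ⟨hxc, hyc⟩ := h.continuous
  obtain ⟨T, hT, hper⟩ := hp
  by_contra hc
  have h0 : x t ^ 2 + y t ^ 2 = 0 := le_antisymm (not_lt.mp hc) (by positivity)
  set R : ℝ → ℝ := fun t => x t ^ 2 + y t ^ 2 with hR
  set D : ℝ → ℝ := fun t => 2 * x t * y t
    + 2 * y t * (-(x t) ^ 3 + α * (x t) ^ 2 * y t + (y t) ^ 3) with hD
  have hd : ∀ t, HasDerivAt R (D t) t := fun t => by
    refine (((h t).1.pow 2).add ((h t).2.pow 2)).congr_deriv ?_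
    simp only [hD]; push_cast; ring
  obtain ⟨M, hM⟩ := bounded_of_periodic (f := R) (by fun_prop) hT fun t => by
    simp only [hR, (hper t).1, (hper t).2]
  have hM0 : 0 ≤ M := (abs_nonneg _).trans (hM 0)
  set K := 1 + (4 + 2 * |α|) * M with hK
  have hb : ∀ t, |D t| ≤ K * R t := by
    intro t
    have h1 : R t ≤ M := (le_abs_self _).trans (hM t)
    have hR0 : 0 ≤ R t := by positivity
    have hx2 : x t ^ 2 ≤ R t := by simp only [hR]; nlinarith [sq_nonneg (y t)]
    have hy2 : y t ^ 2 ≤ R t := by simp only [hR]; nlinarith [sq_nonneg (x t)]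
    have hxy : |2 * (x t * y t)| ≤ R t := by
      rw [abs_le]; simp only [hR]
      constructor <;> nlinarith [sq_nonneg (x t + y t), sq_nonneg (x t - y t)]
    have e : D t = 2 * (x t * y t) * (1 - x t ^ 2) + 2 * α * x t ^ 2 * y t ^ 2
        + 2 * y t ^ 2 * y t ^ 2 := by simp only [hD]; ring
    have b1 : |2 * (x t * y t) * (1 - x t ^ 2)| ≤ R t * (1 + M) := by
      rw [abs_mul]
      refine mul_le_mul hxy ?_ (abs_nonneg _) hR0
      rw [abs_le]; constructor <;> nlinarith [sq_nonneg (x t)]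
    have b2 : |2 * α * x t ^ 2 * y t ^ 2| ≤ 2 * |α| * M * R t := by
      rw [abs_mul, abs_mul, abs_mul, abs_of_nonneg (sq_nonneg (x t)),
        abs_of_nonneg (sq_nonneg (y t)), abs_two]
      have : x t ^ 2 * y t ^ 2 ≤ M * R t := mul_le_mul (hx2.trans h1) hy2 (sq_nonneg _) hM0
      nlinarith [abs_nonneg α]
    have b3 : |2 * y t ^ 2 * y t ^ 2| ≤ 2 * M * R t := by
      rw [abs_of_nonneg (by positivity)]
      have : y t ^ 2 * y t ^ 2 ≤ M * R t := mul_le_mul (hy2.trans h1) hy2 (sq_nonneg _) hM0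
      nlinarith
    rw [e]
    refine (abs_add_three _ _ _).trans ?_
    simp only [hK]
    nlinarith
  have hzero : ∀ s, R s = 0 := by
    intro s
    refine le_antisymm ?_ (by positivity)
    have hE : ∀ L s, HasDerivAt (fun s => R s * Real.exp (L * s))
        ((D s + L * R s) * Real.exp (L * s)) s := fun L s => by
      refine ((hd s).mul (((hasDerivAt_id' s).const_mul L).exp)).congr_deriv ?_
      ring
    have hm1 : Antitone fun s => R s * Real.exp (-K * s) :=
      antitone_of_hasDerivAt_nonpos (hE (-K)) fun s =>
        mul_nonpos_of_nonpos_of_nonneg (by linarith [(abs_le.mp (hb s)).2]) (Real.exp_pos _).le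
    have hm2 : Monotone fun s => R s * Real.exp (K * s) :=
      monotone_of_hasDerivAt_nonneg (hE K) fun s =>
        mul_nonneg (by linarith [(abs_le.mp (hb s)).1]) (Real.exp_pos _).le
    have hRt : R t = 0 := h0
    rcases le_total t s with h1 | h1
    · have := hm1 h1
      simp only [hRt, zero_mul] at this
      exact (nonpos_of_mul_nonpos_left this (Real.exp_pos _))
    · have := hm2 h1
      simp only [hRt, zero_mul] at this
      exact (nonpos_of_mul_nonpos_left this (Real.exp_pos _))
  obtain ⟨a, b, hab⟩ := hn
  have hz : ∀ s, x s = 0 ∧ y s = 0 := fun s => by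
    have := hzero s
    simp only [hR] at this
    constructor <;> nlinarith [sq_nonneg (x s), sq_nonneg (y s)]
  exact hab (by rw [(hz a).1, (hz a).2, (hz b).1, (hz b).2])

theorem le_add_nat_mul {T : ℝ} (hT : 0 < T) (a b : ℝ) : ∃ n : ℕ, a ≤ b + n * T := by
  obtain ⟨n, hn⟩ := exists_nat_ge ((a - b) / T)
  rw [div_le_iff₀ hT] at hn
  exact ⟨n, by linarith⟩

theorem eq_of_antitone_of_periodic {v : ℝ → ℝ} (hv : Antitone v) {T : ℝ} (hT : 0 < T)
    (hp : Function.Periodic v T) (t s : ℝ) : v t = v s := by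
  wlog h : t ≤ s generalizing t s
  · exact (this s t (le_of_not_ge h)).symm
  obtain ⟨n, hn⟩ := le_add_nat_mul hT s t
  have h1 := hv hn
  rw [hp.nat_mul n t] at h1
  exact le_antisymm h1 (hv h)

theorem IsSolXY.angular_pos (h : IsSolXY α x y) (hp : IsPeriodicSol x y) (hn : NonconstSol x y)
    (t : ℝ) : 0 < y t * y t - x t * (-(x t) ^ 3 + α * (x t) ^ 2 * y t + (y t) ^ 3) := by
  have hR := h.radius_pos hp hn
  obtain ⟨hxc, hyc⟩ := h.continuous
  obtain ⟨T, hT, hper⟩ := hp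
  set Y : ℝ → ℝ := fun t => -(x t) ^ 3 + α * (x t) ^ 2 * y t + (y t) ^ 3 with hY
  set N : ℝ → ℝ := fun t => y t * y t - x t * Y t with hN
  set N' : ℝ → ℝ := fun t => y t * Y t
    - x t * ((-3 * x t ^ 2 + 2 * α * x t * y t) * y t + (α * x t ^ 2 + 3 * y t ^ 2) * Y t) with hN'
  have hNd : ∀ t, HasDerivAt N (N' t) t := fun t => by
    have hx := (h t).1
    have hy := (h t).2
    have hYd := ((hx.pow 3).neg.add (((hx.pow 2).const_mul α).mul hy)).add (hy.pow 3)
    refine ((hy.mul hy).sub (hx.mul hYd)).congr_deriv ?_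
    simp only [hN', hY, Pi.add_apply, Pi.neg_apply, Pi.mul_apply, Pi.pow_apply]
    push_cast
    ring
  have hNT : Function.Periodic N T := fun t => by
    simp only [hN, hY, (hper t).1, (hper t).2]
  have h0 : ∀ t, N t ≤ 0 → x t * y t ≠ 0 := by
    intro t ht h1
    have h2 := hR t
    simp only [hN, hY] at ht
    rcases mul_eq_zero.mp h1 with h1 | h1
    · rw [h1] at ht h2; nlinarith
    · rw [h1] at ht h2
      have : 0 < x t ^ 2 := by linarith
      have : 0 < (x t ^ 2) ^ 2 := by positivity
      nlinarith
  have hid : ∀ t, N t = 0 → x t ^ 2 * N' t = -2 * (x t * y t) * y t ^ 2 := by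
    intro t ht
    have e : x t ^ 2 * N' t = -2 * (x t * y t) * y t ^ 2
        + x t * (2 * y t + α * x t ^ 3 + 3 * x t * y t ^ 2) * N t := by
      simp only [hN', hN, hY]; ring
    rw [e, ht]; ring
  by_contra hc
  have hc' : N t ≤ 0 := not_lt.mp hc
  have hle : ∀ s, N s ≤ 0 := by
    intro s
    rcases (h0 t hc').lt_or_gt with h1 | h1
    · obtain ⟨n, hn⟩ := le_add_nat_mul hT (-t) (-s)
      have := nonpos_of_deriv_neg_at_zero (N := fun r => N (-r)) (N' := fun r => -N' (-r))
        (p := fun r => -(x (-r) * y (-r))) (fun r => ?_) (by fun_prop)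
        (fun r hr => neg_ne_zero.mpr (h0 _ hr)) (fun r hr hpr => ?_) (a := -t) (t := -s + n * T)
        (by simpa using hc') (by simpa using h1) hn
      · have e := hNT.nat_mul n (-(-s + n * T))
        rw [show -(-s + n * T) + n * T = s by ring] at e
        rwa [e]
      · exact ((hNd (-r)).scomp r (hasDerivAt_neg r)).congr_deriv (by simp)
      · have e := hid (-r) hr
        have hy : 0 < y (-r) ^ 2 := by
          have := (mul_ne_zero_iff.mp (h0 _ hr.le)).2; positivity
        by_contra hneg
        have := mul_nonneg (sq_nonneg (x (-r))) (sub_nonneg.mpr (not_lt.mp hneg))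
        nlinarith
    · obtain ⟨n, hn⟩ := le_add_nat_mul hT t s
      rw [← hNT.nat_mul n s]
      refine nonpos_of_deriv_neg_at_zero hNd (p := fun r => x r * y r) (by fun_prop) h0
        (fun r hr hpr => ?_) hc' h1 hn
      have e := hid r hr
      have hy : 0 < y r ^ 2 := by
        have := (mul_ne_zero_iff.mp (h0 _ hr.le)).2; positivity
      by_contra hneg
      have := mul_nonneg (sq_nonneg (x r)) (not_lt.mp hneg)
      nlinarith
  have hy0 : ∀ s, y s ≠ 0 := fun s => (mul_ne_zero_iff.mp (h0 s (hle s))).2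
  have hvd : ∀ s, HasDerivAt (fun s => x s / y s) (N s / y s ^ 2) s := fun s =>
    (h s).1.div (h s).2 (hy0 s)
  have hva : Antitone fun s => x s / y s := antitone_of_hasDerivAt_nonpos hvd fun s =>
    div_nonpos_of_nonpos_of_nonneg (hle s) (sq_nonneg _)
  have hvc := eq_of_antitone_of_periodic hva hT fun s => by
    simp only [(hper s).1, (hper s).2]
  have hN0 : ∀ s, N s = 0 := by
    intro s
    have h1 : HasDerivAt (fun s => x s / y s) 0 s := by
      rw [show (fun s => x s / y s) = fun _ => x 0 / y 0 from funext fun s => hvc s 0]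
      exact hasDerivAt_const _ _
    have h2 := (hvd s).unique h1
    rcases div_eq_zero_iff.mp h2 with h | h
    · exact h
    · exact absurd h (pow_ne_zero 2 (hy0 s))
  have h1 : N' t = 0 := by
    have := hNd t
    rw [show N = fun _ => 0 from funext hN0] at this
    exact this.unique (hasDerivAt_const _ _)
  have h2 := hid t (hN0 t)
  rw [h1, mul_zero] at h2
  have h3 := h0 t hc'
  have : -2 * (x t * y t) * y t ^ 2 ≠ 0 :=
    mul_ne_zero (mul_ne_zero (by norm_num) h3) (pow_ne_zero 2 (hy0 t))
  exact this h2.symm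

/-- A nonconstant periodic solution is a `π`-periodic orbit in polar coordinates. -/
theorem IsSolXY.exists_isPol (h : IsSolXY α x y) (hp : IsPeriodicSol x y) (hn : NonconstSol x y) :
    ∃ R, IsPol (-α) R ∧ (∀ θ, R (θ + Real.pi) = R θ) ∧
      Set.range (fun t => (x t, y t))
        = Set.range (fun θ => (√(R θ) * Real.cos θ, √(R θ) * Real.sin θ)) := by
  have hR := h.radius_pos hp hn
  have hN := h.angular_pos hp hn
  obtain ⟨hxc, hyc⟩ := h.continuous
  obtain ⟨T, hT, hper⟩ := hp
  obtain ⟨φ, hφ, hpol⟩ := exists_polar_lift (fun t => (h t).1) (fun t => (h t).2) hyc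
    (by fun_prop) hR
  have hφpos : ∀ t, 0 < (y t * y t - x t * (-(x t) ^ 3 + α * (x t) ^ 2 * y t + (y t) ^ 3))
    / (x t ^ 2 + y t ^ 2) := fun t => div_pos (hN t) (hR t)
  have hmono : StrictMono φ := strictMono_of_hasDerivAt_pos hφ hφpos
  have hφc : Continuous φ := continuous_iff_continuousAt.mpr fun t => (hφ t).continuousAt
  obtain ⟨k, hk⟩ : ∃ k : ℤ, φ T = φ 0 + k * (2 * Real.pi) := by
    have h0 := hpol 0
    have h1 := hpol T
    have hx := (hper 0).1
    have hy := (hper 0).2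
    rw [zero_add] at hx hy
    rw [hx, hy] at h1
    have hs : √(x 0 ^ 2 + y 0 ^ 2) ≠ 0 := (Real.sqrt_pos.mpr (hR 0)).ne'
    have hc : Real.cos (φ T) = Real.cos (φ 0) := by
      have := mul_left_cancel₀ hs (h1.1.symm.trans h0.1)
      rwa [Real.cos_neg, Real.cos_neg] at this
    have hs : Real.sin (φ T) = Real.sin (φ 0) := by
      have := mul_left_cancel₀ hs (h1.2.symm.trans h0.2)
      rwa [Real.sin_neg, Real.sin_neg, neg_inj] at this
    have := Real.Angle.cos_sin_inj hc hs
    obtain ⟨k, hk⟩ := Real.Angle.angle_eq_iff_two_pi_dvd_sub.mp this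
    exact ⟨k, by linarith⟩
  have hkpos : 0 < k := by
    have := hmono hT
    have h2 : (0 : ℝ) < k * (2 * Real.pi) := by linarith
    exact_mod_cast pos_of_mul_pos_left h2 (by positivity)
  have hshift : ∀ t, φ (t + T) = φ t + k * (2 * Real.pi) := by
    intro t
    have hd : ∀ t, HasDerivAt (fun t => φ (t + T) - φ t) 0 t := fun t => by
      refine (((hφ (t + T)).comp_add_const t T).sub (hφ t)).congr_deriv ?_
      rw [(hper t).1, (hper t).2, sub_self]
    have := is_const_of_deriv_eq_zero (fun t => (hd t).differentiableAt) (fun t => (hd t).deriv) t 0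
    rw [zero_add] at this
    linarith
  have hL : 0 < (k : ℝ) * (2 * Real.pi) := mul_pos (by exact_mod_cast hkpos) (by positivity)
  have hnat : ∀ n : ℕ, ∀ t, φ (t + n * T) = φ t + n * (k * (2 * Real.pi)) := by
    intro n
    induction n with
    | zero => intro t; simp
    | succ n ih =>
      intro t
      rw [show t + (n + 1 : ℕ) * T = t + n * T + T by push_cast; ring, hshift, ih]
      push_cast; ring
  have hsurj : Function.Surjective φ := by
    intro a
    obtain ⟨n, hn⟩ := le_add_nat_mul hL a (φ 0)
    obtain ⟨m, hm⟩ := le_add_nat_mul hL (φ 0) a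
    refine mem_range_of_exists_le_of_exists_ge hφc ⟨-(m * T), ?_⟩ ⟨0 + n * T, ?_⟩
    · have := hnat m (-(m * T))
      rw [neg_add_cancel] at this
      linarith
    · rw [hnat]; exact hn
  set g := hmono.orderIsoOfSurjective φ hsurj with hg
  have hgφ : ∀ t, g.symm (φ t) = t := fun t => g.symm_apply_apply t
  have hφg : ∀ a, φ (g.symm a) = a := fun a => g.apply_symm_apply a
  have hgd : ∀ a, HasDerivAt (fun a => g.symm a) (((y (g.symm a) * y (g.symm a)
      - x (g.symm a) * (-(x (g.symm a)) ^ 3 + α * (x (g.symm a)) ^ 2 * y (g.symm a)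
      + (y (g.symm a)) ^ 3)) / (x (g.symm a) ^ 2 + y (g.symm a) ^ 2))⁻¹) a := fun a =>
    (hφ _).of_local_left_inverse g.symm.continuous.continuousAt (hφpos _).ne'
      (Eventually.of_forall hφg)
  set R : ℝ → ℝ := fun θ => x (g.symm (-θ)) ^ 2 + y (g.symm (-θ)) ^ 2 with hRdef
  have hxy : ∀ θ, x (g.symm (-θ)) = √(R θ) * Real.cos θ ∧
      y (g.symm (-θ)) = √(R θ) * Real.sin θ := fun θ => by
    have := hpol (g.symm (-θ))
    rwa [hφg, neg_neg] at this
  have hRpos : ∀ θ, 0 < R θ := fun θ => hR _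
  have hnF : ∀ θ, y (g.symm (-θ)) * y (g.symm (-θ)) - x (g.symm (-θ)) * (-(x (g.symm (-θ))) ^ 3
      + α * (x (g.symm (-θ))) ^ 2 * y (g.symm (-θ)) + (y (g.symm (-θ))) ^ 3)
      = R θ * nF (-α) θ (R θ) := fun θ => by
    rw [(hxy θ).1, (hxy θ).2]
    have hq := Real.sq_sqrt (hRpos θ).le
    generalize √(R θ) = q at *
    rw [← hq, nF]
    ring
  have hIs : IsPol (-α) R := by
    intro θ
    have hn := hN (g.symm (-θ))
    rw [hnF] at hn
    have hn' : 0 < nF (-α) θ (R θ) := pos_of_mul_pos_right hn (hRpos θ).le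
    refine ⟨hRpos θ, hn', ?_⟩
    have h1 := (hgd (-θ)).scomp θ (hasDerivAt_neg θ)
    have hx := (h (g.symm (-θ))).1.comp θ h1
    have hy := (h (g.symm (-θ))).2.comp θ h1
    refine ((hx.pow 2).add (hy.pow 2)).congr_deriv ?_
    rw [hnF]
    simp only [Function.comp_apply, smul_eq_mul]
    rw [show x (g.symm (-θ)) ^ 2 + y (g.symm (-θ)) ^ 2 = R θ from rfl,
      mul_div_cancel_left₀ _ (hRpos θ).ne', (hxy θ).1, (hxy θ).2, eq_div_iff hn'.ne']
    have hq := Real.sq_sqrt (hRpos θ).le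
    generalize √(R θ) = q at *
    field_simp
    rw [← hq, eF]
    push_cast
    ring
  obtain ⟨m, rfl⟩ := Int.eq_ofNat_of_zero_le hkpos.le
  have hm : 0 < 2 * m := by omega
  refine ⟨R, hIs, hIs.periodic_pi hm fun θ => ?_, ?_⟩
  · have e : g.symm (-θ) = g.symm (-(θ + (2 * m : ℕ) * Real.pi)) + T := by
      apply hmono.injective
      rw [hshift, hφg, hφg]
      push_cast
      ring
    simp only [hRdef]
    rw [e, (hper _).1, (hper _).2]
  · ext p
    constructor
    · rintro ⟨t, rfl⟩
      refine ⟨-φ t, ?_⟩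
      have := hxy (-φ t)
      rw [neg_neg, hgφ] at this
      exact Prod.ext this.1.symm this.2.symm
    · rintro ⟨θ, rfl⟩
      exact ⟨g.symm (-θ), Prod.ext (hxy θ).1 (hxy θ).2⟩

end PeriodicSolutions

/-- Two limit cycles coincide. -/
theorem range_eq_of_isPeriodicSol {α : ℝ} (h0 : α < 0) (hα : -(225 / 100) ≤ α)
    {x₁ y₁ x₂ y₂ : ℝ → ℝ} (h₁ : IsSolXY α x₁ y₁) (p₁ : IsPeriodicSol x₁ y₁)
    (n₁ : NonconstSol x₁ y₁) (h₂ : IsSolXY α x₂ y₂) (p₂ : IsPeriodicSol x₂ y₂)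
    (n₂ : NonconstSol x₂ y₂) :
    Set.range (fun t => (x₁ t, y₁ t)) = Set.range (fun t => (x₂ t, y₂ t)) := by
  obtain ⟨R₁, a₁, b₁, c₁⟩ := h₁.exists_isPol p₁ n₁
  obtain ⟨R₂, a₂, b₂, c₂⟩ := h₂.exists_isPol p₂ n₂
  rw [c₁, c₂, a₁.unique (by linarith) (by linarith) a₂ b₁ b₂]

/-- A heteroclinic orbit of the transformed system, with its monotonicity made explicit. -/
structure IsHet (A : ℝ) (v z : ℝ → ℝ) (a b : ℝ) : Prop where
  neg : a < 0
  pos : 0 < b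
  root_left : a ^ 3 + A * a ^ 2 - 1 = 0
  root_right : b ^ 3 + A * b ^ 2 - 1 = 0
  left_le : ∀ w, w ^ 3 + A * w ^ 2 - 1 = 0 → a ≤ w
  le_right : ∀ w, w ^ 3 + A * w ^ 2 - 1 = 0 → w ≤ b
  deriv_v : ∀ τ, HasDerivAt v (v τ * (v τ ^ 3 + A * v τ ^ 2 - 1) + z τ ^ 2) τ
  deriv_z : ∀ τ, HasDerivAt z (z τ * (v τ ^ 3 + A * v τ ^ 2 - 1)) τ
  z_pos : ∀ τ, 0 < z τ
  v_bot : Tendsto v atBot (𝓝 a)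
  v_top : Tendsto v atTop (𝓝 b)
  z_bot : Tendsto z atBot (𝓝 0)
  z_top : Tendsto z atTop (𝓝 0)

namespace IsHet

variable {A a b : ℝ} {v z : ℝ → ℝ}

theorem continuous_v (h : IsHet A v z a b) : Continuous v :=
  continuous_iff_continuousAt.mpr fun t => (h.deriv_v t).continuousAt

theorem continuous_z (h : IsHet A v z a b) : Continuous z :=
  continuous_iff_continuousAt.mpr fun t => (h.deriv_z t).continuousAt

theorem cubic_nonneg (h : IsHet A v z a b) (hA : 0 < A) {w : ℝ} (hw : b ≤ w) :
    0 ≤ w ^ 3 + A * w ^ 2 - 1 := by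
  by_contra hc
  rw [not_le] at hc
  have hw0 : 0 < w := h.pos.trans_le hw
  have hw1 : w ≤ 1 := by
    by_contra h1
    rw [not_le] at h1
    nlinarith [mul_pos hw0 hw0, mul_pos (mul_pos hw0 hw0) (sub_pos.mpr h1),
      mul_pos hA (mul_pos hw0 hw0), mul_pos hw0 (sub_pos.mpr h1)]
  obtain ⟨u, hu, hu0⟩ := intermediate_value_Icc hw1
    (f := fun x : ℝ => x ^ 3 + A * x ^ 2 - 1) (by fun_prop)
    (show (0 : ℝ) ∈ _ from ⟨hc.le, by norm_num; exact hA.le⟩)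
  have h1 := h.le_right u hu0
  have h2 : u = w := le_antisymm (h1.trans hw) hu.1
  simp only [h2] at hu0
  linarith

theorem cubic_nonpos (h : IsHet A v z a b) {w : ℝ} (hw : w ≤ a) :
    w ^ 3 + A * w ^ 2 - 1 ≤ 0 := by
  by_contra hc
  rw [not_le] at hc
  have hw1 : -A ≤ w := by
    by_contra h1
    rw [not_le] at h1
    nlinarith [mul_nonneg (sq_nonneg w) (by linarith : 0 ≤ -A - w)]
  obtain ⟨u, hu, hu0⟩ := intermediate_value_Icc hw1
    (f := fun x : ℝ => x ^ 3 + A * x ^ 2 - 1) (by fun_prop)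
    (show (0 : ℝ) ∈ _ from ⟨by ring_nf; norm_num, hc.le⟩)
  have h1 := h.left_le u hu0
  have h2 : u = w := le_antisymm hu.2 (hw.trans h1)
  simp only [h2] at hu0
  linarith

theorem speed_hasDerivAt (h : IsHet A v z a b) (τ : ℝ) :
    HasDerivAt (fun τ => v τ * (v τ ^ 3 + A * v τ ^ 2 - 1) + z τ ^ 2)
      ((v τ * (v τ ^ 3 + A * v τ ^ 2 - 1) + z τ ^ 2)
        * (3 * (v τ ^ 3 + A * v τ ^ 2 - 1) + v τ * (3 * v τ ^ 2 + 2 * A * v τ))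
        - 2 * v τ * (v τ ^ 3 + A * v τ ^ 2 - 1) ^ 2) τ := by
  have hv := h.deriv_v τ
  have hz := h.deriv_z τ
  refine ((hv.mul (((hv.pow 3).add ((hv.pow 2).const_mul A)).sub_const 1)).add
    (hz.pow 2)).congr_deriv ?_
  simp only [Pi.add_apply, Pi.pow_apply]
  push_cast
  ring

theorem speed_pos (h : IsHet A v z a b) (hA : 0 < A) (τ : ℝ) :
    0 < v τ * (v τ ^ 3 + A * v τ ^ 2 - 1) + z τ ^ 2 := by
  by_contra hc
  rw [not_lt] at hc
  have hne : ∀ t, v t * (v t ^ 3 + A * v t ^ 2 - 1) + z t ^ 2 ≤ 0 → v t ≠ 0 := by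
    intro t ht h0
    rw [h0] at ht
    nlinarith [h.z_pos t]
  have hsq : ∀ t, v t * (v t ^ 3 + A * v t ^ 2 - 1) + z t ^ 2 = 0 →
      0 < (v t ^ 3 + A * v t ^ 2 - 1) ^ 2 := by
    intro t ht
    have := h.z_pos t
    refine sq_pos_iff.mpr ?_
    intro h0
    rw [h0] at ht
    nlinarith
  rcases lt_or_gt_of_ne (hne τ hc) with hv | hv
  · have key : ∀ s, -τ ≤ s →
        v (-s) * (v (-s) ^ 3 + A * v (-s) ^ 2 - 1) + z (-s) ^ 2 ≤ 0 := by
      intro s hs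
      refine nonpos_of_deriv_neg_at_zero (a := -τ)
        (N := fun s => v (-s) * (v (-s) ^ 3 + A * v (-s) ^ 2 - 1) + z (-s) ^ 2)
        (p := fun s => -v (-s))
        (fun t => (h.speed_hasDerivAt (-t)).scomp t (hasDerivAt_neg t))
        (h.continuous_v.comp continuous_neg).neg
        (fun t ht => neg_ne_zero.mpr (hne _ ht)) ?_ (by simpa using hc) (by simpa using hv) hs
      intro t ht hp
      have := hsq _ ht
      rw [ht]
      simp only [smul_eq_mul]
      nlinarith [mul_pos hp this]
    have hanti : AntitoneOn v (Iic τ) := by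
      refine antitoneOn_of_deriv_nonpos (convex_Iic τ) h.continuous_v.continuousOn
        (fun t _ => (h.deriv_v t).differentiableAt.differentiableWithinAt) ?_
      intro t ht
      rw [interior_Iic] at ht
      rw [(h.deriv_v t).deriv]
      simpa using key (-t) (neg_le_neg (le_of_lt ht))
    have hle : v τ ≤ a := by
      refine ge_of_tendsto h.v_bot ?_
      filter_upwards [eventually_le_atBot τ] with t ht
      exact hanti ht (mem_Iic.mpr le_rfl) ht
    have := h.cubic_nonpos hle
    nlinarith [h.z_pos τ, mul_nonneg_of_nonpos_of_nonpos hv.le this]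
  · have key : ∀ s, τ ≤ s → v s * (v s ^ 3 + A * v s ^ 2 - 1) + z s ^ 2 ≤ 0 := by
      intro s hs
      refine nonpos_of_deriv_neg_at_zero (a := τ)
        (N := fun s => v s * (v s ^ 3 + A * v s ^ 2 - 1) + z s ^ 2) (p := v)
        h.speed_hasDerivAt h.continuous_v hne ?_ hc hv hs
      intro t ht hp
      have := hsq _ ht
      rw [ht]
      nlinarith [mul_pos hp this]
    have hanti : AntitoneOn v (Ici τ) := by
      refine antitoneOn_of_deriv_nonpos (convex_Ici τ) h.continuous_v.continuousOn
        (fun t _ => (h.deriv_v t).differentiableAt.differentiableWithinAt) ?_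
      intro t ht
      rw [interior_Ici] at ht
      rw [(h.deriv_v t).deriv]
      exact key t (le_of_lt ht)
    have hle : b ≤ v τ := by
      refine le_of_tendsto h.v_top ?_
      filter_upwards [eventually_ge_atTop τ] with t ht
      exact hanti (mem_Ici.mpr le_rfl) ht ht
    have := h.cubic_nonneg hA hle
    nlinarith [h.z_pos τ, mul_nonneg hv.le this]

theorem strictMono (h : IsHet A v z a b) (hA : 0 < A) : StrictMono v :=
  strictMono_of_deriv_pos fun t => by rw [(h.deriv_v t).deriv]; exact h.speed_pos hA t

theorem v_lt (h : IsHet A v z a b) (hA : 0 < A) (τ : ℝ) : v τ < b := by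
  refine lt_of_lt_of_le (h.strictMono hA (lt_add_one τ)) (ge_of_tendsto h.v_top ?_)
  filter_upwards [eventually_ge_atTop (τ + 1)] with t ht using (h.strictMono hA).monotone ht

theorem exists_eq (h : IsHet A v z a b) {u : ℝ} (h1 : a < u) (h2 : u < b) : ∃ τ, v τ = u := by
  obtain ⟨s, hs⟩ := (h.v_bot.eventually (gt_mem_nhds h1)).exists
  obtain ⟨t, ht⟩ := (h.v_top.eventually (lt_mem_nhds h2)).exists
  exact mem_range_of_exists_le_of_exists_ge h.continuous_v ⟨s, hs.le⟩ ⟨t, ht.le⟩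

end IsHet

theorem cubic_of_lt {α : ℝ} (h : α < -3 * (4 : ℝ) ^ (-(1 : ℝ) / 3)) : 27 < 4 * (-α) ^ 3 := by
  have h1 : 0 < (4 : ℝ) ^ (-(1 : ℝ) / 3) := by positivity
  have h2 : ((4 : ℝ) ^ (-(1 : ℝ) / 3)) ^ 3 = 1 / 4 := by
    rw [← Real.rpow_natCast, ← Real.rpow_mul (by norm_num)]
    norm_num [Real.rpow_neg_one]
  have h3 : (3 * (4 : ℝ) ^ (-(1 : ℝ) / 3)) ^ 3 < (-α) ^ 3 :=
    pow_lt_pow_left₀ (by linarith) (by positivity) (by norm_num)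
  rw [mul_pow, h2] at h3
  linarith

theorem HasHeteroclinic.exists_isHet {α : ℝ} (h : α < -3 * (4 : ℝ) ^ (-(1 : ℝ) / 3))
    (hh : HasHeteroclinic α) : ∃ v z a b, IsHet (-α) v z a b := by
  have hc := cubic_of_lt h
  obtain ⟨v, z, a, b, ⟨ha, ha'⟩, ⟨hb, hb'⟩, hd, h1, h2⟩ := hh
  have hA : 0 < -α := by
    have : 0 < (4 : ℝ) ^ (-(1 : ℝ) / 3) := by positivity
    linarith
  have e : ∀ w, fcubic w α = w ^ 3 + -α * w ^ 2 - 1 := fun w => by unfold fcubic; ring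
  simp only [e] at *
  generalize hAe : -α = A at *
  refine ⟨v, z, a, b, ?_, ?_, ha, hb, ha', hb', fun τ => (hd τ).1, fun τ => (hd τ).2.1,
    fun τ => (hd τ).2.2, (continuous_fst.tendsto _).comp h1, (continuous_fst.tendsto _).comp h2,
    (continuous_snd.tendsto _).comp h1, (continuous_snd.tendsto _).comp h2⟩
  · obtain ⟨u, hu, hu0⟩ := intermediate_value_Icc (by linarith : -A ≤ -(2 * A / 3))
      (f := fun x : ℝ => x ^ 3 + A * x ^ 2 - 1) (by fun_prop)
      (show (0 : ℝ) ∈ _ from ⟨by ring_nf; norm_num, by ring_nf; linarith⟩)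
    linarith [ha' u hu0, hu.2]
  · obtain ⟨u, hu, hu0⟩ := intermediate_value_Icc (zero_le_one : (0 : ℝ) ≤ 1)
      (f := fun x : ℝ => x ^ 3 + A * x ^ 2 - 1) (by fun_prop)
      (show (0 : ℝ) ∈ _ from ⟨by norm_num, by norm_num; exact hA.le⟩)
    have : u ≠ 0 := by rintro rfl; norm_num at hu0
    exact (lt_of_le_of_ne hu.1 this.symm).trans_le (hb' u hu0)

/-- A barrier for heteroclinic orbits with large parameter. -/
noncomputable def omF (v : ℝ) : ℝ :=
  167 / 100 - 214 / 100 * v - 73 / 100 * v ^ 2 + 38 / 100 * v ^ 3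

theorem omF_hasDerivAt (v : ℝ) :
    HasDerivAt omF (-(214 / 100) - 146 / 100 * v + 114 / 100 * v ^ 2) v := by
  refine (((((hasDerivAt_id v).const_mul (214 / 100 : ℝ)).const_sub (167 / 100 : ℝ)).sub
    (((hasDerivAt_id v).pow 2).const_mul (73 / 100 : ℝ))).add
    (((hasDerivAt_id v).pow 3).const_mul (38 / 100 : ℝ))).congr_deriv ?_
  simp only [id_eq]
  push_cast
  ring

theorem omF_pos {v : ℝ} (h1 : -(19 / 10) ≤ v) (h2 : v ≤ 6 / 10) : 0 < omF v :=
  pos_of_bern (l := [12357 / 25000, 667817 / 50000, 89123 / 12500, 1283 / 6250])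
    (p := (6 / 10 - v) / (5 / 2)) (q := (v + 19 / 10) / (5 / 2))
    (by simp) (by linarith) (by linarith) (by ring) (by simp [bern, omF]; ring)

theorem omF_transversal {v A : ℝ} (hA : 9 / 4 ≤ A) (h1 : -(19 / 10) ≤ v) (h2 : v ≤ 6 / 10) :
    0 < 2 * omF v * (v ^ 3 + A * v ^ 2 - 1)
      - (-(214 / 100) - 146 / 100 * v + 114 / 100 * v ^ 2)
        * (v * (v ^ 3 + A * v ^ 2 - 1) + omF v) := by
  have hq : 0 < 334 / 100 - 214 / 100 * v - 38 / 100 * v ^ 3 :=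
    pos_of_bern (l := [500621 / 50000, 359969 / 25000, 76861 / 6250, 12337 / 6250])
      (p := (6 / 10 - v) / (5 / 2)) (q := (v + 19 / 10) / (5 / 2))
      (by simp) (by linarith) (by linarith) (by ring) (by simp [bern]; ring)
  have hG : 0 < 2 * omF v * (v ^ 3 + 9 / 4 * v ^ 2 - 1)
      - (-(214 / 100) - 146 / 100 * v + 114 / 100 * v ^ 2)
        * (v * (v ^ 3 + 9 / 4 * v ^ 2 - 1) + omF v) := by
    rcases le_total v (-(65 / 100)) with h | h
    · exact pos_of_bern (l := [145369619 / 500000000, 3602046803 / 1000000000,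
          375106589 / 200000000, 636688779 / 400000000, 4774140587 / 1600000000,
          27484536223 / 16000000000, 2494858029 / 8000000000])
        (p := (-(65 / 100) - v) / (5 / 4)) (q := (v + 19 / 10) / (5 / 4))
        (by simp) (by linarith) (by linarith) (by ring) (by simp [bern, omF]; ring)
    · exact pos_of_bern (l := [2494858029 / 8000000000, 32392056473 / 16000000000,
          903487589 / 200000000, 346480101 / 100000000, 68018491 / 50000000,
          85504529 / 31250000, 9159367 / 15625000])
        (p := (6 / 10 - v) / (5 / 4)) (q := (v + 65 / 100) / (5 / 4))
        (by simp) (by linarith) (by linarith) (by ring) (by simp [bern, omF]; ring)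
  have e : 2 * omF v * (v ^ 3 + A * v ^ 2 - 1)
      - (-(214 / 100) - 146 / 100 * v + 114 / 100 * v ^ 2)
        * (v * (v ^ 3 + A * v ^ 2 - 1) + omF v)
      = (2 * omF v * (v ^ 3 + 9 / 4 * v ^ 2 - 1)
      - (-(214 / 100) - 146 / 100 * v + 114 / 100 * v ^ 2)
        * (v * (v ^ 3 + 9 / 4 * v ^ 2 - 1) + omF v))
      + (A - 9 / 4) * v ^ 2 * (334 / 100 - 214 / 100 * v - 38 / 100 * v ^ 3) := by
    unfold omF; ring
  rw [e]
  have := mul_nonneg (mul_nonneg (sub_nonneg.mpr hA) (sq_nonneg v)) hq.le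
  linarith

theorem IsHet.param_lt {A a b : ℝ} {v z : ℝ → ℝ} (h : IsHet A v z a b) : A < 9 / 4 := by
  by_contra hA
  rw [not_lt] at hA
  have hA0 : 0 < A := by linarith
  have ha : a ≤ -2 := by
    by_contra hc
    rw [not_le] at hc
    obtain ⟨u, hu, hu0⟩ := intermediate_value_Icc (show -A - 1 ≤ -2 by linarith)
      (f := fun x : ℝ => x ^ 3 + A * x ^ 2 - 1) (by fun_prop)
      (show (0 : ℝ) ∈ _ from ⟨by nlinarith [sq_nonneg (A + 1)], by linarith⟩)
    linarith [h.left_le u hu0, hu.2]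
  have hb : b < 6 / 10 := by
    by_contra hc
    rw [not_lt] at hc
    have h1 : (6 / 10) ^ 2 ≤ b ^ 2 := pow_le_pow_left₀ (by norm_num) hc 2
    have h2 : (6 / 10) ^ 3 ≤ b ^ 3 := pow_le_pow_left₀ (by norm_num) hc 3
    have h3 : 9 / 4 * (6 / 10) ^ 2 ≤ A * b ^ 2 := mul_le_mul hA h1 (by norm_num) hA0.le
    have := h.root_right
    norm_num at h2 h3
    linarith
  obtain ⟨τ₀, hτ₀⟩ := h.exists_eq (show a < -(19 / 10) by linarith)
    (show -(19 / 10) < b by linarith [h.pos])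
  have hmem : ∀ τ, τ₀ ≤ τ → -(19 / 10) ≤ v τ ∧ v τ ≤ 6 / 10 := fun τ hτ =>
    ⟨hτ₀ ▸ (h.strictMono hA0).monotone hτ, ((h.v_lt hA0 τ).trans hb).le⟩
  have key : ∀ τ, τ₀ ≤ τ → 0 < z τ ^ 2 - omF (v τ) := by
    intro τ hτ
    refine pos_of_deriv_pos_at_zero (f := fun τ => z τ ^ 2 - omF (v τ)) hτ
      (fun t _ => ((h.deriv_z t).pow 2).sub ((omF_hasDerivAt (v t)).comp t (h.deriv_v t))) ?_ ?_
    · have h1 := h.speed_pos hA0 τ₀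
      simp only [hτ₀, omF] at h1 ⊢
      nlinarith
    · intro t ht _ h0
      obtain ⟨h1, h2⟩ := hmem t ht.1.le
      have := omF_transversal hA h1 h2
      have e : z t ^ 2 = omF (v t) := by linarith
      push_cast
      rw [← e] at this
      linarith
  have hlim : Tendsto (fun τ => z τ ^ 2 - omF (v τ)) atTop (𝓝 (0 ^ 2 - omF b)) :=
    (h.z_top.pow 2).sub ((omF_hasDerivAt b).continuousAt.tendsto.comp h.v_top)
  have h1 := ge_of_tendsto hlim
    ((eventually_ge_atTop τ₀).mono fun τ hτ => (key τ hτ).le)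
  have := omF_pos (show -(19 / 10) ≤ b by linarith [h.pos]) hb.le
  linarith

/-- `R` is an orbit in polar coordinates over the angles in `[0, T]`. -/
def IsArc (A T : ℝ) (R : ℝ → ℝ) : Prop :=
  ∀ θ ∈ Icc 0 T, 0 < R θ ∧ 0 < nF A θ (R θ) ∧ HasDerivAt R (eF A θ (R θ) / nF A θ (R θ)) θ

theorem IsArc.mono {A S T : ℝ} {R : ℝ → ℝ} (h : IsArc A T R) (hST : S ≤ T) : IsArc A S R :=
  fun θ hθ => h θ ⟨hθ.1, hθ.2.trans hST⟩

theorem IsArc.hasDerivAt_x_sq {A T : ℝ} {R : ℝ → ℝ} (h : IsArc A T R) {θ : ℝ} (hθ : θ ∈ Icc 0 T) :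
    HasDerivAt (fun θ => R θ * Real.cos θ ^ 2)
      (-2 * R θ * Real.cos θ * Real.sin θ / nF A θ (R θ)) θ := by
  obtain ⟨h1, h2, h3⟩ := h θ hθ
  refine (h3.mul ((Real.hasDerivAt_cos θ).pow 2)).congr_deriv ?_
  field_simp
  have := Real.sin_sq_add_cos_sq θ
  simp only [nF, eF, Pi.pow_apply] at h2 ⊢
  push_cast
  linear_combination (-2 * R θ * Real.cos θ * Real.sin θ) * this

theorem IsArc.hasDerivAt_y_sq {A T : ℝ} {R : ℝ → ℝ} (h : IsArc A T R) {θ : ℝ} (hθ : θ ∈ Icc 0 T) :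
    HasDerivAt (fun θ => R θ * Real.sin θ ^ 2)
      (2 * R θ ^ 2 * Real.sin θ * (Real.cos θ ^ 3 + A * Real.cos θ ^ 2 * Real.sin θ
        - Real.sin θ ^ 3) / nF A θ (R θ)) θ := by
  obtain ⟨h1, h2, h3⟩ := h θ hθ
  refine (h3.mul ((Real.hasDerivAt_sin θ).pow 2)).congr_deriv ?_
  field_simp
  have := Real.sin_sq_add_cos_sq θ
  simp only [nF, eF, Pi.pow_apply] at h2 ⊢
  push_cast
  linear_combination (2 * R θ ^ 2 * Real.sin θ * (Real.cos θ ^ 3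
    + A * Real.cos θ ^ 2 * Real.sin θ - Real.sin θ ^ 3)) * this

theorem IsArc.hasDerivAt_xy {A T : ℝ} {R : ℝ → ℝ} (h : IsArc A T R) {θ : ℝ} (hθ : θ ∈ Icc 0 T) :
    HasDerivAt (fun θ => R θ * Real.cos θ * Real.sin θ)
      (-R θ * (Real.sin θ ^ 2 - R θ * (Real.cos θ ^ 4 + A * Real.cos θ ^ 3 * Real.sin θ
        - Real.cos θ * Real.sin θ ^ 3)) / nF A θ (R θ)) θ := by
  obtain ⟨h1, h2, h3⟩ := h θ hθ
  refine ((h3.mul (Real.hasDerivAt_cos θ)).mul (Real.hasDerivAt_sin θ)).congr_deriv ?_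
  field_simp
  have := Real.sin_sq_add_cos_sq θ
  simp only [nF, eF, Pi.mul_apply] at h2 ⊢
  linear_combination R θ * (-Real.sin θ ^ 2 + R θ * (Real.cos θ ^ 4
    + A * Real.cos θ ^ 3 * Real.sin θ - Real.cos θ * Real.sin θ ^ 3)) * this

/-- A function which is nondecreasing where it is below `c` stays above `c`. -/
theorem le_of_deriv_nonneg_below {f f' : ℝ → ℝ} {a b c : ℝ} (hab : a ≤ b)
    (hd : ∀ t ∈ Icc a b, HasDerivAt f (f' t) t) (h0 : c ≤ f a)
    (hz : ∀ t ∈ Icc a b, f t ≤ c → 0 ≤ f' t) : c ≤ f b := by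
  by_contra hb
  rw [not_le] at hb
  have hc : ContinuousOn f (Icc a b) := fun t ht => (hd t ht).continuousAt.continuousWithinAt
  set Z : Set ℝ := Icc a b ∩ f ⁻¹' Ici c with hZ
  have hZc : IsClosed Z := hc.preimage_isClosed_of_isClosed isClosed_Icc isClosed_Ici
  have hZk : IsCompact Z := isCompact_Icc.of_isClosed_subset hZc inter_subset_left
  obtain ⟨s, hs, hmax⟩ := hZk.exists_isGreatest ⟨a, ⟨le_rfl, hab⟩, h0⟩
  have hlt : ∀ t ∈ Ioc s b, f t < c := fun t ht => by
    by_contra hcon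
    exact absurd (hmax ⟨⟨hs.1.1.trans ht.1.le, ht.2⟩, not_lt.mp hcon⟩) (not_le.mpr ht.1)
  have hsub : Icc s b ⊆ Icc a b := Icc_subset_Icc_left hs.1.1
  have hmono : MonotoneOn f (Icc s b) := by
    refine monotoneOn_of_deriv_nonneg (convex_Icc s b) (hc.mono hsub)
      (fun t ht => ((hd t (hsub (interior_subset ht))).differentiableAt).differentiableWithinAt)
      fun t ht => ?_
    rw [interior_Icc] at ht
    have ht' := hsub (Ioo_subset_Icc_self ht)
    rw [(hd t ht').deriv]
    exact hz t ht' (hlt t ⟨ht.1, ht.2.le⟩).le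
  have := hmono ⟨le_rfl, hs.1.2⟩ ⟨hs.1.2, le_rfl⟩ hs.1.2
  have hs2 : c ≤ f s := hs.2
  linarith

theorem lyapunov_le {r c s : ℝ} (hr : 0 < r) (hr1 : r ≤ 1 / 8) (hcs : c ^ 2 + s ^ 2 = 1) :
    r * s ^ 2 / 2 * ((1 - r * c * s) ^ 2 + 2 * (r * c * s) ^ 2) + (r * c ^ 2) ^ 2 / 4 ≤ r := by
  have hc1 : c ^ 2 ≤ 1 := by nlinarith [sq_nonneg s]
  have hs1 : s ^ 2 ≤ 1 := by nlinarith [sq_nonneg c]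
  have hu : |r * c * s| ≤ 1 / 8 := by
    have : |c * s| ≤ 1 := abs_le.mpr ⟨by nlinarith [sq_nonneg (c + s)],
      by nlinarith [sq_nonneg (c - s)]⟩
    rw [mul_assoc, abs_mul, abs_of_pos hr]
    calc r * |c * s| ≤ 1 / 8 * 1 := mul_le_mul hr1 this (abs_nonneg _) (by norm_num)
      _ = 1 / 8 := mul_one _
  have b1 : (1 - r * c * s) ^ 2 + 2 * (r * c * s) ^ 2 ≤ 3 / 2 := by
    obtain ⟨h1, h2⟩ := abs_le.mp hu
    generalize r * c * s = u at h1 h2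
    nlinarith
  have b2 : r * s ^ 2 ≤ r := mul_le_of_le_one_right hr.le hs1
  have b3 : r * c ^ 2 ≤ r := mul_le_of_le_one_right hr.le hc1
  have b4 : (r * c ^ 2) ^ 2 ≤ r ^ 2 := pow_le_pow_left₀ (by positivity) b3 2
  have b5 : r * s ^ 2 / 2 * ((1 - r * c * s) ^ 2 + 2 * (r * c * s) ^ 2) ≤ r / 2 * (3 / 2) :=
    mul_le_mul (by linarith) b1 (by positivity) (by linarith)
  have b6 : r ^ 2 ≤ r := by nlinarith
  linarith

/-- A Lyapunov function near the origin, in the coordinates `X = x²`, `Y = y²`, `u = xy`. -/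
theorem exists_lower_bound {A : ℝ} (hA : 0 < A) : ∃ lo > 0, ∃ m > 0, ∀ T R, IsArc A T R →
    lo ≤ R 0 → ∀ θ ∈ Icc 0 T, m ≤ R θ ∧ (θ = Real.pi → lo ≤ R θ) := by
  set lo := A / (30 + 18 * A) with hlo
  have hlo0 : 0 < lo := by positivity
  have hlo1 : lo * (30 + 18 * A) = A := by rw [hlo]; field_simp
  have hlo2 : lo < 1 / 18 := by rw [hlo, div_lt_iff₀ (by positivity)]; linarith
  refine ⟨lo, hlo0, lo ^ 2 / 8, by positivity, fun T R h h0 θ hθ => ?_⟩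
  set V : ℝ → ℝ → ℝ := fun θ r => r * Real.sin θ ^ 2 / 2 * ((1 - r * Real.cos θ * Real.sin θ) ^ 2
    + 2 * (r * Real.cos θ * Real.sin θ) ^ 2) + (r * Real.cos θ ^ 2) ^ 2 / 4 with hV
  have hr : 0 < R θ := (h θ hθ).1
  have hcs : ∀ t, |Real.cos t * Real.sin t| ≤ 1 := fun t => by
    rw [abs_mul]
    exact mul_le_one₀ (Real.abs_cos_le_one t) (abs_nonneg _) (Real.abs_sin_le_one t)
  have key : lo ^ 2 / 4 ≤ V θ (R θ) := by
    refine le_of_deriv_nonneg_below (f := fun θ => V θ (R θ)) hθ.1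
      (f' := fun θ => R θ ^ 2 * Real.cos θ ^ 2 * Real.sin θ ^ 2 * (A - 3 * R θ * Real.cos θ ^ 2
        - 3 * A * R θ * Real.cos θ * Real.sin θ + 6 * R θ ^ 2 * (Real.cos θ ^ 3 * Real.sin θ
          + A * Real.cos θ ^ 2 * Real.sin θ ^ 2 - Real.sin θ ^ 4)) / nF A θ (R θ)) ?_ ?_ ?_
    · intro t ht
      obtain ⟨h1, h2, h3⟩ := h t ⟨ht.1, ht.2.trans hθ.2⟩
      have hx := h.hasDerivAt_x_sq ⟨ht.1, ht.2.trans hθ.2⟩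
      have hy := h.hasDerivAt_y_sq ⟨ht.1, ht.2.trans hθ.2⟩
      have hu := h.hasDerivAt_xy ⟨ht.1, ht.2.trans hθ.2⟩
      refine (((hy.div_const 2).mul (((hu.const_sub 1).pow 2).add
        ((hu.pow 2).const_mul 2))).add ((hx.pow 2).div_const 4)).congr_deriv ?_
      simp only [Pi.add_apply, Pi.pow_apply]
      push_cast
      generalize hn : nF A t (R t) = n at h2 ⊢
      field_simp
      ring
    · have : lo ^ 2 ≤ R 0 ^ 2 := pow_le_pow_left₀ hlo0.le h0 2
      simp only [hV, Real.sin_zero, Real.cos_zero]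
      linarith
    · intro t ht hle
      obtain ⟨h1, h2, -⟩ := h t ⟨ht.1, ht.2.trans hθ.2⟩
      refine div_nonneg (mul_nonneg (by positivity) ?_) h2.le
      have hu := abs_le.mp (hcs t)
      have hc := Real.cos_sq_le_one t
      have hs := Real.sin_sq_le_one t
      have hsc := Real.cos_sq_add_sin_sq t
      set c := Real.cos t
      set s := Real.sin t
      set r := R t
      have hy : r * s ^ 2 ≤ 3 * (lo ^ 2 / 4) := by
        simp only [hV] at hle
        nlinarith [sq_nonneg (r * c ^ 2), mul_nonneg (mul_nonneg h1.le (sq_nonneg s))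
          (sq_nonneg (3 * (r * c * s) - 1))]
      have hx : r * c ^ 2 ≤ lo := by
        refine (abs_le_of_sq_le_sq' ?_ hlo0.le).2
        simp only [hV] at hle
        nlinarith [mul_nonneg (mul_nonneg h1.le (sq_nonneg s))
          (add_nonneg (sq_nonneg (1 - r * c * s)) (mul_nonneg two_pos.le (sq_nonneg (r * c * s))))]
      have hr2 : r ≤ 2 * lo := by
        have : r = r * c ^ 2 + r * s ^ 2 := by rw [← mul_add, hsc, mul_one]
        nlinarith
      have b1 : r * c ^ 2 ≤ r := by nlinarith
      have b2 : A * r * (c * s) ≤ A * r := by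
        have := mul_pos hA h1
        nlinarith [hu.2]
      have b3 : -(1 + 1) ≤ c ^ 3 * s + A * c ^ 2 * s ^ 2 - s ^ 4 := by
        have e1 : -1 ≤ c ^ 2 * (c * s) := by nlinarith [hu.1, sq_nonneg c]
        have e2 : 0 ≤ A * c ^ 2 * s ^ 2 := by positivity
        have e3 : s ^ 4 ≤ 1 := by nlinarith [sq_nonneg s]
        linarith
      have b4 : r ^ 2 ≤ r := by nlinarith
      have b5 : -(2 * r) ≤ r ^ 2 * (c ^ 3 * s + A * c ^ 2 * s ^ 2 - s ^ 4) := by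
        nlinarith [mul_le_mul_of_nonneg_left b3 (sq_nonneg r)]
      linarith [mul_le_mul_of_nonneg_left hr2 hA.le, mul_pos hA hlo0]
  constructor
  · by_contra hc
    rw [not_le] at hc
    have hlo3 : lo ^ 2 < 1 := by nlinarith
    have := lyapunov_le hr (by linarith) (Real.cos_sq_add_sin_sq θ)
    simp only [hV] at key
    linarith
  · rintro rfl
    simp only [hV, Real.sin_pi, Real.cos_pi] at key
    refine (abs_le_of_sq_le_sq' ?_ hr.le).2
    nlinarith

theorem hasDerivAt_acot (v : ℝ) : HasDerivAt acot (-(1 / (1 + v ^ 2))) v :=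
  (Real.hasDerivAt_arctan v).const_sub (Real.pi / 2)

theorem cos_acot (v : ℝ) : Real.cos (acot v) = v * Real.sin (acot v) := by
  have h := Real.sin_pos_of_pos_of_lt_pi (acot_pos v) (acot_lt_pi v)
  exact (div_eq_iff h.ne').mp (cot_acot v)

/-- The orbits with a smaller parameter stay inside a heteroclinic orbit. -/
theorem IsHet.mul_y_sq_le {A As a b T : ℝ} {v z R : ℝ → ℝ} (h : IsHet As v z a b) (hA : 0 < A)
    (hAs : A < As) (hR : IsArc A T R) {τ : ℝ} (hτ : acot (v τ) ≤ T) :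
    z τ ^ 2 * (R (acot (v τ)) * Real.sin (acot (v τ)) ^ 2) ≤ 1 := by
  have hAs0 : 0 < As := hA.trans hAs
  have hmem : ∀ t, τ ≤ t → acot (v t) ∈ Icc 0 T := fun t ht => by
    refine ⟨(acot_pos _).le, le_trans ?_ hτ⟩
    rcases ht.eq_or_lt with rfl | h1
    · exact le_rfl
    · exact (acot_lt (h.strictMono hAs0 h1)).le
  set Y : ℝ → ℝ := fun θ => R θ * Real.sin θ ^ 2 with hY
  set E : ℝ → ℝ := fun t => 1 - z t ^ 2 * Y (acot (v t)) with hE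
  set k : ℝ → ℝ := fun t => 2 * z t ^ 2 * R (acot (v t)) * Real.sin (acot (v t)) ^ 4
    / nF A (acot (v t)) (R (acot (v t))) with hk
  have hd : ∀ t, τ ≤ t → HasDerivAt E (k t * (v t ^ 3 + A * v t ^ 2 - 1
      - (v t ^ 3 + As * v t ^ 2 - 1) - (v t ^ 3 + A * v t ^ 2 - 1) * E t)) t := by
    intro t ht
    obtain ⟨h1, h2, -⟩ := hR _ (hmem t ht)
    have h3 := (hR.hasDerivAt_y_sq (hmem t ht)).comp t ((hasDerivAt_acot (v t)).comp t (h.deriv_v t))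
    refine ((((h.deriv_z t).pow 2).mul h3).const_sub 1).congr_deriv ?_
    simp only [hk, hE, hY, Function.comp_apply, Pi.pow_apply]
    have hs := sin_acot_sq (v t)
    have hs0 := Real.sin_pos_of_pos_of_lt_pi (acot_pos (v t)) (acot_lt_pi (v t))
    unfold nF at h2 ⊢
    simp only [cos_acot] at h2 ⊢
    rw [← hs]
    push_cast
    set s := Real.sin (acot (v t))
    generalize R (acot (v t)) = r at h1 h2 ⊢
    generalize v t = v at h2 ⊢
    obtain ⟨q, hq⟩ : ∃ q, q = 1 + r * s ^ 2 * (v * (v ^ 3 + A * v ^ 2 - 1)) := ⟨_, rfl⟩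
    have hn : s ^ 2 + r * ((v * s) ^ 4 + A * (v * s) ^ 3 * s - v * s * s ^ 3) = s ^ 2 * q := by
      rw [hq]; ring
    rw [hn] at h2 ⊢
    have hq0 : 0 < q := pos_of_mul_pos_right h2 (sq_nonneg s)
    field_simp
    rw [hq]
    ring
  have hk0 : ∀ t, τ ≤ t → 0 ≤ k t := fun t ht => by
    obtain ⟨h1, h2, -⟩ := hR _ (hmem t ht)
    simp only [hk]
    positivity
  have hkc : ∀ t, τ ≤ t → ContinuousAt k t := fun t ht => by
    obtain ⟨h1, h2, h3⟩ := hR _ (hmem t ht)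
    have c1 : ContinuousAt (fun t => acot (v t)) t :=
      (hasDerivAt_acot (v t)).continuousAt.comp h.continuous_v.continuousAt
    have c2 : ContinuousAt (fun t => R (acot (v t))) t :=
      ContinuousAt.comp (g := R) (f := fun t => acot (v t)) h3.continuousAt c1
    have c3 : ContinuousAt (fun t => nF A (acot (v t)) (R (acot (v t)))) t :=
      ContinuousAt.comp (g := fun p : ℝ × ℝ => nF A p.1 p.2)
        (f := fun t => (acot (v t), R (acot (v t))))
        (contDiff_nF A).continuous.continuousAt (c1.prodMk c2)
    have c4 : ContinuousAt (fun t => 2 * z t ^ 2) t :=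
      ((h.continuous_z.pow 2).const_mul 2).continuousAt
    have c5 : ContinuousAt (fun t => Real.sin (acot (v t)) ^ 4) t :=
      (ContinuousAt.comp (g := Real.sin) (f := fun t => acot (v t))
        Real.continuous_sin.continuousAt c1).pow 4
    exact ((c4.mul c2).mul c5).div c3 h2.ne'
  have hb : acot b ∈ Icc 0 T :=
    ⟨(acot_pos b).le, (acot_lt (h.v_lt hAs0 τ)).le.trans hτ⟩
  have hlim : Tendsto E atTop (𝓝 (1 - 0 ^ 2 * Y (acot b))) := by
    refine ((h.z_top.pow 2).mul ?_).const_sub 1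
    exact ((hR.hasDerivAt_y_sq hb).continuousAt.comp
      (hasDerivAt_acot b).continuousAt).tendsto.comp h.v_top
  obtain ⟨τ₂, h2, h3⟩ := ((hlim.eventually (lt_mem_nhds (show (0 : ℝ) < _ by norm_num))).and
    (eventually_ge_atTop τ)).exists
  have hvc : Continuous fun s => v (-s) ^ 3 + A * v (-s) ^ 2 - 1 := by
    exact (show Continuous fun x : ℝ => x ^ 3 + A * x ^ 2 - 1 by fun_prop).comp
      (h.continuous_v.comp continuous_neg)
  have hkc' : ∀ s ∈ Icc (-τ₂) (-τ), ContinuousAt (fun s => k (-s)) s := fun s hs =>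
    ContinuousAt.comp (g := k) (hkc (-s) (le_neg_of_le_neg hs.2)) continuous_neg.continuousAt
  have hd' : ∀ s ∈ Icc (-τ₂) (-τ), HasDerivAt (fun s => E (-s)) _ s := fun s hs =>
    (hd (-s) (le_neg_of_le_neg hs.2)).scomp s (hasDerivAt_neg s)
  have := nonneg_of_deriv_ge (D := fun s => E (-s)) (neg_le_neg h3)
    (c := fun s => k (-s) * (v (-s) ^ 3 + A * v (-s) ^ 2 - 1))
    (fun s hs => ((hkc' s hs).mul hvc.continuousAt).continuousWithinAt) hd' ?_
    (by simpa only [neg_neg] using h2.le)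
  · simp only [hE, hY, neg_neg] at this
    linarith
  · intro s hs
    have h4 := mul_nonneg (hk0 (-s) (le_neg_of_le_neg hs.2))
      (mul_nonneg (sub_nonneg.mpr hAs.le) (sq_nonneg (v (-s))))
    simp only [smul_eq_mul]
    generalize E (-s) = e
    generalize k (-s) = κ at h4 ⊢
    linarith

/-- The derivative of the angular speed in the angle. -/
noncomputable def nDerivF (A θ r : ℝ) : ℝ :=
  2 * Real.sin θ * Real.cos θ + r * (-4 * Real.cos θ ^ 3 * Real.sin θ
    + A * (-3 * Real.cos θ ^ 2 * Real.sin θ ^ 2 + Real.cos θ ^ 4)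
    + Real.sin θ ^ 4 - 3 * Real.cos θ ^ 2 * Real.sin θ ^ 2)

/-- The derivative of the angular speed in the radius. -/
noncomputable def psF (A θ : ℝ) : ℝ :=
  Real.cos θ ^ 4 + A * Real.cos θ ^ 3 * Real.sin θ - Real.cos θ * Real.sin θ ^ 3

theorem IsArc.hasDerivAt_nF {A T : ℝ} {R : ℝ → ℝ} (h : IsArc A T R) {θ : ℝ} (hθ : θ ∈ Icc 0 T) :
    HasDerivAt (fun t => nF A t (R t)) ((nDerivF A θ (R θ) * nF A θ (R θ)
      + psF A θ * eF A θ (R θ)) / nF A θ (R θ)) θ := by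
  obtain ⟨h1, h2, h3⟩ := h θ hθ
  have hs := Real.hasDerivAt_sin θ
  have hc := Real.hasDerivAt_cos θ
  refine ((hs.pow 2).add (h3.mul (((hc.pow 4).add (((hc.pow 3).const_mul A).mul hs)).sub
    (hc.mul (hs.pow 3))))).congr_deriv ?_
  rw [add_div, mul_div_assoc, div_self h2.ne', mul_one]
  simp only [Pi.pow_apply, Pi.add_apply, Pi.sub_apply, Pi.mul_apply, nDerivF, psF]
  push_cast
  ring

theorem turn_pos {A θ r : ℝ} (hr : 0 < r) (h0 : 0 ≤ θ) (h1 : θ ≤ Real.pi / 2)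
    (hn : nF A θ r = 0) : 0 < psF A θ * eF A θ r := by
  have hpi := Real.pi_pos
  have hs : 0 ≤ Real.sin θ := Real.sin_nonneg_of_nonneg_of_le_pi h0 (by linarith)
  have hc : 0 ≤ Real.cos θ := Real.cos_nonneg_of_neg_pi_div_two_le_of_le (by linarith) h1
  have hsc := Real.sin_sq_add_cos_sq θ
  simp only [nF, psF, eF] at hn ⊢
  generalize Real.sin θ = s at *
  generalize Real.cos θ = c at *
  have hs' : 0 < s := by
    refine lt_of_le_of_ne hs fun h => ?_
    subst h
    nlinarith [pow_pos (lt_of_le_of_ne hc (by rintro rfl; norm_num at hsc)) 4]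
  have hc' : 0 < c := by
    refine lt_of_le_of_ne hc fun h => ?_
    subst h
    nlinarith
  have key : c * ((c ^ 4 + A * c ^ 3 * s - c * s ^ 3)
      * (-2 * r * (c * s + r * (-(c ^ 3 * s) - A * c ^ 2 * s ^ 2 + s ^ 4)))) = 2 * s ^ 3 := by
    have e : c * (-2 * r * (c * s + r * (-(c ^ 3 * s) - A * c ^ 2 * s ^ 2 + s ^ 4)))
        = -2 * r * s := by
      linear_combination 2 * r * s * hn - 2 * r * s * hsc
    linear_combination (c ^ 4 + A * c ^ 3 * s - c * s ^ 3) * e - 2 * s * hn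
  exact pos_of_mul_pos_right (key ▸ by positivity) hc'.le

theorem exists_nF_lower (A m M : ℝ) (hm : 0 < m) : ∃ δ > 0, ∀ T R, T ≤ Real.pi / 2 →
    IsArc A T R → (∀ θ ∈ Icc 0 T, m ≤ R θ ∧ R θ ≤ M) → ∀ θ ∈ Icc 0 T, δ ≤ nF A θ (R θ) := by
  set g : ℝ × ℝ → ℝ := fun p => nDerivF A p.1 p.2 * nF A p.1 p.2 + psF A p.1 * eF A p.1 p.2
  have hg : Continuous g := by
    simp only [g, nDerivF, nF, psF, eF]; fun_prop
  have hn := (contDiff_nF A).continuous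
  set K : Set (ℝ × ℝ) := (Icc 0 (Real.pi / 2) ×ˢ Icc m M)
    ∩ ({p | 0 ≤ nF A p.1 p.2} ∩ {p | g p ≤ 0}) with hK
  have hKc : IsCompact K := (isCompact_Icc.prod isCompact_Icc).inter_right
    ((isClosed_le continuous_const hn).inter (isClosed_le hg continuous_const))
  have hpos : ∀ p ∈ K, 0 < nF A p.1 p.2 := by
    rintro ⟨θ, r⟩ ⟨⟨h1, h2⟩, h3, h4⟩
    refine lt_of_le_of_ne h3 fun h0 => ?_
    have := turn_pos (hm.trans_le h2.1) h1.1 h1.2 h0.symm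
    change nDerivF A θ r * nF A θ r + psF A θ * eF A θ r ≤ 0 at h4
    simp only at h0
    rw [← h0] at h4
    linarith
  obtain ⟨μ, hμ, hμK⟩ : ∃ μ > 0, ∀ p ∈ K, μ ≤ nF A p.1 p.2 := by
    rcases K.eq_empty_or_nonempty with he | hne
    · exact ⟨1, one_pos, by simp [he]⟩
    · obtain ⟨p, hp, hmin⟩ := hKc.exists_isMinOn hne hn.continuousOn
      exact ⟨_, hpos p hp, fun q hq => hmin hq⟩
  refine ⟨min μ m / 2, by positivity, fun T R hT hR hb θ hθ => ?_⟩
  have hlt : 0 < min μ m := lt_min hμ hm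
  have := pos_of_deriv_pos_at_zero (f := fun t => nF A t (R t) - min μ m / 2) hθ.1
    (fun t ht => (hR.hasDerivAt_nF ⟨ht.1, ht.2.trans hθ.2⟩).sub_const _) ?_ ?_
  · linarith
  · have h1 := (hb 0 ⟨le_rfl, hθ.1.trans hθ.2⟩).1
    have := min_le_right μ m
    simp only [nF, Real.sin_zero, Real.cos_zero]
    linarith
  · intro t ht _ h0
    have ht' : t ∈ Icc 0 T := ⟨ht.1.le, ht.2.trans hθ.2⟩
    have hnp := (hR t ht').2.1
    refine div_pos ?_ hnp
    by_contra hc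
    have := hμK (t, R t) ⟨⟨⟨ht'.1, ht'.2.trans hT⟩, hb t ht'⟩, hnp.le, not_lt.mp hc⟩
    have h2 := min_le_left μ m
    simp only at this
    linarith

theorem exists_pos_le {f : ℝ → ℝ} {a b : ℝ} (hf : ContinuousOn f (Icc a b))
    (h : ∀ t ∈ Icc a b, 0 < f t) : ∃ c > 0, ∀ t ∈ Icc a b, c ≤ f t := by
  rcases (Icc a b).eq_empty_or_nonempty with he | hne
  · exact ⟨1, one_pos, by simp [he]⟩
  · obtain ⟨p, hp, hmin⟩ := isCompact_Icc.exists_isMinOn hne hf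
    exact ⟨_, h p hp, fun q hq => hmin hq⟩

theorem acot_zero : acot 0 = Real.pi / 2 := by simp [acot]

theorem acot_cot {θ : ℝ} (h0 : 0 < θ) (h1 : θ < Real.pi) :
    acot (Real.cos θ / Real.sin θ) = θ := by
  have e : Real.cos θ / Real.sin θ = Real.tan (Real.pi / 2 - θ) := by
    rw [Real.tan_eq_sin_div_cos, Real.sin_pi_div_two_sub, Real.cos_pi_div_two_sub]
  rw [acot, e, Real.arctan_tan (by linarith) (by linarith)]
  ring

theorem acot_surj {θ u w : ℝ} (h0 : acot w ≤ θ) (h1 : θ ≤ acot u) :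
    ∃ x, u ≤ x ∧ x ≤ w ∧ acot x = θ := by
  have h2 : acot (Real.cos θ / Real.sin θ) = θ :=
    acot_cot ((acot_pos w).trans_le h0) (h1.trans_lt (acot_lt_pi u))
  refine ⟨_, ?_, ?_, h2⟩
  · by_contra hc
    have := acot_lt (not_le.mp hc)
    linarith
  · by_contra hc
    have := acot_lt (not_le.mp hc)
    linarith

theorem psF_acot (A v : ℝ) : psF A (acot v)
    = Real.sin (acot v) ^ 4 * (v * (v ^ 3 + A * v ^ 2 - 1)) := by
  rw [psF, cos_acot]; ring

theorem nF_eq (A θ r : ℝ) : nF A θ r = Real.sin θ ^ 2 + r * psF A θ := rfl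

theorem IsHet.exists_neg_cubic {A As a b : ℝ} {v z : ℝ → ℝ} (h : IsHet As v z a b)
    (hAs : A < As) : ∃ u, a < u ∧ u < 0 ∧ ∀ x ≤ u, x ^ 3 + A * x ^ 2 - 1 < 0 := by
  have hneg : ∀ x ≤ a, x ^ 3 + A * x ^ 2 - 1 < 0 := fun x hx => by
    have h1 := h.cubic_nonpos hx
    have h2 : x ≠ 0 := by have := h.neg; rintro rfl; linarith
    have := mul_pos (sub_pos.mpr hAs) (sq_pos_of_ne_zero h2)
    linarith
  have hc : ContinuousAt (fun x : ℝ => x ^ 3 + A * x ^ 2 - 1) a := by fun_prop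
  obtain ⟨ε, hε, hb⟩ := Metric.eventually_nhds_iff.mp (hc.eventually (gt_mem_nhds (hneg a le_rfl)))
  have ha := h.neg
  refine ⟨a + min (ε / 2) (-a / 2), ?_, ?_, fun x hx => ?_⟩
  · linarith [lt_min (half_pos hε) (by linarith : 0 < -a / 2)]
  · linarith [min_le_right (ε / 2) (-a / 2)]
  · rcases le_total x a with h1 | h1
    · exact hneg x h1
    · refine hb ?_
      rw [Real.dist_eq, abs_of_nonneg (sub_nonneg.mpr h1)]
      linarith [min_le_left (ε / 2) (-a / 2)]

/-- Orbits with a smaller parameter than a heteroclinic one are bounded over half a turn, by a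
bound at the end which does not depend on the start. -/
theorem IsHet.exists_upper_bound {A As a b : ℝ} {v z : ℝ → ℝ} (h : IsHet As v z a b) (hA : 0 < A)
    (hAs : A < As) : ∃ K, ∀ B m, 0 < m → ∃ M, ∃ δ > 0, ∀ T R, T ≤ Real.pi → IsArc A T R →
      R 0 ≤ B → (∀ θ ∈ Icc 0 T, m ≤ R θ) →
        ∀ θ ∈ Icc 0 T, R θ ≤ M ∧ δ ≤ nF A θ (R θ) ∧ (θ = Real.pi → R θ ≤ K) := by
  have hAs0 := hA.trans hAs
  obtain ⟨u, hau, hu0, hu⟩ := h.exists_neg_cubic hAs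
  have hb := h.pos
  obtain ⟨τu, hτu⟩ := h.exists_eq hau (hu0.trans hb)
  obtain ⟨τb, hτb⟩ := h.exists_eq (show a < b / 2 by linarith [h.neg]) (half_lt_self hb)
  -- lower bounds along the heteroclinic orbit
  obtain ⟨c₁, hc₁, hz⟩ := exists_pos_le (f := fun t => z t ^ 2) (a := τu) (b := τb)
    (h.continuous_z.pow 2).continuousOn fun t _ => pow_pos (h.z_pos t) 2
  obtain ⟨c₂, hc₂, hP⟩ := exists_pos_le (a := τu) (b := τb)
    (f := fun τ => v τ * (v τ ^ 3 + As * v τ ^ 2 - 1) + z τ ^ 2)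
    (fun t _ => (h.speed_hasDerivAt t).continuousAt.continuousWithinAt)
    fun t _ => h.speed_pos hAs0 t
  have hpi := Real.pi_pos
  set θb := acot (b / 2) with hθb
  set θu := acot u with hθu
  have hθb0 : 0 < θb := acot_pos _
  have hθbh : θb < Real.pi / 2 := acot_zero ▸ acot_lt (half_pos hb)
  have hθuh : Real.pi / 2 < θu := acot_zero ▸ acot_lt hu0
  have hθu1 : θu < Real.pi := acot_lt_pi _
  obtain ⟨σ, hσ, hs⟩ := exists_pos_le (f := fun t => Real.sin t ^ 2) (a := θb) (b := θu)
    (by fun_prop) fun t ht => pow_pos (Real.sin_pos_of_pos_of_lt_pi (hθb0.trans_le ht.1)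
      (ht.2.trans_lt hθu1)) 2
  obtain ⟨κ, hκ, hk⟩ := exists_pos_le (f := fun t => psF A t + Real.sin t ^ 4 * c₁) (a := θu)
    (b := Real.pi) (by simp only [psF]; fun_prop) fun t ht => by
      rcases ht.2.eq_or_lt with rfl | h1
      · norm_num [psF]
      · obtain ⟨x, hx⟩ : ∃ x, x = Real.cos t / Real.sin t := ⟨_, rfl⟩
        have h0 : acot x = t := hx ▸ acot_cot (by linarith [ht.1]) h1
        have hxu : x ≤ u := by
          by_contra hc
          have := acot_lt (not_le.mp hc)
          linarith [ht.1]
        have h3 := hu x hxu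
        have h4 := Real.sin_pos_of_pos_of_lt_pi (acot_pos x) (acot_lt_pi x)
        rw [← h0, psF_acot]
        have := mul_pos_of_neg_of_neg (hxu.trans_lt hu0) h3
        positivity
  have hcb : 0 < Real.cos θb ^ 2 :=
    pow_pos (Real.cos_pos_of_mem_Ioo ⟨by linarith, hθbh⟩) 2
  set K₀ := 1 / (c₁ * σ) + Real.pi / κ with hK₀
  refine ⟨K₀, fun B m hm => ?_⟩
  set M := max (max (B / Real.cos θb ^ 2) (1 / (c₁ * σ))) (K₀ + 1 / c₁) with hM
  obtain ⟨δ, hδ, hlow⟩ := exists_nF_lower A m M hm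
  refine ⟨M, min δ (min (m * σ ^ 2 * c₂) (κ * m)), by positivity, fun T R hT hR hB hmR => ?_⟩
  have hcmp : ∀ θ ∈ Icc θb θu, θ ≤ T → c₁ * (R θ * Real.sin θ ^ 2) ≤ 1 ∧
      (Real.pi / 2 ≤ θ → R θ * Real.sin θ ^ 4 * c₂ ≤ nF A θ (R θ)) := by
    intro θ hθ hθT
    obtain ⟨x, hx1, hx2, rfl⟩ := acot_surj hθ.1 hθ.2
    obtain ⟨τ, rfl⟩ := h.exists_eq (hau.trans_le hx1) (hx2.trans_lt (half_lt_self hb))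
    have hmono := h.strictMono hAs0
    have hτ : τ ∈ Icc τu τb :=
      ⟨hmono.le_iff_le.mp (hτu ▸ hx1), hmono.le_iff_le.mp (hτb ▸ hx2)⟩
    have h1 := h.mul_y_sq_le hA hAs hR hθT
    have h2 : 0 < R (acot (v τ)) := (hR _ ⟨(acot_pos _).le, hθT⟩).1
    have h3 := sq_nonneg (Real.sin (acot (v τ)))
    refine ⟨(mul_le_mul_of_nonneg_right (hz τ hτ) (mul_nonneg h2.le h3)).trans h1, fun hle => ?_⟩
    have hv : v τ ≤ 0 := by
      by_contra hc
      have := acot_lt (not_le.mp hc)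
      rw [acot_zero] at this
      linarith
    rw [nF_eq, psF_acot]
    have h4 := hP τ hτ
    have h45 := mul_nonneg (sub_nonneg.mpr hAs.le) (sq_nonneg (v τ))
    have h5 : v τ * (v τ ^ 3 + As * v τ ^ 2 - 1) ≤ v τ * (v τ ^ 3 + A * v τ ^ 2 - 1) :=
      mul_le_mul_of_nonpos_left (by linarith) hv
    have h6 : c₂ ≤ v τ * (v τ ^ 3 + A * v τ ^ 2 - 1) + z τ ^ 2 := by linarith
    have h7 := mul_le_mul_of_nonneg_left h6
      (mul_nonneg h2.le (pow_nonneg (Real.sin_pos_of_pos_of_lt_pi (acot_pos (v τ))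
        (acot_lt_pi (v τ))).le 4))
    have h8 := mul_le_mul_of_nonneg_left h1 h3
    generalize v τ * (v τ ^ 3 + A * v τ ^ 2 - 1) = q at *
    linarith
  have hfirst : ∀ θ ∈ Icc 0 T, θ ≤ θb → R θ ≤ B / Real.cos θb ^ 2 := by
    intro θ hθ hle
    have h1 : -R 0 ≤ -(R θ * Real.cos θ ^ 2) := by
      refine le_of_deriv_nonneg_below (f := fun t => -(R t * Real.cos t ^ 2)) hθ.1
        (fun t ht => (hR.hasDerivAt_x_sq ⟨ht.1, ht.2.trans hθ.2⟩).neg) (by simp) ?_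
      intro t ht _
      obtain ⟨h2, h3, -⟩ := hR t ⟨ht.1, ht.2.trans hθ.2⟩
      have h4 : 0 ≤ Real.cos t := Real.cos_nonneg_of_neg_pi_div_two_le_of_le
        (by linarith [ht.1]) (by linarith [ht.2])
      have h5 : 0 ≤ Real.sin t := Real.sin_nonneg_of_nonneg_of_le_pi ht.1 (by linarith [ht.2])
      rw [← neg_div]
      refine div_nonneg ?_ h3.le
      have : 0 ≤ R t * Real.cos t * Real.sin t := by positivity
      linarith
    have h2 : Real.cos θb ^ 2 ≤ Real.cos θ ^ 2 :=
      pow_le_pow_left₀ (Real.cos_pos_of_mem_Ioo ⟨by linarith, hθbh⟩).le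
        (Real.cos_le_cos_of_nonneg_of_le_pi hθ.1 (by linarith) hle) 2
    have h3 := mul_le_mul_of_nonneg_left h2 (hR θ hθ).1.le
    rw [le_div_iff₀ hcb]
    linarith
  have hmid : ∀ θ ∈ Icc θb θu, θ ≤ T → R θ ≤ 1 / (c₁ * σ) := by
    intro θ hθ hle
    have h1 := (hcmp θ hθ hle).1
    have h2 := (hR θ ⟨hθb0.le.trans hθ.1, hle⟩).1
    have h3 := mul_le_mul_of_nonneg_left (hs θ hθ) (mul_nonneg hc₁.le h2.le)
    rw [le_div_iff₀ (by positivity)]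
    linarith
  have hlast : ∀ θ ∈ Icc θu T, c₁ * (R θ * Real.sin θ ^ 2) ≤ 1 ∧ κ * R θ ≤ nF A θ (R θ) := by
    intro θ hθ
    have hmem : ∀ t ∈ Icc θu θ, t ∈ Icc 0 T := fun t ht =>
      ⟨by linarith [ht.1], ht.2.trans hθ.2⟩
    have h1 : -1 ≤ -(c₁ * (R θ * Real.sin θ ^ 2)) := by
      refine le_of_deriv_nonneg_below (f := fun t => -(c₁ * (R t * Real.sin t ^ 2))) hθ.1
        (fun t ht => ((hR.hasDerivAt_y_sq (hmem t ht)).const_mul c₁).neg) ?_ ?_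
      · exact neg_le_neg (hcmp θu ⟨by linarith, le_rfl⟩ (hθ.1.trans hθ.2)).1
      · intro t ht _
        obtain ⟨h2, h3, -⟩ := hR t (hmem t ht)
        rcases (ht.2.trans (hθ.2.trans hT)).eq_or_lt with h4 | h4
        · simp [h4]
        · obtain ⟨x, hx⟩ : ∃ x, x = Real.cos t / Real.sin t := ⟨_, rfl⟩
          have h0 : acot x = t := hx ▸ acot_cot (by linarith [ht.1]) h4
          have hxu : x ≤ u := by
            by_contra hc
            have := acot_lt (not_le.mp hc)
            linarith [ht.1]
          have h5 := Real.sin_pos_of_pos_of_lt_pi (acot_pos x) (acot_lt_pi x)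
          have h6 : Real.cos t ^ 3 + A * Real.cos t ^ 2 * Real.sin t - Real.sin t ^ 3
              = Real.sin t ^ 3 * (x ^ 3 + A * x ^ 2 - 1) := by
            rw [← h0, cos_acot]; ring
          rw [h0] at h5
          rw [h6, ← mul_neg, ← neg_div]
          refine mul_nonneg hc₁.le (div_nonneg ?_ h3.le)
          rw [← mul_neg, ← mul_neg]
          have := (neg_pos.mpr (hu x hxu)).le
          positivity
    have h2 := (hR θ (hmem θ ⟨hθ.1, le_rfl⟩)).1
    have h3 := mul_le_mul_of_nonneg_left (hk θ ⟨hθ.1, hθ.2.trans hT⟩) h2.le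
    have h4 := mul_le_mul_of_nonneg_left (neg_le_neg_iff.mp h1) (sq_nonneg (Real.sin θ))
    refine ⟨neg_le_neg_iff.mp h1, ?_⟩
    rw [nF_eq]
    linarith
  have hx : ∀ θ ∈ Icc θu T, R θ * Real.cos θ ^ 2 ≤ K₀ := by
    intro θ hθ
    have hmem : ∀ t ∈ Icc θu θ, t ∈ Icc θu T := fun t ht => ⟨ht.1, ht.2.trans hθ.2⟩
    have h1 : θu / κ - R θu ≤ θ / κ - R θ * Real.cos θ ^ 2 := by
      refine le_of_deriv_nonneg_below (f := fun t => t / κ - R t * Real.cos t ^ 2) hθ.1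
        (fun t ht => ((hasDerivAt_id t).div_const κ).sub
          (hR.hasDerivAt_x_sq ⟨by linarith [ht.1], (hmem t ht).2⟩)) ?_ ?_
      · have h2 := (hR θu ⟨by linarith, hθ.1.trans hθ.2⟩).1
        have := mul_le_of_le_one_right h2.le (Real.cos_sq_le_one θu)
        linarith
      · intro t ht _
        obtain ⟨h2, h3, -⟩ := hR t ⟨by linarith [ht.1], (hmem t ht).2⟩
        have h4 := (hlast t (hmem t ht)).2
        rw [sub_nonneg, div_le_div_iff₀ h3 hκ, one_mul]
        have h5 : -2 * Real.cos t * Real.sin t ≤ 1 := by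
          linarith [sq_nonneg (Real.cos t + Real.sin t), Real.sin_sq_add_cos_sq t]
        have h6 := mul_le_mul_of_nonneg_left h5 (mul_nonneg hκ.le h2.le)
        linarith
    have h2 := hmid θu ⟨by linarith, le_rfl⟩ (hθ.1.trans hθ.2)
    have h3 : θ / κ ≤ Real.pi / κ := div_le_div_of_nonneg_right (hθ.2.trans hT) hκ.le
    have h4 : 0 ≤ θu / κ := div_nonneg (by linarith) hκ.le
    linarith
  have hRM : ∀ θ ∈ Icc 0 T, R θ ≤ M := by
    intro θ hθ
    rcases le_total θ θb with h1 | h1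
    · exact (hfirst θ hθ h1).trans ((le_max_left _ _).trans (le_max_left _ _))
    rcases le_total θ θu with h2 | h2
    · exact (hmid θ ⟨h1, h2⟩ hθ.2).trans ((le_max_right _ _).trans (le_max_left _ _))
    · refine le_trans ?_ (le_max_right _ _)
      have h3 := hx θ ⟨h2, hθ.2⟩
      have h4 : R θ * Real.sin θ ^ 2 ≤ 1 / c₁ := by
        rw [le_div_iff₀ hc₁]; linarith [(hlast θ ⟨h2, hθ.2⟩).1]
      have h5 : R θ = R θ * Real.cos θ ^ 2 + R θ * Real.sin θ ^ 2 := by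
        rw [← mul_add, Real.cos_sq_add_sin_sq, mul_one]
      linarith
  intro θ hθ
  refine ⟨hRM θ hθ, ?_, ?_⟩
  · rcases le_total θ (Real.pi / 2) with h1 | h1
    · exact (min_le_left _ _).trans (hlow θ R h1 (hR.mono hθ.2)
        (fun t ht => ⟨hmR t ⟨ht.1, ht.2.trans hθ.2⟩, hRM t ⟨ht.1, ht.2.trans hθ.2⟩⟩) θ ⟨hθ.1, le_rfl⟩)
    refine (min_le_right _ _).trans ?_
    have hm' := hmR θ hθ
    rcases le_total θ θu with h2 | h2
    · refine (min_le_left _ _).trans (le_trans ?_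
        ((hcmp θ ⟨by linarith, h2⟩ hθ.2).2 h1))
      have h3 : σ ^ 2 ≤ Real.sin θ ^ 4 := by
        have := pow_le_pow_left₀ hσ.le (hs θ ⟨by linarith, h2⟩) 2
        rwa [← pow_mul] at this
      exact mul_le_mul_of_nonneg_right
        (mul_le_mul hm' h3 (by positivity) (hm.le.trans hm')) hc₂.le
    · exact (min_le_right _ _).trans ((mul_le_mul_of_nonneg_left hm' hκ.le).trans
        (hlast θ ⟨h2, hθ.2⟩).2)
  · rintro rfl
    have := hx Real.pi ⟨hθu1.le, hθ.2⟩
    simpa using this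

theorem abs_cos_pow_mul_sin_pow_le (i j : ℕ) (θ : ℝ) : |Real.cos θ ^ i * Real.sin θ ^ j| ≤ 1 := by
  rw [abs_mul, abs_pow, abs_pow]
  exact mul_le_one₀ (pow_le_one₀ (abs_nonneg _) (Real.abs_cos_le_one θ)) (by positivity)
    (pow_le_one₀ (abs_nonneg _) (Real.abs_sin_le_one θ))

theorem abs_nF_sub_le {A : ℝ} (hA : 0 ≤ A) (θ r s : ℝ) :
    |nF A θ r - nF A θ s| ≤ (2 + A) * |r - s| := by
  have h1 := abs_le.mp (abs_cos_pow_mul_sin_pow_le 4 0 θ)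
  have h2 := abs_le.mp (abs_cos_pow_mul_sin_pow_le 3 1 θ)
  have h3 := abs_le.mp (abs_cos_pow_mul_sin_pow_le 1 3 θ)
  have h4 := mul_le_mul_of_nonneg_left h2.1 hA
  have h5 := mul_le_mul_of_nonneg_left h2.2 hA
  have e : nF A θ r - nF A θ s = (Real.cos θ ^ 4 * Real.sin θ ^ 0
      + A * (Real.cos θ ^ 3 * Real.sin θ ^ 1) - Real.cos θ ^ 1 * Real.sin θ ^ 3) * (r - s) := by
    simp only [nF]; ring
  rw [e, abs_mul]
  refine mul_le_mul_of_nonneg_right (abs_le.mpr ⟨?_, ?_⟩) (abs_nonneg _) <;> linarith [h1.1, h1.2]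

theorem abs_eF_sub_le {A b : ℝ} (hA : 0 ≤ A) {θ r s : ℝ} (hr : |r| ≤ b) (hs : |s| ≤ b) :
    |eF A θ r - eF A θ s| ≤ 2 * (1 + 2 * b * (2 + A)) * |r - s| := by
  have h1 := abs_cos_pow_mul_sin_pow_le 1 1 θ
  have h2 := abs_le.mp (abs_cos_pow_mul_sin_pow_le 3 1 θ)
  have h3 := abs_le.mp (abs_cos_pow_mul_sin_pow_le 2 2 θ)
  have h4 := abs_le.mp (abs_cos_pow_mul_sin_pow_le 0 4 θ)
  have h5 := mul_le_mul_of_nonneg_left h3.1 hA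
  have h6 := mul_le_mul_of_nonneg_left h3.2 hA
  have hq : |-(Real.cos θ ^ 3 * Real.sin θ ^ 1) - A * (Real.cos θ ^ 2 * Real.sin θ ^ 2)
      + Real.cos θ ^ 0 * Real.sin θ ^ 4| ≤ 2 + A :=
    abs_le.mpr ⟨by linarith [h2.1, h2.2], by linarith [h2.1, h2.2]⟩
  have e : eF A θ r - eF A θ s = -2 * (Real.cos θ ^ 1 * Real.sin θ ^ 1
      + (r + s) * (-(Real.cos θ ^ 3 * Real.sin θ ^ 1) - A * (Real.cos θ ^ 2 * Real.sin θ ^ 2)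
      + Real.cos θ ^ 0 * Real.sin θ ^ 4)) * (r - s) := by
    simp only [eF]; ring
  rw [e, abs_mul, abs_mul, abs_neg, abs_two]
  refine mul_le_mul_of_nonneg_right (mul_le_mul_of_nonneg_left ?_ zero_le_two) (abs_nonneg _)
  refine (abs_add_le _ _).trans (add_le_add h1 ?_)
  rw [abs_mul]
  exact mul_le_mul ((abs_add_le _ _).trans (by linarith)) hq (abs_nonneg _)
    (by linarith [abs_nonneg r])

/-- The radial field of the polar equation, truncated away from `[a, b]` and from the zeros of the
angular speed. -/
noncomputable def truncF (A a b d θ r : ℝ) : ℝ :=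
  eF A θ (max a (min r b)) / max (nF A θ (max a (min r b))) d

theorem truncF_eq {A a b d θ r : ℝ} (ha : a ≤ r) (hb : r ≤ b) (hd : d ≤ nF A θ r) :
    truncF A a b d θ r = eF A θ r / nF A θ r := by
  rw [truncF, min_eq_left hb, max_eq_right ha, max_eq_left hd]

theorem abs_clamp_le {a b : ℝ} (ha : 0 ≤ a) (hab : a ≤ b) (r : ℝ) : |max a (min r b)| ≤ b := by
  rw [abs_of_nonneg (ha.trans (le_max_left _ _))]
  exact max_le hab (min_le_right _ _)

theorem abs_clamp_sub_le (a b r s : ℝ) : |max a (min r b) - max a (min s b)| ≤ |r - s| := by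
  refine (abs_max_sub_max_le_max a (min r b) a (min s b)).trans (max_le (by simp) ?_)
  exact (abs_min_sub_min_le_max r b s b).trans (max_le le_rfl (by simp))

theorem abs_truncF_le {A a b d : ℝ} (hA : 0 ≤ A) (ha : 0 ≤ a) (hab : a ≤ b) (hd : 0 < d)
    (θ r : ℝ) : |truncF A a b d θ r| ≤ 2 * (1 + 2 * b * (2 + A)) * b / d := by
  have h1 := abs_clamp_le ha hab r
  have h2 := abs_eF_sub_le hA (θ := θ) h1 (s := 0) (by simpa using ha.trans hab)
  have h3 : 0 < max (nF A θ (max a (min r b))) d := hd.trans_le (le_max_right _ _)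
  have h4 : eF A θ 0 = 0 := by simp [eF]
  rw [h4, sub_zero, sub_zero] at h2
  have hb := ha.trans hab
  rw [truncF, abs_div, abs_of_pos h3]
  exact div_le_div₀ (by positivity) (h2.trans (mul_le_mul_of_nonneg_left h1 (by positivity))) hd
    (le_max_right _ _)

theorem exists_lipschitz_truncF {A a b d : ℝ} (hA : 0 ≤ A) (ha : 0 ≤ a) (hab : a ≤ b)
    (hd : 0 < d) : ∃ K : NNReal, ∀ θ, LipschitzWith K (truncF A a b d θ) := by
  have hb := ha.trans hab
  set E := 2 * (1 + 2 * b * (2 + A)) with hE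
  have hE0 : 0 ≤ E := by positivity
  refine ⟨.mk (E / d + E * b / d * (2 + A) / d) (by positivity), fun θ => ?_⟩
  refine LipschitzWith.of_dist_le_mul fun r s => ?_
  rw [Real.dist_eq, Real.dist_eq, NNReal.coe_mk]
  have h1 := abs_clamp_le ha hab r
  have h2 := abs_clamp_le ha hab s
  have h3 := abs_clamp_sub_le a b r s
  have hs := abs_truncF_le hA ha hab hd θ s
  rw [← hE] at hs
  have e1 := abs_eF_sub_le hA (θ := θ) h1 h2
  have e2 := abs_nF_sub_le hA θ (max a (min r b)) (max a (min s b))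
  simp only [truncF] at hs ⊢
  set p := max a (min r b)
  set q := max a (min s b)
  have m1 : d ≤ max (nF A θ p) d := le_max_right _ _
  have m2 : d ≤ max (nF A θ q) d := le_max_right _ _
  have m3 : |max (nF A θ p) d - max (nF A θ q) d| ≤ |nF A θ p - nF A θ q| :=
    (abs_max_sub_max_le_max _ _ _ _).trans (max_le le_rfl (by simp))
  set u := max (nF A θ p) d
  set w := max (nF A θ q) d
  have hu := hd.trans_le m1
  have hw := hd.trans_le m2
  have e : eF A θ p / u - eF A θ q / w
      = (eF A θ p - eF A θ q) / u - eF A θ q / w * (u - w) / u := by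
    field_simp; ring
  rw [e]
  refine (abs_sub _ _).trans ?_
  rw [add_mul]
  refine add_le_add ?_ ?_
  · rw [abs_div, abs_of_pos hu, div_mul_eq_mul_div]
    exact div_le_div₀ (by positivity) (e1.trans (mul_le_mul_of_nonneg_left h3 hE0)) hd m1
  · rw [abs_div, abs_of_pos hu, abs_mul, div_mul_eq_mul_div, mul_assoc]
    refine div_le_div₀ (by positivity) (mul_le_mul hs ?_ (abs_nonneg _) (by positivity)) hd m1
    exact m3.trans (e2.trans (mul_le_mul_of_nonneg_left h3 (by positivity)))

theorem continuous_truncF {A a b d : ℝ} (hd : 0 < d) (r : ℝ) :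
    Continuous fun θ => truncF A a b d θ r := by
  have h1 : Continuous fun θ => nF A θ (max a (min r b)) := by unfold nF; fun_prop
  have h2 : Continuous fun θ => eF A θ (max a (min r b)) := by unfold eF; fun_prop
  exact h2.div (h1.max continuous_const) fun θ => (hd.trans_le (le_max_right _ _)).ne'

theorem exists_flow_truncF {A a b d : ℝ} (hA : 0 ≤ A) (ha : 0 ≤ a) (hab : a ≤ b) (hd : 0 < d)
    {hi : ℝ} (hhi : 0 ≤ hi) : ∃ Φ : ℝ → ℝ → ℝ, (∀ r ∈ Icc 0 hi, Φ r 0 = r ∧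
      ∀ θ ∈ Icc 0 Real.pi, HasDerivAt (Φ r) (truncF A a b d θ (Φ r θ)) θ) ∧
      ContinuousOn (fun r => Φ r Real.pi) (Icc 0 hi) := by
  obtain ⟨K, hK⟩ := exists_lipschitz_truncF hA ha hab hd
  have hb := ha.trans hab
  have hpi := Real.pi_pos
  set L : ℝ := 2 * (1 + 2 * b * (2 + A)) * b / d with hL
  have hL0 : 0 ≤ L := by positivity
  have h0 : (0 : ℝ) ∈ Icc (-1) (Real.pi + 1) := ⟨by norm_num, by linarith⟩
  have hpl : IsPicardLindelof (truncF A a b d) (⟨0, h0⟩ : Icc (-1 : ℝ) (Real.pi + 1)) (0 : ℝ)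
      (.mk (hi + L * (Real.pi + 1)) (by positivity)) (.mk hi hhi) (.mk L hL0) K :=
    { lipschitzOnWith := fun t _ => (hK t).lipschitzOnWith
      continuousOn := fun x _ => (continuous_truncF hd x).continuousOn
      norm_le := fun t _ x _ => abs_truncF_le hA ha hab hd t x
      mul_max_le := by
        simp only [NNReal.coe_mk, sub_zero, zero_sub, neg_neg]
        rw [max_eq_left (by linarith), add_sub_cancel_left] }
  obtain ⟨Φ, h1, L', h2⟩ :=
    hpl.exists_forall_mem_closedBall_eq_hasDerivWithinAt_lipschitzOnWith
  have hsub : Icc 0 hi ⊆ Metric.closedBall (0 : ℝ) hi := by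
    intro r hr
    rw [mem_closedBall_zero_iff, Real.norm_eq_abs, abs_of_nonneg hr.1]
    exact hr.2
  refine ⟨Φ, fun r hr => ⟨(h1 r (hsub hr)).1, fun θ hθ => ?_⟩, ?_⟩
  · exact ((h1 r (hsub hr)).2 θ ⟨by linarith [hθ.1], by linarith [hθ.2]⟩).hasDerivAt
      (Icc_mem_nhds (by linarith [hθ.1]) (by linarith [hθ.2]))
  · exact ((h2 Real.pi ⟨by linarith, by linarith⟩).continuousOn).mono hsub

theorem continuousOn_nF_comp (A : ℝ) {R : ℝ → ℝ} {s : Set ℝ} (hR : ContinuousOn R s) :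
    ContinuousOn (fun θ => nF A θ (R θ)) s := by
  unfold nF
  fun_prop

theorem continuousOn_min_sub {f g : ℝ → ℝ} {s : Set ℝ} {p q d : ℝ} (hf : ContinuousOn f s)
    (hg : ContinuousOn g s) :
    ContinuousOn (fun t => min (f t - p) (min (q - f t) (g t - d))) s := by
  fun_prop

/-- A continuous function cannot leave the positive half line if nonnegativity up to some time
forces positivity at that time. -/
theorem pos_of_nonneg_imp_pos {φ : ℝ → ℝ} {T : ℝ} (hφ : ContinuousOn φ (Icc 0 T)) (h0 : 0 < φ 0)
    (h : ∀ t ∈ Icc 0 T, (∀ s ∈ Icc 0 t, 0 ≤ φ s) → 0 < φ t) : ∀ t ∈ Icc 0 T, 0 < φ t := by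
  by_contra! hc
  obtain ⟨t₀, ht₀, hc⟩ := hc
  have hS : IsCompact (Icc 0 T ∩ φ ⁻¹' Iic 0) :=
    isCompact_Icc.of_isClosed_subset (hφ.preimage_isClosed_of_isClosed isClosed_Icc isClosed_Iic)
      inter_subset_left
  obtain ⟨t, ⟨ht, htn⟩, hmin⟩ := hS.exists_isLeast ⟨t₀, ht₀, hc⟩
  have hpos : ∀ s ∈ Ico 0 t, 0 < φ s := by
    intro s hs
    by_contra hn
    exact absurd (hmin ⟨⟨hs.1, hs.2.le.trans ht.2⟩, not_lt.mp hn⟩) (not_le.mpr hs.2)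
  have hnn : 0 ≤ φ t := by
    by_contra hn
    have hn := not_le.mp hn
    obtain ⟨s, hs, hs0⟩ := intermediate_value_Icc' ht.1 (hφ.mono (Icc_subset_Icc_right ht.2))
      ⟨hn.le, h0.le⟩
    rcases hs.2.eq_or_lt with rfl | hlt
    · exact hn.ne hs0
    · exact (hpos s ⟨hs.1, hlt⟩).ne' hs0
  refine absurd (h t ht fun s hs => ?_) (not_lt.mpr htn)
  rcases hs.2.eq_or_lt with rfl | hlt
  · exact hnn
  · exact (hpos s ⟨hs.1, hlt⟩).le

/-- In the presence of a heteroclinic orbit for a larger parameter, some orbit closes up after half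
a turn. -/
theorem IsHet.exists_isArc {A As a b : ℝ} {v z : ℝ → ℝ} (h : IsHet As v z a b) (hA : 0 < A)
    (hAs : A < As) : ∃ R, IsArc A Real.pi R ∧ R Real.pi = R 0 := by
  obtain ⟨lo, hlo, m, hm, hlow⟩ := exists_lower_bound hA
  obtain ⟨K, hK⟩ := h.exists_upper_bound hA hAs
  set hi := max K lo with hhi
  obtain ⟨M, δ, hδ, hup⟩ := hK hi m hm
  have hpi := Real.pi_pos
  have hlohi : lo ≤ hi := le_max_right _ _
  have hhi0 : 0 < hi := hlo.trans_le hlohi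
  set p := min m lo / 2 with hp
  set q := max M hi + 1 with hq
  set d := min δ lo / 2 with hd
  have hp1 : p < m := (half_lt_self (lt_min hm hlo)).trans_le (min_le_left _ _)
  have hp2 : p < lo := (half_lt_self (lt_min hm hlo)).trans_le (min_le_right _ _)
  have hp0 : 0 < p := half_pos (lt_min hm hlo)
  have hd1 : d < δ := (half_lt_self (lt_min hδ hlo)).trans_le (min_le_left _ _)
  have hd2 : d < lo := (half_lt_self (lt_min hδ hlo)).trans_le (min_le_right _ _)
  have hd0 : 0 < d := half_pos (lt_min hδ hlo)
  have hq1 : M < q := (le_max_left _ _).trans_lt (lt_add_one _)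
  have hq2 : hi < q := (le_max_right _ _).trans_lt (lt_add_one _)
  obtain ⟨Φ, hΦ, hcont⟩ := exists_flow_truncF hA.le hp0.le (b := q) (by linarith) hd0 hhi0.le
  have hmem : ∀ r ∈ Icc lo hi, r ∈ Icc 0 hi := fun r hr => ⟨hlo.le.trans hr.1, hr.2⟩
  have harc : ∀ r ∈ Icc lo hi, IsArc A Real.pi (Φ r) := by
    intro r hr
    obtain ⟨hr0, hder⟩ := hΦ r (hmem r hr)
    have hc : ContinuousOn (Φ r) (Icc 0 Real.pi) :=
      fun θ hθ => (hder θ hθ).continuousAt.continuousWithinAt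
    set φ : ℝ → ℝ := fun θ => min (Φ r θ - p) (min (q - Φ r θ) (nF A θ (Φ r θ) - d)) with hφ
    have hφc : ContinuousOn φ (Icc 0 Real.pi) := by
      have hn : ContinuousOn (fun θ => nF A θ (Φ r θ)) (Icc 0 Real.pi) :=
        continuousOn_nF_comp A hc
      exact continuousOn_min_sub hc hn
    have hsub : ∀ T ≤ Real.pi, (∀ s ∈ Icc 0 T, 0 ≤ φ s) → IsArc A T (Φ r) := by
      intro T hT hs θ hθ
      have h1 := le_min_iff.mp (hs θ hθ)
      have h2 := le_min_iff.mp h1.2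
      have h3 := hder θ ⟨hθ.1, hθ.2.trans hT⟩
      rw [truncF_eq (by linarith) (by linarith) (by linarith)] at h3
      exact ⟨by linarith, by linarith, h3⟩
    refine hsub Real.pi le_rfl fun s hs => (pos_of_nonneg_imp_pos hφc ?_ ?_ s hs).le
    · have : nF A 0 r = r := by simp [nF]
      simp only [hφ, hr0, this]
      refine lt_min ?_ (lt_min ?_ ?_) <;> linarith [hr.1, hr.2]
    · intro t ht hs
      have h1 := hsub t ht.2 hs
      have h2 := hlow t _ h1 (hr0.symm ▸ hr.1)
      have h3 := hup t _ ht.2 h1 (hr0.symm ▸ hr.2) (fun θ hθ => (h2 θ hθ).1) t ⟨ht.1, le_rfl⟩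
      have h4 := (h2 t ⟨ht.1, le_rfl⟩).1
      refine lt_min ?_ (lt_min ?_ ?_) <;> linarith [h3.1, h3.2.1]
  have hle : ∀ r ∈ Icc lo hi, lo ≤ Φ r Real.pi ∧ Φ r Real.pi ≤ hi := by
    intro r hr
    have hr0 := (hΦ r (hmem r hr)).1
    have h1 := harc r hr
    have h2 := hlow _ _ h1 (hr0.symm ▸ hr.1)
    have h3 := hup _ _ le_rfl h1 (hr0.symm ▸ hr.2) (fun θ hθ => (h2 θ hθ).1) Real.pi
      ⟨hpi.le, le_rfl⟩
    exact ⟨(h2 Real.pi ⟨hpi.le, le_rfl⟩).2 rfl, (h3.2.2 rfl).trans (le_max_left _ _)⟩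
  obtain ⟨r, hr, hr1⟩ := intermediate_value_Icc' hlohi
    (f := fun r => -(r - Φ r Real.pi))
    ((continuousOn_id.sub (hcont.mono fun r hr => hmem r hr)).neg) (show (0 : ℝ) ∈ _ from
      ⟨by simpa using (hle hi ⟨hlohi, le_rfl⟩).2, by simpa using (hle lo ⟨le_rfl, hlohi⟩).1⟩)
  refine ⟨Φ r, harc r hr, ?_⟩
  rw [(hΦ r (hmem r hr)).1]
  simp only [neg_sub, sub_eq_zero] at hr1
  exact hr1

theorem IsArc.exists_isPol {A : ℝ} {R : ℝ → ℝ} (h : IsArc A Real.pi R)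
    (hR : R Real.pi = R 0) : ∃ S, IsPol A S ∧ ∀ θ, S (θ + Real.pi) = S θ := by
  have hpi := Real.pi_pos
  set S : ℝ → ℝ := fun θ => R (θ - ⌊θ / Real.pi⌋ * Real.pi) with hS
  have hSk : ∀ k : ℤ, ∀ θ ∈ Icc (k * Real.pi) (k * Real.pi + Real.pi),
      S θ = R (θ - k * Real.pi) := by
    intro k θ hθ
    rcases hθ.2.eq_or_lt with hlt | hlt
    · have hk : ⌊θ / Real.pi⌋ = k + 1 := by
        rw [Int.floor_eq_iff, le_div_iff₀ hpi, div_lt_iff₀ hpi, hlt]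
        push_cast
        constructor <;> linarith
      simp only [hS]
      rw [hk, hlt]
      push_cast
      rw [show (k : ℝ) * Real.pi + Real.pi - (k + 1) * Real.pi = 0 by ring, ← hR]
      congr 1; ring
    · have hk : ⌊θ / Real.pi⌋ = k := by
        rw [Int.floor_eq_iff, le_div_iff₀ hpi, div_lt_iff₀ hpi]
        exact ⟨hθ.1, by linarith⟩
      simp only [hS]
      rw [hk]
  have hn : ∀ (k : ℤ) (θ r : ℝ), nF A (θ - k * Real.pi) r = nF A θ r := fun k θ r =>
    Function.Periodic.sub_int_mul_eq (f := fun t => nF A t r) (fun t => nF_add_pi A t r) k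
  have he : ∀ (k : ℤ) (θ r : ℝ), eF A (θ - k * Real.pi) r = eF A θ r := fun k θ r =>
    Function.Periodic.sub_int_mul_eq (f := fun t => eF A t r) (fun t => eF_add_pi A t r) k
  have hder : ∀ k : ℤ, ∀ θ ∈ Icc (k * Real.pi) (k * Real.pi + Real.pi),
      0 < S θ ∧ 0 < nF A θ (S θ) ∧ HasDerivWithinAt S (eF A θ (S θ) / nF A θ (S θ))
        (Icc (k * Real.pi) (k * Real.pi + Real.pi)) θ := by
    intro k θ hθ
    obtain ⟨h1, h2, h3⟩ := h (θ - k * Real.pi) ⟨by linarith [hθ.1], by linarith [hθ.2]⟩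
    rw [← hSk k θ hθ] at h1 h2 h3
    rw [hn] at h2 h3
    rw [he] at h3
    exact ⟨h1, h2, (h3.comp_sub_const θ (k * Real.pi)).hasDerivWithinAt.congr (hSk k)
      (hSk k θ hθ)⟩
  have hfl : ∀ θ, θ ∈ Ico (⌊θ / Real.pi⌋ * Real.pi) (⌊θ / Real.pi⌋ * Real.pi + Real.pi) := by
    intro θ
    have h1 := Int.floor_le (θ / Real.pi)
    have h2 := Int.lt_floor_add_one (θ / Real.pi)
    rw [le_div_iff₀ hpi] at h1
    rw [div_lt_iff₀ hpi] at h2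
    exact ⟨h1, by linarith⟩
  refine ⟨S, fun θ => ?_, fun θ => ?_⟩
  · have hθ := hfl θ
    obtain ⟨h1, h2, h3⟩ := hder _ θ (Ico_subset_Icc_self hθ)
    refine ⟨h1, h2, ?_⟩
    rcases hθ.1.eq_or_lt with heq | hlt
    · obtain ⟨-, -, h4⟩ := hder (⌊θ / Real.pi⌋ - 1) θ
        ⟨by push_cast; linarith, by push_cast; linarith⟩
      refine (h4.union h3).hasDerivAt ?_
      filter_upwards [Ioo_mem_nhds (show θ - Real.pi < θ by linarith)
        (show θ < θ + Real.pi by linarith)] with t ht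
      rcases le_total t θ with hle | hle
      · left
        push_cast
        constructor <;> linarith [ht.1]
      · right
        constructor <;> linarith [ht.2]
    · exact h3.hasDerivAt (Icc_mem_nhds hlt hθ.2)
  · have hθ := hfl θ
    rw [hSk _ θ (Ico_subset_Icc_self hθ), hSk (⌊θ / Real.pi⌋ + 1) (θ + Real.pi)
      ⟨by push_cast; linarith [hθ.1], by push_cast; linarith [hθ.2]⟩]
    congr 1
    push_cast
    ring

/-- A positive continuous periodic speed generates a global flow on the line. -/
theorem exists_flow_of_periodic {g : ℝ → ℝ} (hg : Continuous g) (hpos : ∀ θ, 0 < g θ) {P : ℝ}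
    (hP : 0 < P) (hper : Function.Periodic g P) : ∃ ϑ : ℝ → ℝ, (∀ t, HasDerivAt ϑ (g (ϑ t)) t) ∧
      ∃ T > 0, ∀ t, ϑ (t + T) = ϑ t + P := by
  set w : ℝ → ℝ := fun θ => (g θ)⁻¹ with hw
  have hwc : Continuous w := hg.inv₀ fun θ => (hpos θ).ne'
  have hwp : ∀ θ, 0 < w θ := fun θ => inv_pos.mpr (hpos θ)
  have hwper : Function.Periodic w P := fun θ => by simp only [hw, hper θ]
  have h_int : ∀ a b, IntervalIntegrable w volume a b := fun a b => hwc.intervalIntegrable a b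
  set τ : ℝ → ℝ := fun θ => ∫ x in (0 : ℝ)..θ, w x with hτ
  have hder : ∀ θ, HasDerivAt τ (w θ) θ := fun θ =>
    intervalIntegral.integral_hasDerivAt_right (h_int 0 θ)
      (hwc.stronglyMeasurableAtFilter _ _) hwc.continuousAt
  have hmono : StrictMono τ := strictMono_of_hasDerivAt_pos hder hwp
  have hsurj : Function.Surjective τ :=
    (continuous_iff_continuousAt.mpr fun θ => (hder θ).continuousAt).surjective
      (hwper.tendsto_atTop_intervalIntegral_of_pos' (h_int 0 P) hwp hP)
      (hwper.tendsto_atBot_intervalIntegral_of_pos' (h_int 0 P) hwp hP)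
  set e := hmono.orderIsoOfSurjective τ hsurj with he
  have hes : ∀ t, τ (e.symm t) = t := fun t => e.apply_symm_apply t
  refine ⟨e.symm, fun t => ?_, τ P, intervalIntegral.intervalIntegral_pos_of_pos (h_int 0 P) hwp hP,
    fun t => ?_⟩
  · have := (hder (e.symm t)).of_local_left_inverse e.symm.continuous.continuousAt
      (hwp _).ne' (Eventually.of_forall hes)
    simpa only [hw, inv_inv] using this
  · refine hmono.injective ?_
    rw [hes]
    have h1 := intervalIntegral.integral_add_adjacent_intervals (h_int 0 (e.symm t))
      (h_int (e.symm t) (e.symm t + P))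
    rw [hwper.intervalIntegral_add_eq (e.symm t) 0, zero_add] at h1
    simp only [hτ] at hes ⊢
    rw [← h1, hes]

/-- A `π`-periodic polar orbit is traced by a nonconstant periodic solution. -/
theorem IsPol.exists_isPeriodicSol {A : ℝ} {R : ℝ → ℝ} (h : IsPol A R)
    (hper : ∀ θ, R (θ + Real.pi) = R θ) :
    ∃ x y, IsSolXY (-A) x y ∧ IsPeriodicSol x y ∧ NonconstSol x y := by
  have hR : Continuous R := h.contDiff.continuous
  have hg : Continuous fun θ => nF A θ (R θ) := continuous_nF_comp A hR
  have hR2 : ∀ θ, R (θ + 2 * Real.pi) = R θ := fun θ => by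
    rw [show θ + 2 * Real.pi = θ + Real.pi + Real.pi by ring, hper, hper]
  obtain ⟨ϑ, hϑ, T, hT, hϑT⟩ := exists_flow_of_periodic hg (fun θ => (h θ).2.1) Real.two_pi_pos
    (fun θ => by
      rw [hR2, show θ + 2 * Real.pi = θ + Real.pi + Real.pi by ring, nF_add_pi, nF_add_pi])
  have hd : ∀ t, HasDerivAt (fun t => ϑ (-t)) (-nF A (ϑ (-t)) (R (ϑ (-t)))) t := fun t => by
    have := (hϑ (-t)).comp t (hasDerivAt_neg t)
    rwa [mul_neg_one] at this
  have hϑT' : ∀ t, ϑ (-(t + T)) = ϑ (-t) - 2 * Real.pi := fun t => by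
    have := hϑT (-(t + T))
    rw [show -(t + T) + T = -t by ring] at this
    linarith
  have hRT : ∀ t, R (ϑ (-t) - 2 * Real.pi) = R (ϑ (-t)) := fun t => by
    rw [← hR2, sub_add_cancel]
  have hρ : ∀ t, HasDerivAt (fun t => √(R (ϑ (-t))))
      (-eF A (ϑ (-t)) (R (ϑ (-t))) / (2 * √(R (ϑ (-t))))) t := fun t => by
    obtain ⟨h1, h2, h3⟩ := h (ϑ (-t))
    have := ((h3.comp t (hd t)).sqrt h1.ne')
    refine this.congr_deriv ?_
    simp only [Function.comp]
    field_simp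
  have hsol : IsSolXY (-A) (fun t => √(R (ϑ (-t))) * Real.cos (ϑ (-t)))
      (fun t => √(R (ϑ (-t))) * Real.sin (ϑ (-t))) := by
    intro t
    have h1 := (h (ϑ (-t))).1
    have hs := Real.sqrt_pos.mpr h1
    have hsq := Real.sq_sqrt h1.le
    have hcs := Real.sin_sq_add_cos_sq (ϑ (-t))
    have hx := (hρ t).mul (hd t).cos
    have hy := (hρ t).mul (hd t).sin
    set ρ := √(R (ϑ (-t)))
    set c := Real.cos (ϑ (-t)) with hc
    set s := Real.sin (ϑ (-t)) with hs'
    have he : -eF A (ϑ (-t)) (R (ϑ (-t))) / (2 * ρ)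
        = ρ * (c * s + ρ ^ 2 * (-(c ^ 3 * s) - A * c ^ 2 * s ^ 2 + s ^ 4)) := by
      rw [eF, ← hsq, ← hc, ← hs']
      field_simp
    have hn : nF A (ϑ (-t)) (R (ϑ (-t))) = s ^ 2 + ρ ^ 2 * (c ^ 4 + A * c ^ 3 * s - c * s ^ 3) := by
      rw [nF, hsq]
    rw [he, hn] at hx hy
    constructor
    · refine hx.congr_deriv ?_
      linear_combination (ρ * s) * hcs
    · refine hy.congr_deriv ?_
      linear_combination ρ ^ 3 * (-c ^ 3 - A * c ^ 2 * s + s ^ 3) * hcs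
  refine ⟨_, _, hsol, ⟨T, hT, fun t => ?_⟩, ?_⟩
  · simp only [hϑT', hRT, Real.cos_sub_two_pi, Real.sin_sub_two_pi, and_self]
  · by_contra hc
    simp only [NonconstSol, not_exists, not_not, Prod.mk.injEq] at hc
    obtain ⟨h1, h2⟩ := hsol 0
    have h3 := h1.unique ((hasDerivAt_const 0 _).congr_of_eventuallyEq
      (Eventually.of_forall fun t => (hc t 0).1))
    have h4 := h2.unique ((hasDerivAt_const 0 _).congr_of_eventuallyEq
      (Eventually.of_forall fun t => (hc t 0).2))
    simp only at h3 h4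
    rw [h3] at h4
    have h5 : √(R (ϑ (-0))) * Real.cos (ϑ (-0)) = 0 := by
      refine pow_eq_zero_iff three_ne_zero |>.mp ?_
      linarith
    have hs := (Real.sqrt_pos.mpr (h (ϑ (-0))).1).ne'
    have hcs := Real.sin_sq_add_cos_sq (ϑ (-0))
    rw [(mul_eq_zero.mp h3).resolve_left hs, (mul_eq_zero.mp h5).resolve_left hs] at hcs
    norm_num at hcs

end

/-- For `α ∈ (α*, 0)` (where `α*` is the unique heteroclinic parameter) the system
`ẋ = y`, `ẏ = -x³ + αx²y + y³` has exactly one limit cycle: a nonconstant periodic solution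
exists, and any two nonconstant periodic solutions have the same image in `ℝ²`. -/
theorem unique_limit_cycle (αs : ℝ)
    (h₁ : αs < -3 * (4 : ℝ) ^ (-(1 : ℝ) / 3)) (h₂ : HasHeteroclinic αs)
    (huniq : ∀ β : ℝ, β < -3 * (4 : ℝ) ^ (-(1 : ℝ) / 3) → HasHeteroclinic β → β = αs) :
    ∀ α : ℝ, αs < α → α < 0 →
      (∃ x y : ℝ → ℝ, IsSolXY α x y ∧ IsPeriodicSol x y ∧ NonconstSol x y) ∧
      (∀ x₁ y₁ x₂ y₂ : ℝ → ℝ,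
        IsSolXY α x₁ y₁ → IsPeriodicSol x₁ y₁ → NonconstSol x₁ y₁ →
        IsSolXY α x₂ y₂ → IsPeriodicSol x₂ y₂ → NonconstSol x₂ y₂ →
        Set.range (fun t => (x₁ t, y₁ t)) = Set.range (fun t => (x₂ t, y₂ t))) := by
  intro α hα hα0
  obtain ⟨v, z, a, b, h⟩ := h₂.exists_isHet h₁
  have hlt := h.param_lt
  refine ⟨?_, fun _ _ _ _ s₁ p₁ n₁ s₂ p₂ n₂ =>
    range_eq_of_isPeriodicSol hα0 (by linarith) s₁ p₁ n₁ s₂ p₂ n₂⟩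
  obtain ⟨R, hR, hR0⟩ := h.exists_isArc (neg_pos.mpr hα0) (neg_lt_neg hα)
  obtain ⟨S, hS, hper⟩ := hR.exists_isPol hR0
  simpa only [neg_neg] using hS.exists_isPeriodicSol hper
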